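/- arXiv:2505.04220 — 13 statements merged into one kernel-verified Lean document; each statement's English description precedes it below -/
import Mathlib

section
/- Let L be a bounded lattice, e ∈ L \ {0,1}, and cl a closure operator on L such that cl(x) ∉ [e,1] for all x ∈ I_e. Then cl(x) ∧ (x ∨ e) ∈ I_e for every x ∈ I_e. -/
/-- `Par a b` means that `a` and `b` are incomparable. -/
def Par {L : Type*} [Lattice L] (a b : L) : Prop := ¬ a ≤ b ∧ ¬ b ≤ a

theorem closure_mem_incomp {L : Type*} [Lattice L] [BoundedOrder L]
    (e : L) (he0 : e ≠ ⊥) (he1 : e ≠ ⊤)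
    (cl : L → L)
    (hcl_le : ∀ x, x ≤ cl x)
    (hcl_sup : ∀ x y, cl (x ⊔ y) = cl x ⊔ cl y)
    (hcl_idem : ∀ x, cl (cl x) = cl x)
    (hcond : ∀ x, Par x e → cl x ∉ Set.Icc e ⊤) :
    ∀ x, Par x e → Par (cl x ⊓ (x ⊔ e)) e := by
  intro x hx
  refine ⟨fun h => hx.1 ?_, fun h => hcond x hx ⟨h.trans inf_le_left, le_top⟩⟩
  exact (le_inf (hcl_le x) le_sup_left).trans h
end

section
/- Let e ∈ L \ {0,1}, S a t-conorm on [e,1], and cl₁, cl₂ closure operators on L with cl₁(x) ≤ cl₂(x) for all x ∈ L \ [e,1]. Define U : L² → L by: U(x,y) = S(x,y) if (x,y) ∈ [e,1]²; U(x,y) = x if (x,y) ∈ (I_e ∪ ]0,e[) × {e}; U(x,y) = y if (x,y) ∈ {e} × (I_e ∪ ]0,e[); U(x,y) = cl₁(x) ∧ (x ∨ e) if (x,y) ∈ ]0,e[ × ]e,1]; U(x,y) = cl₁(y) ∧ (y ∨ e) if (x,y) ∈ ]e,1] × ]0,e[; U(x,y) = cl₂(x) ∧ (x ∨ e) if (x,y)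 ∈ I_e × ]e,1]; U(x,y) = cl₂(y) ∧ (y ∨ e) if (x,y) ∈ ]e,1] × I_e; and U(x,y) = 0 otherwise. Then U is a uninorm on L with neutral element e if and only if cl₁(x) ∉ [e,1] for all x ∈ ]0,e[ and cl₂(x) ∉ [e,1] for all x ∈ I_e. -/
/-- An element not above `e` is the bottom, lies strictly between the bottom and `e`, or is
incomparable with `e`. -/
theorem eq_bot_or_mem_Ioo_or_par_of_not_le {L : Type*} [Lattice L] [BoundedOrder L] {e x : L}
    (h : ¬ e ≤ x) : x = ⊥ ∨ x ∈ Set.Ioo ⊥ e ∨ Par x e := by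
  by_cases hb : x = ⊥
  · exact Or.inl hb
  by_cases hx : x ≤ e
  · exact Or.inr (Or.inl ⟨bot_lt_iff_ne_bot.mpr hb, lt_of_le_not_ge hx h⟩)
  · exact Or.inr (Or.inr ⟨hx, h⟩)

/-- A t-conorm on `[e, 1]` extends to a uninorm on `L` by letting the elements above `e` other than
`e` act on the elements not above `e` through a monotone idempotent map `f`, and by making the
product of two elements not above `e` trivial. -/
theorem uninorm_of_upper_action {L : Type*} [Lattice L] [BoundedOrder L] {e : L}
    (he : ¬ e ≤ ⊥) {S U : L → L → L} {f : L → L}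
    (hS_mem : ∀ x, e ≤ x → ∀ y, e ≤ y → e ≤ S x y)
    (hS_comm : ∀ x, e ≤ x → ∀ y, e ≤ y → S x y = S y x)
    (hS_assoc : ∀ x, e ≤ x → ∀ y, e ≤ y → ∀ z, e ≤ z → S (S x y) z = S x (S y z))
    (hS_mono : ∀ x, e ≤ x → ∀ y, e ≤ y → ∀ z, e ≤ z → x ≤ y → S x z ≤ S y z)
    (hS_unit : ∀ x, e ≤ x → S e x = x)
    (hf_bot : f ⊥ = ⊥)
    (hf_not : ∀ x, ¬ e ≤ x → ¬ e ≤ f x)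
    (hf_le : ∀ x, ¬ e ≤ x → x ≤ f x)
    (hf_sup : ∀ x, ¬ e ≤ x → f x ≤ x ⊔ e)
    (hf_mono : ∀ x y, ¬ e ≤ x → ¬ e ≤ y → x ≤ y → f x ≤ f y)
    (hf_idem : ∀ x, ¬ e ≤ x → f (f x) = f x)
    (hU_upper : ∀ x y, e ≤ x → e ≤ y → U x y = S x y)
    (hU_lower : ∀ x y, ¬ e ≤ x → ¬ e ≤ y → U x y = ⊥)
    (hU_unit : ∀ x, ¬ e ≤ x → U x e = x)
    (hU_unit' : ∀ x, ¬ e ≤ x → U e x = x)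
    (hU_act : ∀ x y, ¬ e ≤ x → e < y → U x y = f x)
    (hU_act' : ∀ x y, ¬ e ≤ x → e < y → U y x = f x) :
    (∀ x y, U x y = U y x) ∧ (∀ x y z, U (U x y) z = U x (U y z)) ∧
      (∀ x y z, x ≤ y → U x z ≤ U y z) ∧ (∀ x y z, x ≤ y → U z x ≤ U z y) ∧
      (∀ x, U e x = x) := by
  have comm : ∀ x y, U x y = U y x := by
    intro x y
    by_cases hx : e ≤ x <;> by_cases hy : e ≤ y
    · rw [hU_upper x y hx hy, hU_upper y x hy hx, hS_comm x hx y hy]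
    · rcases hx.eq_or_lt with rfl | hx
      · rw [hU_unit y hy, hU_unit' y hy]
      · rw [hU_act y x hy hx, hU_act' y x hy hx]
    · rcases hy.eq_or_lt with rfl | hy
      · rw [hU_unit x hx, hU_unit' x hx]
      · rw [hU_act x y hx hy, hU_act' x y hx hy]
    · rw [hU_lower x y hx hy, hU_lower y x hy hx]
  have unit : ∀ x, U e x = x := by
    intro x
    by_cases hx : e ≤ x
    · rw [hU_upper e x le_rfl hx, hS_unit x hx]
    · exact hU_unit' x hx
  have unit' : ∀ x, U x e = x := fun x => by rw [comm, unit]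
  have le_S : ∀ x y, e ≤ x → e ≤ y → y ≤ S x y := by
    intro x y hx hy
    calc y = S e y := (hS_unit y hy).symm
      _ ≤ S x y := hS_mono e le_rfl x hx y hy hx
  have le_S' : ∀ x y, e ≤ x → e ≤ y → x ≤ S x y := by
    intro x y hx hy
    rw [hS_comm x hx y hy]
    exact le_S y x hy hx
  have mono : ∀ x y z, x ≤ y → U x z ≤ U y z := by
    intro x y z hxy
    by_cases hz : e ≤ z
    · rcases hz.eq_or_lt with rfl | hz'
      · rwa [unit', unit']
      by_cases hx : e ≤ x
      · have hy := hx.trans hxy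
        rw [hU_upper x z hx hz, hU_upper y z hy hz]
        exact hS_mono x hx y hy z hz hxy
      rw [hU_act x z hx hz']
      by_cases hy : e ≤ y
      · rw [hU_upper y z hy hz]
        exact (hf_sup x hx).trans ((sup_le hxy hy).trans (le_S' y z hy hz))
      · rw [hU_act y z hy hz']
        exact hf_mono x y hx hy hxy
    · by_cases hx : e ≤ x
      · rcases hx.eq_or_lt with rfl | hx'
        · rw [unit]
          rcases hxy.eq_or_lt with rfl | hy'
          · rw [unit]
          · rw [hU_act' z y hz hy']
            exact hf_le z hz
        · rw [hU_act' z x hz hx', hU_act' z y hz (hx'.trans_le hxy)]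
      · rw [hU_lower x z hx hz]
        exact bot_le
  have act_act : ∀ x y z, ¬ e ≤ x → e ≤ y → e ≤ z → U (U x y) z = U x (U y z) := by
    intro x y z hx hy hz
    rcases hy.eq_or_lt with rfl | hy'
    · rw [unit', unit]
    rcases hz.eq_or_lt with rfl | hz'
    · rw [unit', unit']
    rw [hU_act x y hx hy', hU_act _ z (hf_not x hx) hz', hf_idem x hx, hU_upper y z hy hz,
      hU_act x _ hx (hy'.trans_le (le_S' y z hy hz))]
  have U_not : ∀ x y, ¬ e ≤ x → e ≤ y → ¬ e ≤ U x y := by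
    intro x y hx hy
    rcases hy.eq_or_lt with rfl | hy'
    · rwa [unit']
    · rw [hU_act x y hx hy']
      exact hf_not x hx
  have bot_act : ∀ z, U ⊥ z = ⊥ := by
    intro z
    by_cases hz : e ≤ z
    · rcases hz.eq_or_lt with rfl | hz'
      · exact unit' _
      · rw [hU_act _ z he hz', hf_bot]
    · exact hU_lower _ _ he hz
  have low_low : ∀ x y z, ¬ e ≤ x → ¬ e ≤ y → U (U x y) z = U x (U y z) := by
    intro x y z hx hy
    rw [hU_lower x y hx hy, bot_act]
    by_cases hz : e ≤ z
    · rw [hU_lower x _ hx (U_not y z hy hz)]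
    · rw [hU_lower y z hy hz, comm, bot_act]
  refine ⟨comm, ?_, mono, fun x y z h => by rw [comm z x, comm z y]; exact mono x y z h, unit⟩
  intro x y z
  by_cases hx : e ≤ x <;> by_cases hy : e ≤ y <;> by_cases hz : e ≤ z
  · rw [hU_upper x y hx hy, hU_upper y z hy hz, hU_upper _ z (hS_mem x hx y hy) hz,
      hU_upper x _ hx (hS_mem y hy z hz), hS_assoc x hx y hy z hz]
  · rw [comm (U x y) z, comm x y, ← act_act z y x hz hy hx, comm z y, comm]
  · rw [comm x y, act_act y x z hy hx hz, comm x z, ← act_act y z x hy hz hx, comm]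
  · rw [comm (U x y) z, comm x y, ← low_low z y x hz hy, comm z y, comm]
  · exact act_act x y z hx hy hz
  · rw [hU_lower _ z (U_not x y hx hy) hz, comm y z, hU_lower x _ hx (U_not z y hz hy)]
  · exact low_low x y z hx hy
  · exact low_low x y z hx hy

theorem uninorm_two_closure_iff {L : Type*} [Lattice L] [BoundedOrder L]
    (e : L) (he0 : e ≠ ⊥) (he1 : e ≠ ⊤)
    (S : L → L → L)
    (hS_mem : ∀ x ∈ Set.Icc e ⊤, ∀ y ∈ Set.Icc e ⊤, S x y ∈ Set.Icc e ⊤)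
    (hS_comm : ∀ x ∈ Set.Icc e ⊤, ∀ y ∈ Set.Icc e ⊤, S x y = S y x)
    (hS_assoc : ∀ x ∈ Set.Icc e ⊤, ∀ y ∈ Set.Icc e ⊤, ∀ z ∈ Set.Icc e ⊤, S (S x y) z = S x (S y z))
    (hS_mono₁ : ∀ x ∈ Set.Icc e ⊤, ∀ y ∈ Set.Icc e ⊤, ∀ z ∈ Set.Icc e ⊤, x ≤ y → S x z ≤ S y z)
    (hS_mono₂ : ∀ x ∈ Set.Icc e ⊤, ∀ y ∈ Set.Icc e ⊤, ∀ z ∈ Set.Icc e ⊤, x ≤ y → S z x ≤ S z y)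
    (hS_unit : ∀ x ∈ Set.Icc e ⊤, S e x = x)
    (cl₁ cl₂ : L → L)
    (hcl₁_le : ∀ x, x ≤ cl₁ x)
    (hcl₁_sup : ∀ x y, cl₁ (x ⊔ y) = cl₁ x ⊔ cl₁ y)
    (hcl₁_idem : ∀ x, cl₁ (cl₁ x) = cl₁ x)
    (hcl₂_le : ∀ x, x ≤ cl₂ x)
    (hcl₂_sup : ∀ x y, cl₂ (x ⊔ y) = cl₂ x ⊔ cl₂ y)
    (hcl₂_idem : ∀ x, cl₂ (cl₂ x) = cl₂ x)
    (hcl₁₂ : ∀ x, x ∉ Set.Icc e ⊤ → cl₁ x ≤ cl₂ x)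
    (U : L → L → L)
    (hU1 : ∀ x y, x ∈ Set.Icc e ⊤ ∧ y ∈ Set.Icc e ⊤ → U x y = S x y)
    (hU2 : ∀ x y, (Par x e ∨ x ∈ Set.Ioo ⊥ e) ∧ y = e → U x y = x)
    (hU3 : ∀ x y, x = e ∧ (Par y e ∨ y ∈ Set.Ioo ⊥ e) → U x y = y)
    (hU4 : ∀ x y, x ∈ Set.Ioo ⊥ e ∧ y ∈ Set.Ioc e ⊤ → U x y = cl₁ x ⊓ (x ⊔ e))
    (hU5 : ∀ x y, x ∈ Set.Ioc e ⊤ ∧ y ∈ Set.Ioo ⊥ e → U x y = cl₁ y ⊓ (y ⊔ e))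
    (hU6 : ∀ x y, Par x e ∧ y ∈ Set.Ioc e ⊤ → U x y = cl₂ x ⊓ (x ⊔ e))
    (hU7 : ∀ x y, x ∈ Set.Ioc e ⊤ ∧ Par y e → U x y = cl₂ y ⊓ (y ⊔ e))
    (hU0 : ∀ x y, ¬(x ∈ Set.Icc e ⊤ ∧ y ∈ Set.Icc e ⊤) → ¬((Par x e ∨ x ∈ Set.Ioo ⊥ e) ∧ y = e) → ¬(x = e ∧ (Par y e ∨ y ∈ Set.Ioo ⊥ e)) → ¬(x ∈ Set.Ioo ⊥ e ∧ y ∈ Set.Ioc e ⊤) → ¬(x ∈ Set.Ioc e ⊤ ∧ y ∈ Set.Ioo ⊥ e) → ¬(Par x e ∧ y ∈ Set.Ioc e ⊤) → ¬(x ∈ Set.Ioc e ⊤ ∧ Par y e) → U x y = ⊥)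
    :
    ((∀ x y, U x y = U y x) ∧ (∀ x y z, U (U x y) z = U x (U y z)) ∧
      (∀ x y z, x ≤ y → U x z ≤ U y z) ∧ (∀ x y z, x ≤ y → U z x ≤ U z y) ∧
      (∀ x, U e x = x)) ↔
      ((∀ x ∈ Set.Ioo ⊥ e, cl₁ x ∉ Set.Icc e ⊤) ∧ (∀ x, Par x e → cl₂ x ∉ Set.Icc e ⊤)) := by
  simp only [Set.mem_Icc, le_top, and_true] at *
  have top_gt : e < ⊤ := lt_top_iff_ne_top.mpr he1
  have not_le_bot : ¬ e ≤ ⊥ := fun h => he0 (le_bot_iff.mp h)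
  have lower_bot : ∀ x y, ¬ e ≤ x → ¬ e ≤ y → U x y = ⊥ := by
    intro x y hx hy
    have hxe : x ≠ e := fun h => hx h.ge
    have hye : y ≠ e := fun h => hy h.ge
    refine hU0 x y ?_ ?_ ?_ ?_ ?_ ?_ ?_ <;> simp [lt_iff_le_and_ne, hx, hy, hxe, hye]
  have bot_left : ∀ y, U ⊥ y = ⊥ := by
    intro y
    refine hU0 ⊥ y ?_ ?_ ?_ ?_ ?_ ?_ ?_ <;>
      simp [Par, not_le_bot, he0.symm, lt_iff_le_and_ne]
  have bot_right : ∀ y, U y ⊥ = ⊥ := by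
    intro y
    refine hU0 y ⊥ ?_ ?_ ?_ ?_ ?_ ?_ ?_ <;>
      simp [Par, not_le_bot, he0.symm, lt_iff_le_and_ne]
  have top_Ioc : (⊤ : L) ∈ Set.Ioc e ⊤ := ⟨top_gt, le_rfl⟩
  have act_Ioo : ∀ x ∈ Set.Ioo ⊥ e, U x ⊤ = cl₁ x ⊓ e := by
    intro x hx
    rw [hU4 x ⊤ ⟨hx, top_Ioc⟩, sup_eq_right.mpr hx.2.le]
  have act_par : ∀ x, Par x e → U x ⊤ = cl₂ x ⊓ (x ⊔ e) := fun x hx => hU6 x ⊤ ⟨hx, top_Ioc⟩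
  constructor
  · rintro ⟨-, assoc, -, -, -⟩
    have eq_bot : ∀ x, ¬ e ≤ x → U x (U x ⊤) = ⊥ := by
      intro x hx
      rw [← assoc, lower_bot x x hx hx, bot_left]
    constructor
    · intro x hx hle
      have h := eq_bot x hx.2.not_ge
      rw [act_Ioo x hx, inf_eq_right.mpr hle, hU2 x e ⟨Or.inr hx, rfl⟩] at h
      exact hx.1.ne' h
    · intro x hx hle
      have h := eq_bot x hx.2
      have hv : e ≤ U x ⊤ := by
        rw [act_par x hx]
        exact le_inf hle le_sup_right
      have hx_le : x ≤ U x (U x ⊤) := by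
        rcases hv.eq_or_lt with hv | hv
        · rw [← hv, hU2 x e ⟨Or.inl hx, rfl⟩]
        · rw [hU6 x _ ⟨hx, hv, le_top⟩]
          exact le_inf (hcl₂_le x) le_sup_left
      rw [h] at hx_le
      exact hx.1 (hx_le.trans bot_le)
  · rintro ⟨h₁, h₂⟩
    have mono₁ : Monotone cl₁ := fun x y h => by
      rw [← sup_eq_right.mpr h, hcl₁_sup]; exact le_sup_left
    have mono₂ : Monotone cl₂ := fun x y h => by
      rw [← sup_eq_right.mpr h, hcl₂_sup]; exact le_sup_left
    have Ioo_act : ∀ x ∈ Set.Ioo ⊥ e, U x ⊤ ∈ Set.Ioo ⊥ e := by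
      intro x hx
      rw [act_Ioo x hx]
      exact ⟨hx.1.trans_le (le_inf (hcl₁_le x) hx.2.le),
        lt_of_le_not_ge inf_le_right fun h => h₁ x hx (h.trans inf_le_left)⟩
    have par_act : ∀ x, Par x e → Par (U x ⊤) e := by
      intro x hx
      rw [act_par x hx]
      exact ⟨fun h => hx.1 ((le_inf (hcl₂_le x) le_sup_left).trans h),
        fun h => h₂ x hx (h.trans inf_le_left)⟩
    have le_act : ∀ x, ¬ e ≤ x → x ≤ U x ⊤ := by
      intro x hx
      rcases eq_bot_or_mem_Ioo_or_par_of_not_le hx with rfl | h | h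
      · exact bot_le
      · rw [act_Ioo x h]
        exact le_inf (hcl₁_le x) h.2.le
      · rw [act_par x h]
        exact le_inf (hcl₂_le x) le_sup_left
    have act_not : ∀ x, ¬ e ≤ x → ¬ e ≤ U x ⊤ := by
      intro x hx
      rcases eq_bot_or_mem_Ioo_or_par_of_not_le hx with rfl | h | h
      · rwa [bot_left]
      · exact (Ioo_act x h).2.not_ge
      · exact (par_act x h).2
    have act_le : ∀ x, ¬ e ≤ x → U x ⊤ ≤ x ⊔ e := by
      intro x hx
      rcases eq_bot_or_mem_Ioo_or_par_of_not_le hx with rfl | h | h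
      · rw [bot_left]
        exact bot_le
      · rw [act_Ioo x h]
        exact inf_le_right.trans le_sup_right
      · rw [act_par x h]
        exact inf_le_right
    have act_mono : ∀ x y, ¬ e ≤ x → ¬ e ≤ y → x ≤ y → U x ⊤ ≤ U y ⊤ := by
      intro x y hx hy hxy
      rcases eq_bot_or_mem_Ioo_or_par_of_not_le hx with rfl | h | h
      · rw [bot_left]
        exact bot_le
      · rcases eq_bot_or_mem_Ioo_or_par_of_not_le hy with rfl | h' | h'
        · exact absurd hxy h.1.not_ge
        · rw [act_Ioo x h, act_Ioo y h']
          exact inf_le_inf_right e (mono₁ hxy)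
        · rw [act_Ioo x h, act_par y h']
          exact inf_le_inf ((hcl₁₂ x hx).trans (mono₂ hxy)) le_sup_right
      · have h' : Par y e := ⟨fun h' => h.1 (hxy.trans h'), hy⟩
        rw [act_par x h, act_par y h']
        exact inf_le_inf (mono₂ hxy) (sup_le_sup_right hxy e)
    have act_idem : ∀ x, ¬ e ≤ x → U (U x ⊤) ⊤ = U x ⊤ := by
      intro x hx
      refine le_antisymm ?_ (le_act _ (act_not x hx))
      rcases eq_bot_or_mem_Ioo_or_par_of_not_le hx with rfl | h | h
      · rw [bot_left, bot_left]
      · rw [act_Ioo _ (Ioo_act x h), act_Ioo x h]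
        exact inf_le_inf_right e ((mono₁ inf_le_left).trans_eq (hcl₁_idem x))
      · rw [act_par _ (par_act x h), act_par x h]
        exact inf_le_inf ((mono₂ inf_le_left).trans_eq (hcl₂_idem x))
          (sup_le inf_le_right le_sup_right)
    refine uninorm_of_upper_action (f := fun x => U x ⊤) not_le_bot hS_mem hS_comm hS_assoc hS_mono₁
      hS_unit (bot_left ⊤) act_not le_act act_le act_mono act_idem
      (fun x y hx hy => hU1 x y ⟨hx, hy⟩) lower_bot ?_ ?_ ?_ ?_
    · intro x hx
      rcases eq_bot_or_mem_Ioo_or_par_of_not_le hx with rfl | h | h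
      · exact bot_left e
      · exact hU2 x e ⟨Or.inr h, rfl⟩
      · exact hU2 x e ⟨Or.inl h, rfl⟩
    · intro x hx
      rcases eq_bot_or_mem_Ioo_or_par_of_not_le hx with rfl | h | h
      · exact bot_right e
      · exact hU3 e x ⟨rfl, Or.inr h⟩
      · exact hU3 e x ⟨rfl, Or.inl h⟩
    · intro x y hx hy
      rcases eq_bot_or_mem_Ioo_or_par_of_not_le hx with rfl | h | h
      · rw [bot_left, bot_left]
      · rw [hU4 x y ⟨h, hy, le_top⟩, hU4 x ⊤ ⟨h, top_Ioc⟩]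
      · rw [hU6 x y ⟨h, hy, le_top⟩, hU6 x ⊤ ⟨h, top_Ioc⟩]
    · intro x y hx hy
      rcases eq_bot_or_mem_Ioo_or_par_of_not_le hx with rfl | h | h
      · rw [bot_left, bot_right]
      · rw [hU5 y x ⟨⟨hy, le_top⟩, h⟩, hU4 x ⊤ ⟨h, top_Ioc⟩]
      · rw [hU7 y x ⟨⟨hy, le_top⟩, h⟩, hU6 x ⊤ ⟨h, top_Ioc⟩]
end

section
/- Let U be the uninorm constructed in Theorem 3.3 (i.e., the piecewise operation built from a t-conorm S on [e,1] and closure operators cl₁ ≤ cl₂ on L \ [e,1] with cl₁(x) ∉ [e,1] for all x ∈ ]0,e[ and cl₂(x) ∉ [e,1] for all x ∈ I_e). If ]0,e[ contains at most one element, or if any two distinct elements of ]0,e[ are incomparable, then U belongs to the class U_min^*, i.e., U(x,y) = y for all (x,y) ∈ ]e,1] × [0,e[. -/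
theorem uninorm_two_closure_Umin_star {L : Type*} [Lattice L] [BoundedOrder L]
    (e : L) (he0 : e ≠ ⊥) (he1 : e ≠ ⊤)
    (S : L → L → L)
    (hS_mem : ∀ x ∈ Set.Icc e ⊤, ∀ y ∈ Set.Icc e ⊤, S x y ∈ Set.Icc e ⊤)
    (hS_comm : ∀ x ∈ Set.Icc e ⊤, ∀ y ∈ Set.Icc e ⊤, S x y = S y x)
    (hS_assoc : ∀ x ∈ Set.Icc e ⊤, ∀ y ∈ Set.Icc e ⊤, ∀ z ∈ Set.Icc e ⊤, S (S x y) z = S x (S y z))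
    (hS_mono₁ : ∀ x ∈ Set.Icc e ⊤, ∀ y ∈ Set.Icc e ⊤, ∀ z ∈ Set.Icc e ⊤, x ≤ y → S x z ≤ S y z)
    (hS_mono₂ : ∀ x ∈ Set.Icc e ⊤, ∀ y ∈ Set.Icc e ⊤, ∀ z ∈ Set.Icc e ⊤, x ≤ y → S z x ≤ S z y)
    (hS_unit : ∀ x ∈ Set.Icc e ⊤, S e x = x)
    (cl₁ cl₂ : L → L)
    (hcl₁_le : ∀ x, x ≤ cl₁ x)
    (hcl₁_sup : ∀ x y, cl₁ (x ⊔ y) = cl₁ x ⊔ cl₁ y)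
    (hcl₁_idem : ∀ x, cl₁ (cl₁ x) = cl₁ x)
    (hcl₂_le : ∀ x, x ≤ cl₂ x)
    (hcl₂_sup : ∀ x y, cl₂ (x ⊔ y) = cl₂ x ⊔ cl₂ y)
    (hcl₂_idem : ∀ x, cl₂ (cl₂ x) = cl₂ x)
    (hcl₁₂ : ∀ x, x ∉ Set.Icc e ⊤ → cl₁ x ≤ cl₂ x)
    (U : L → L → L)
    (hU1 : ∀ x y, x ∈ Set.Icc e ⊤ ∧ y ∈ Set.Icc e ⊤ → U x y = S x y)
    (hU2 : ∀ x y, (Par x e ∨ x ∈ Set.Ioo ⊥ e) ∧ y = e → U x y = x)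
    (hU3 : ∀ x y, x = e ∧ (Par y e ∨ y ∈ Set.Ioo ⊥ e) → U x y = y)
    (hU4 : ∀ x y, x ∈ Set.Ioo ⊥ e ∧ y ∈ Set.Ioc e ⊤ → U x y = cl₁ x ⊓ (x ⊔ e))
    (hU5 : ∀ x y, x ∈ Set.Ioc e ⊤ ∧ y ∈ Set.Ioo ⊥ e → U x y = cl₁ y ⊓ (y ⊔ e))
    (hU6 : ∀ x y, Par x e ∧ y ∈ Set.Ioc e ⊤ → U x y = cl₂ x ⊓ (x ⊔ e))
    (hU7 : ∀ x y, x ∈ Set.Ioc e ⊤ ∧ Par y e → U x y = cl₂ y ⊓ (y ⊔ e))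
    (hU0 : ∀ x y, ¬(x ∈ Set.Icc e ⊤ ∧ y ∈ Set.Icc e ⊤) → ¬((Par x e ∨ x ∈ Set.Ioo ⊥ e) ∧ y = e) → ¬(x = e ∧ (Par y e ∨ y ∈ Set.Ioo ⊥ e)) → ¬(x ∈ Set.Ioo ⊥ e ∧ y ∈ Set.Ioc e ⊤) → ¬(x ∈ Set.Ioc e ⊤ ∧ y ∈ Set.Ioo ⊥ e) → ¬(Par x e ∧ y ∈ Set.Ioc e ⊤) → ¬(x ∈ Set.Ioc e ⊤ ∧ Par y e) → U x y = ⊥)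
    (hcl₁cond : ∀ x ∈ Set.Ioo ⊥ e, cl₁ x ∉ Set.Icc e ⊤)
    (hcl₂cond : ∀ x, Par x e → cl₂ x ∉ Set.Icc e ⊤)
    (hsmall : (Set.Ioo ⊥ e).Subsingleton ∨
      (∀ x ∈ Set.Ioo ⊥ e, ∀ y ∈ Set.Ioo ⊥ e, x ≠ y → Par x y))
    :
    ∀ x ∈ Set.Ioc e ⊤, ∀ y ∈ Set.Ico ⊥ e, U x y = y := by
  intro x hx y hy
  rcases eq_or_ne y ⊥ with rfl | hy0
  · have hx' : ¬ x ≤ e := not_le_of_gt hx.1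
    apply hU0
    · exact fun h => he0 (le_bot_iff.mp h.2.1)
    · exact fun h => he0 h.2.symm
    · exact fun h => hx' h.1.le
    · exact fun h => hx' h.1.2.le
    · exact fun h => lt_irrefl _ h.2.1
    · exact fun h => h.1.2 hx.1.le
    · exact fun h => h.2.1 bot_le
  · have hyI : y ∈ Set.Ioo ⊥ e := ⟨bot_lt_iff_ne_bot.mpr hy0, hy.2⟩
    have hle : y ≤ cl₁ y ⊓ e := le_inf (hcl₁_le y) hy.2.le
    have hlt : cl₁ y ⊓ e < e :=
      inf_lt_right.mpr fun h => hcl₁cond y hyI ⟨h, le_top⟩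
    have hcI : cl₁ y ⊓ e ∈ Set.Ioo ⊥ e := ⟨hyI.1.trans_le hle, hlt⟩
    rw [hU5 x y ⟨hx, hyI⟩, sup_eq_right.mpr hy.2.le]
    rcases hsmall with hs | hs
    · exact hs hcI hyI
    · by_contra hne
      exact (hs _ hcI y hyI hne).2 hle
end

section
/- Let e ∈ L \ {0,1}, S a t-conorm on [e,1], and cl a closure operator on L. Define U : L² → L by: U(x,y) = S(x,y) if (x,y) ∈ [e,1]²; U(x,y) = x if (x,y) ∈ (I_e ∪ ]0,e[) × {e}; U(x,y) = y if (x,y) ∈ {e} × (I_e ∪ ]0,e[); U(x,y) = cl(x) ∧ (x ∨ e) if (x,y) ∈ (I_e ∪ ]0,e[) × ]e,1]; U(x,y) = cl(y) ∧ (y ∨ e) if (x,y) ∈ ]e,1] × (I_e ∪ ]0,e[); and U(x,y) = 0 otherwise. Then U is a uninorm on L with neutral element e if and only if cl(x) ∉ [e,1] for all x ∈ I_e ∪ ]0,e[. -/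
theorem par_or_mem_Ioo_iff {L : Type*} [Lattice L] [BoundedOrder L] {e x : L} :
    (Par x e ∨ x ∈ Set.Ioo ⊥ e) ↔ x ≠ ⊥ ∧ ¬ e ≤ x := by
  constructor
  · rintro (⟨h1, h2⟩ | ⟨h1, h2⟩)
    · exact ⟨fun h => h1 (h ▸ bot_le), h2⟩
    · exact ⟨h1.ne', not_le_of_gt h2⟩
  · rintro ⟨h1, h2⟩
    by_cases h : x ≤ e
    · exact Or.inr ⟨bot_lt_iff_ne_bot.2 h1, lt_of_le_not_ge h h2⟩
    · exact Or.inl ⟨h, h2⟩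

theorem uninorm_one_closure_iff {L : Type*} [Lattice L] [BoundedOrder L]
    (e : L) (he0 : e ≠ ⊥) (he1 : e ≠ ⊤)
    (S : L → L → L)
    (hS_mem : ∀ x ∈ Set.Icc e ⊤, ∀ y ∈ Set.Icc e ⊤, S x y ∈ Set.Icc e ⊤)
    (hS_comm : ∀ x ∈ Set.Icc e ⊤, ∀ y ∈ Set.Icc e ⊤, S x y = S y x)
    (hS_assoc : ∀ x ∈ Set.Icc e ⊤, ∀ y ∈ Set.Icc e ⊤, ∀ z ∈ Set.Icc e ⊤, S (S x y) z = S x (S y z))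
    (hS_mono₁ : ∀ x ∈ Set.Icc e ⊤, ∀ y ∈ Set.Icc e ⊤, ∀ z ∈ Set.Icc e ⊤, x ≤ y → S x z ≤ S y z)
    (hS_mono₂ : ∀ x ∈ Set.Icc e ⊤, ∀ y ∈ Set.Icc e ⊤, ∀ z ∈ Set.Icc e ⊤, x ≤ y → S z x ≤ S z y)
    (hS_unit : ∀ x ∈ Set.Icc e ⊤, S e x = x)
    (cl : L → L)
    (hcl_le : ∀ x, x ≤ cl x)
    (hcl_sup : ∀ x y, cl (x ⊔ y) = cl x ⊔ cl y)
    (hcl_idem : ∀ x, cl (cl x) = cl x)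
    (U : L → L → L)
    (hU1 : ∀ x y, x ∈ Set.Icc e ⊤ ∧ y ∈ Set.Icc e ⊤ → U x y = S x y)
    (hU2 : ∀ x y, (Par x e ∨ x ∈ Set.Ioo ⊥ e) ∧ y = e → U x y = x)
    (hU3 : ∀ x y, x = e ∧ (Par y e ∨ y ∈ Set.Ioo ⊥ e) → U x y = y)
    (hU4 : ∀ x y, (Par x e ∨ x ∈ Set.Ioo ⊥ e) ∧ y ∈ Set.Ioc e ⊤ → U x y = cl x ⊓ (x ⊔ e))
    (hU5 : ∀ x y, x ∈ Set.Ioc e ⊤ ∧ (Par y e ∨ y ∈ Set.Ioo ⊥ e) → U x y = cl y ⊓ (y ⊔ e))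
    (hU0 : ∀ x y, ¬(x ∈ Set.Icc e ⊤ ∧ y ∈ Set.Icc e ⊤) → ¬((Par x e ∨ x ∈ Set.Ioo ⊥ e) ∧ y = e) → ¬(x = e ∧ (Par y e ∨ y ∈ Set.Ioo ⊥ e)) → ¬((Par x e ∨ x ∈ Set.Ioo ⊥ e) ∧ y ∈ Set.Ioc e ⊤) → ¬(x ∈ Set.Ioc e ⊤ ∧ (Par y e ∨ y ∈ Set.Ioo ⊥ e)) → U x y = ⊥)
    :
    ((∀ x y, U x y = U y x) ∧ (∀ x y z, U (U x y) z = U x (U y z)) ∧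
      (∀ x y z, x ≤ y → U x z ≤ U y z) ∧ (∀ x y z, x ≤ y → U z x ≤ U z y) ∧
      (∀ x, U e x = x)) ↔
      (∀ x, (Par x e ∨ x ∈ Set.Ioo ⊥ e) → cl x ∉ Set.Icc e ⊤) := by
  simp only [par_or_mem_Ioo_iff, Set.mem_Icc, Set.mem_Ioc, le_top, and_true] at *
  have hbot : ¬ e ≤ ⊥ := fun h => he0 (le_bot_iff.1 h)
  have hUbl : ∀ y, U ⊥ y = ⊥ := fun y => by
    apply hU0 <;> simp [hbot, Ne.symm he0]
  have hUbr : ∀ y, U y ⊥ = ⊥ := fun y => by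
    apply hU0 <;> simp [hbot, Ne.symm he0]
  have hUNN : ∀ x y, ¬ e ≤ x → ¬ e ≤ y → U x y = ⊥ := fun x y hx hy => by
    apply hU0
    · exact fun h => hx h.1
    · exact fun h => hy h.2.ge
    · exact fun h => hx h.1.ge
    · exact fun h => hy h.2.le
    · exact fun h => hx h.1.le
  have hclm : Monotone cl := fun x y h => by
    have := hcl_sup x y
    rw [sup_eq_right.2 h] at this
    rw [this]
    exact le_sup_left
  constructor
  · rintro ⟨-, hassoc, -, -, -⟩ x hx hcl
    have h1 : U x ⊤ = x ⊔ e := by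
      rw [hU4 x ⊤ ⟨hx, lt_top_iff_ne_top.2 he1⟩]
      exact inf_eq_right.2 (sup_le (hcl_le x) hcl)
    have h2 := hassoc x x ⊤
    rw [hUNN x x hx.2 hx.2, hUbl, h1] at h2
    rcases (le_sup_right : e ≤ x ⊔ e).eq_or_lt with h | h
    · rw [← h, hU2 x e ⟨hx, rfl⟩] at h2
      exact hx.1 h2.symm
    · rw [hU4 _ _ ⟨hx, h⟩] at h2
      exact hx.1 (le_bot_iff.1 (h2 ▸ le_inf (hcl_le x) le_sup_left))
  · intro hcl
    set f : L → L := fun x => cl x ⊓ (x ⊔ e) with hf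
    have hfm : Monotone f := fun x y h => inf_le_inf (hclm h) (sup_le_sup_right h e)
    have hxf : ∀ x, x ≤ f x := fun x => le_inf (hcl_le x) le_sup_left
    have hff : ∀ x, f (f x) = f x := fun x => by
      refine le_antisymm (le_inf ?_ ?_) (hxf _)
      · exact inf_le_left.trans ((hclm inf_le_left).trans (hcl_idem x).le)
      · exact inf_le_right.trans (sup_le inf_le_right le_sup_right)
    have hfN : ∀ x, x ≠ ⊥ ∧ ¬ e ≤ x → f x ≠ ⊥ ∧ ¬ e ≤ f x := fun x hx =>
      ⟨fun h => hx.1 (le_bot_iff.1 (h ▸ hxf x)), fun h => hcl x hx (h.trans inf_le_left)⟩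
    have hcases : ∀ x, x = ⊥ ∨ (x ≠ ⊥ ∧ ¬ e ≤ x) ∨ e ≤ x := fun x => by tauto
    have hSunit' : ∀ x, e ≤ x → S x e = x := fun x hx => by
      rw [hS_comm x hx e le_rfl, hS_unit x hx]
    have hSl : ∀ x y, e ≤ x → e ≤ y → x ≤ S x y := fun x y hx hy => by
      simpa [hSunit' x hx] using hS_mono₂ e le_rfl y hy x hx hy
    have hcomm : ∀ x y, U x y = U y x := fun x y => by
      rcases hcases x with rfl | hx | hx
      · rw [hUbl, hUbr]
      · rcases hcases y with rfl | hy | hy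
        · rw [hUbl, hUbr]
        · rw [hUNN x y hx.2 hy.2, hUNN y x hy.2 hx.2]
        · rcases hy.eq_or_lt with rfl | hy
          · rw [hU2 _ _ ⟨hx, rfl⟩, hU3 _ _ ⟨rfl, hx⟩]
          · rw [hU4 _ _ ⟨hx, hy⟩, hU5 _ _ ⟨hy, hx⟩]
      · rcases hcases y with rfl | hy | hy
        · rw [hUbl, hUbr]
        · rcases hx.eq_or_lt with rfl | hx
          · rw [hU2 _ _ ⟨hy, rfl⟩, hU3 _ _ ⟨rfl, hy⟩]
          · rw [hU4 _ _ ⟨hy, hx⟩, hU5 _ _ ⟨hx, hy⟩]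
        · rw [hU1 _ _ ⟨hx, hy⟩, hU1 _ _ ⟨hy, hx⟩, hS_comm x hx y hy]
    have hNA : ∀ x y, (x ≠ ⊥ ∧ ¬ e ≤ x) → e ≤ y → U x y ≠ ⊥ ∧ ¬ e ≤ U x y := by
      intro x y hx hy
      rcases hy.eq_or_lt with rfl | hy
      · rwa [hU2 _ _ ⟨hx, rfl⟩]
      · rw [hU4 _ _ ⟨hx, hy⟩]
        exact hfN x hx
    have hmono : ∀ x y z, x ≤ y → U x z ≤ U y z := by
      intro x y z hxy
      rcases hcases z with rfl | hz | hz
      · rw [hUbr]; exact bot_le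
      · by_cases hx : e ≤ x
        · rcases hx.eq_or_lt with rfl | hx
          · rw [hU3 _ _ ⟨rfl, hz⟩]
            rcases hxy.eq_or_lt with rfl | hy
            · rw [hU3 _ _ ⟨rfl, hz⟩]
            · rw [hU5 _ _ ⟨hy, hz⟩]
              exact hxf z
          · rw [hU5 _ _ ⟨hx, hz⟩, hU5 _ _ ⟨hx.trans_le hxy, hz⟩]
        · rw [hUNN x z hx hz.2]; exact bot_le
      · rcases hcases x with rfl | hx | hx
        · rw [hUbl]; exact bot_le
        · rcases hcases y with rfl | hy | hy
          · exact absurd (le_bot_iff.1 hxy) hx.1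
          · rcases hz.eq_or_lt with rfl | hz
            · rwa [hU2 _ _ ⟨hx, rfl⟩, hU2 _ _ ⟨hy, rfl⟩]
            · rw [hU4 _ _ ⟨hx, hz⟩, hU4 _ _ ⟨hy, hz⟩]
              exact hfm hxy
          · rw [hU1 _ _ ⟨hy, hz⟩]
            refine le_trans ?_ (hSl y z hy hz)
            rcases hz.eq_or_lt with rfl | hz
            · rwa [hU2 _ _ ⟨hx, rfl⟩]
            · rw [hU4 _ _ ⟨hx, hz⟩]
              exact inf_le_right.trans (sup_le hxy hy)
        · rw [hU1 _ _ ⟨hx, hz⟩, hU1 _ _ ⟨hx.trans hxy, hz⟩]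
          exact hS_mono₁ x hx y (hx.trans hxy) z hz hxy
    have hNAA : ∀ x y z, (x ≠ ⊥ ∧ ¬ e ≤ x) → e ≤ y → e ≤ z → U (U x y) z = U x (S y z) := by
      intro x y z hx hy hz
      rcases hy.eq_or_lt with rfl | hy
      · rw [hU2 _ _ ⟨hx, rfl⟩, hS_unit z hz]
      · have hyz : e < S y z := hy.trans_le (hSl y z hy.le hz)
        rw [hU4 _ _ ⟨hx, hy⟩, hU4 _ _ ⟨hx, hyz⟩]
        rcases hz.eq_or_lt with rfl | hz
        · exact hU2 _ _ ⟨hfN x hx, rfl⟩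
        · rw [hU4 _ _ ⟨hfN x hx, hz⟩]
          exact hff x
    have hAN : ∀ x y, e ≤ x → (y ≠ ⊥ ∧ ¬ e ≤ y) → U x y ≠ ⊥ ∧ ¬ e ≤ U x y :=
      fun x y hx hy => hcomm y x ▸ hNA y x hy hx
    have hassoc : ∀ x y z, U (U x y) z = U x (U y z) := by
      intro x y z
      rcases hcases x with rfl | hx | hx
      · simp only [hUbl]
      · rcases hcases y with rfl | hy | hy
        · simp only [hUbl, hUbr]
        · rcases hcases z with rfl | hz | hz
          · simp only [hUbr]
          · rw [hUNN x y hx.2 hy.2, hUNN y z hy.2 hz.2, hUbl, hUbr]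
          · rw [hUNN x y hx.2 hy.2, hUbl, hUNN x _ hx.2 (hNA y z hy hz).2]
        · rcases hcases z with rfl | hz | hz
          · simp only [hUbr]
          · rw [hUNN _ z (hNA x y hx hy).2 hz.2, hUNN x _ hx.2 (hAN y z hy hz).2]
          · rw [hU1 y z ⟨hy, hz⟩, hNAA x y z hx hy hz]
      · rcases hcases y with rfl | hy | hy
        · simp only [hUbl, hUbr]
        · rcases hcases z with rfl | hz | hz
          · simp only [hUbr]
          · rw [hUNN _ z (hAN x y hx hy).2 hz.2, hUNN y z hy.2 hz.2, hUbr]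
          · rw [hcomm x y, hcomm x (U y z), hNAA y x z hy hx hz, hNAA y z x hy hz hx,
              hS_comm x hx z hz]
        · rcases hcases z with rfl | hz | hz
          · simp only [hUbr]
          · rw [hU1 x y ⟨hx, hy⟩, hcomm _ z, hcomm y z, hcomm x, hNAA z y x hz hy hx,
              hS_comm x hx y hy]
          · rw [hU1 x y ⟨hx, hy⟩, hU1 y z ⟨hy, hz⟩, hU1 _ _ ⟨hS_mem x hx y hy, hz⟩,
              hU1 _ _ ⟨hx, hS_mem y hy z hz⟩, hS_assoc x hx y hy z hz]
    refine ⟨hcomm, hassoc, hmono, fun x y z h => ?_, fun x => ?_⟩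
    · rw [hcomm z x, hcomm z y]
      exact hmono x y z h
    · rcases hcases x with rfl | hx | hx
      · exact hUbr e
      · exact hU3 _ _ ⟨rfl, hx⟩
      · rw [hU1 _ _ ⟨le_rfl, hx⟩, hS_unit x hx]
end

section
/- Let e ∈ L \ {0,1}, S a t-conorm on [e,1], and cl a closure operator on L. Define U : L² → L by: U(x,y) = S(x,y) if (x,y) ∈ [e,1]²; U(x,y) = x if (x,y) ∈ [0,e[ × [e,1] ∪ I_e × {e}; U(x,y) = y if (x,y) ∈ [e,1] × [0,e[ ∪ {e} × I_e; U(x,y) = cl(x) ∧ (x ∨ e) if (x,y) ∈ I_e × ]e,1]; U(x,y) = cl(y) ∧ (y ∨ e) if (x,y) ∈ ]e,1] × I_e; and U(x,y) = 0 otherwise. Then U is a uninorm on L with neutral element e if and only if cl(x) ∉ [e,1] for all x ∈ I_e. -/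
theorem lt_or_eq_or_gt_or_par {L : Type*} [Lattice L] (x e : L) :
    x < e ∨ x = e ∨ e < x ∨ Par x e := by
  by_cases h₁ : x ≤ e
  · rcases h₁.lt_or_eq with h | h <;> simp [h]
  · by_cases h₂ : e ≤ x
    · rcases h₂.lt_or_eq with h | h <;> simp [h]
    · exact Or.inr (Or.inr (Or.inr ⟨h₁, h₂⟩))


theorem uninorm_one_closure_iff' {L : Type*} [Lattice L] [BoundedOrder L]
    (e : L) (he0 : e ≠ ⊥) (he1 : e ≠ ⊤)
    (S : L → L → L)
    (hS_mem : ∀ x ∈ Set.Icc e ⊤, ∀ y ∈ Set.Icc e ⊤, S x y ∈ Set.Icc e ⊤)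
    (hS_comm : ∀ x ∈ Set.Icc e ⊤, ∀ y ∈ Set.Icc e ⊤, S x y = S y x)
    (hS_assoc : ∀ x ∈ Set.Icc e ⊤, ∀ y ∈ Set.Icc e ⊤, ∀ z ∈ Set.Icc e ⊤, S (S x y) z = S x (S y z))
    (hS_mono₁ : ∀ x ∈ Set.Icc e ⊤, ∀ y ∈ Set.Icc e ⊤, ∀ z ∈ Set.Icc e ⊤, x ≤ y → S x z ≤ S y z)
    (hS_mono₂ : ∀ x ∈ Set.Icc e ⊤, ∀ y ∈ Set.Icc e ⊤, ∀ z ∈ Set.Icc e ⊤, x ≤ y → S z x ≤ S z y)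
    (hS_unit : ∀ x ∈ Set.Icc e ⊤, S e x = x)
    (cl : L → L)
    (hcl_le : ∀ x, x ≤ cl x)
    (hcl_sup : ∀ x y, cl (x ⊔ y) = cl x ⊔ cl y)
    (hcl_idem : ∀ x, cl (cl x) = cl x)
    (U : L → L → L)
    (hU1 : ∀ x y, x ∈ Set.Icc e ⊤ ∧ y ∈ Set.Icc e ⊤ → U x y = S x y)
    (hU2 : ∀ x y, (x ∈ Set.Ico ⊥ e ∧ y ∈ Set.Icc e ⊤) ∨ (Par x e ∧ y = e) → U x y = x)
    (hU3 : ∀ x y, (x ∈ Set.Icc e ⊤ ∧ y ∈ Set.Ico ⊥ e) ∨ (x = e ∧ Par y e) → U x y = y)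
    (hU4 : ∀ x y, Par x e ∧ y ∈ Set.Ioc e ⊤ → U x y = cl x ⊓ (x ⊔ e))
    (hU5 : ∀ x y, x ∈ Set.Ioc e ⊤ ∧ Par y e → U x y = cl y ⊓ (y ⊔ e))
    (hU0 : ∀ x y, ¬(x ∈ Set.Icc e ⊤ ∧ y ∈ Set.Icc e ⊤) → ¬((x ∈ Set.Ico ⊥ e ∧ y ∈ Set.Icc e ⊤) ∨ (Par x e ∧ y = e)) → ¬((x ∈ Set.Icc e ⊤ ∧ y ∈ Set.Ico ⊥ e) ∨ (x = e ∧ Par y e)) → ¬(Par x e ∧ y ∈ Set.Ioc e ⊤) → ¬(x ∈ Set.Ioc e ⊤ ∧ Par y e) → U x y = ⊥)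
    :
    ((∀ x y, U x y = U y x) ∧ (∀ x y z, U (U x y) z = U x (U y z)) ∧
      (∀ x y z, x ≤ y → U x z ≤ U y z) ∧ (∀ x y z, x ≤ y → U z x ≤ U z y) ∧
      (∀ x, U e x = x)) ↔
      (∀ x, Par x e → cl x ∉ Set.Icc e ⊤) := by
  have bot_lt : ⊥ < e := bot_lt_iff_ne_bot.2 he0
  have cl_mono : ∀ x y, x ≤ y → cl x ≤ cl y := fun x y h => by
    rw [← sup_eq_right.2 h, hcl_sup]; exact le_sup_left
  have U_ge_ge : ∀ x y, e ≤ x → e ≤ y → U x y = S x y := fun x y hx hy =>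
    hU1 x y ⟨⟨hx, le_top⟩, ⟨hy, le_top⟩⟩
  have U_lt_ge : ∀ x y, x < e → e ≤ y → U x y = x := fun x y hx hy =>
    hU2 x y (Or.inl ⟨⟨bot_le, hx⟩, ⟨hy, le_top⟩⟩)
  have U_ge_lt : ∀ x y, e ≤ x → y < e → U x y = y := fun x y hx hy =>
    hU3 x y (Or.inl ⟨⟨hx, le_top⟩, ⟨bot_le, hy⟩⟩)
  have U_par_gt : ∀ x y, Par x e → e < y → U x y = cl x ⊓ (x ⊔ e) := fun x y hx hy =>
    hU4 x y ⟨hx, ⟨hy, le_top⟩⟩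
  have U_gt_par : ∀ x y, e < x → Par y e → U x y = cl y ⊓ (y ⊔ e) := fun x y hx hy =>
    hU5 x y ⟨⟨hx, le_top⟩, hy⟩
  have U_low : ∀ x y, x < e ∨ Par x e → y < e ∨ Par y e → U x y = ⊥ := by
    intro x y hx hy
    have not_ge : ∀ {z}, z < e ∨ Par z e → ¬ e ≤ z := fun h h' =>
      h.elim (fun h => h.not_ge h') (fun h => h.2 h')
    have hx' := not_ge hx
    have hy' := not_ge hy
    apply hU0
    · exact fun h => hx' h.1.1
    · rintro (h | h)
      · exact hy' h.2.1
      · exact hy' h.2.ge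
    · rintro (h | h)
      · exact hx' h.1.1
      · exact hx' h.1.ge
    · exact fun h => hy' h.2.1.le
    · exact fun h => hx' h.1.1.le
  have unit_left : ∀ x, U e x = x := by
    intro x
    rcases lt_or_eq_or_gt_or_par x e with h | rfl | h | h
    · exact U_ge_lt _ _ le_rfl h
    · rw [U_ge_ge _ _ le_rfl le_rfl, hS_unit _ ⟨le_rfl, le_top⟩]
    · rw [U_ge_ge _ _ le_rfl h.le, hS_unit _ ⟨h.le, le_top⟩]
    · exact hU3 _ _ (Or.inr ⟨rfl, h⟩)
  constructor
  · rintro ⟨-, assoc, -, -, -⟩ x hx hcl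
    have hgt : e < x ⊔ e := lt_of_le_not_ge le_sup_right fun h => hx.1 (le_sup_left.trans h)
    have hU : U x (x ⊔ e) = x ⊔ e := by
      rw [U_par_gt _ _ hx hgt]
      exact inf_eq_right.2 (sup_le (hcl_le x) hcl.1)
    have h := assoc x x (x ⊔ e)
    rw [U_low x x (Or.inr hx) (Or.inr hx), hU, hU, U_lt_ge _ _ bot_lt hgt.le] at h
    exact (bot_lt.trans hgt).ne h
  intro hcl
  have unit_right : ∀ z, U z e = z := by
    intro z
    rcases lt_or_eq_or_gt_or_par z e with h | rfl | h | h
    · exact U_lt_ge _ _ h le_rfl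
    · exact unit_left _
    · rw [U_ge_ge _ _ h.le le_rfl, hS_comm _ ⟨h.le, le_top⟩ _ ⟨le_rfl, le_top⟩,
        hS_unit _ ⟨h.le, le_top⟩]
    · exact hU2 _ _ (Or.inr ⟨h, rfl⟩)
  have comm : ∀ x y, U x y = U y x := by
    intro x y
    rcases lt_or_eq_or_gt_or_par x e with hx | rfl | hx | hx
    · rcases lt_or_eq_or_gt_or_par y e with hy | rfl | hy | hy
      · rw [U_low _ _ (.inl hx) (.inl hy), U_low _ _ (.inl hy) (.inl hx)]
      · rw [unit_left, unit_right]
      · rw [U_lt_ge _ _ hx hy.le, U_ge_lt _ _ hy.le hx]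
      · rw [U_low _ _ (.inl hx) (.inr hy), U_low _ _ (.inr hy) (.inl hx)]
    · rw [unit_left, unit_right]
    · rcases lt_or_eq_or_gt_or_par y e with hy | rfl | hy | hy
      · rw [U_ge_lt _ _ hx.le hy, U_lt_ge _ _ hy hx.le]
      · rw [unit_left, unit_right]
      · rw [U_ge_ge _ _ hx.le hy.le, U_ge_ge _ _ hy.le hx.le,
          hS_comm _ ⟨hx.le, le_top⟩ _ ⟨hy.le, le_top⟩]
      · rw [U_gt_par _ _ hx hy, U_par_gt _ _ hy hx]
    · rcases lt_or_eq_or_gt_or_par y e with hy | rfl | hy | hy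
      · rw [U_low _ _ (.inr hx) (.inl hy), U_low _ _ (.inl hy) (.inr hx)]
      · rw [unit_left, unit_right]
      · rw [U_par_gt _ _ hx hy, U_gt_par _ _ hy hx]
      · rw [U_low _ _ (.inr hx) (.inr hy), U_low _ _ (.inr hy) (.inr hx)]
  have le_S : ∀ x y, e ≤ x → e ≤ y → x ≤ S x y := fun x y hx hy => by
    have h := hS_mono₂ e ⟨le_rfl, le_top⟩ y ⟨hy, le_top⟩ x ⟨hx, le_top⟩ hy
    rwa [hS_comm x ⟨hx, le_top⟩ e ⟨le_rfl, le_top⟩, hS_unit x ⟨hx, le_top⟩] at h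
  have S_gt : ∀ x y, e < x → e < y → e < S x y := fun x y hx hy =>
    hx.trans_le (le_S x y hx.le hy.le)
  have le_f : ∀ x, x ≤ cl x ⊓ (x ⊔ e) := fun x => le_inf (hcl_le x) le_sup_left
  have f_par : ∀ x, Par x e → Par (cl x ⊓ (x ⊔ e)) e := fun x hx =>
    ⟨fun h => hx.1 ((le_f x).trans h), fun h => hcl x hx ⟨h.trans inf_le_left, le_top⟩⟩
  have f_idem : ∀ x, cl (cl x ⊓ (x ⊔ e)) ⊓ (cl x ⊓ (x ⊔ e) ⊔ e) = cl x ⊓ (x ⊔ e) := by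
    intro x
    have h₁ : cl (cl x ⊓ (x ⊔ e)) = cl x :=
      le_antisymm ((cl_mono _ _ inf_le_left).trans (hcl_idem x).le) (cl_mono _ _ (le_f x))
    have h₂ : cl x ⊓ (x ⊔ e) ⊔ e = x ⊔ e :=
      le_antisymm (sup_le inf_le_right le_sup_right) (sup_le_sup_right (le_f x) e)
    rw [h₁, h₂]
  have U_bot_left : ∀ x, U ⊥ x = ⊥ := by
    intro x
    rcases lt_or_eq_or_gt_or_par x e with h | rfl | h | h
    · exact U_low _ _ (.inl bot_lt) (.inl h)
    · exact unit_right _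
    · exact U_lt_ge _ _ bot_lt h.le
    · exact U_low _ _ (.inl bot_lt) (.inr h)
  have U_bot_right : ∀ x, U x ⊥ = ⊥ := fun x => by rw [comm, U_bot_left]
  have assoc : ∀ x y z, U (U x y) z = U x (U y z) := by
    intro x y z
    have S_assoc : e < x → e < y → e < z → S (S x y) z = S x (S y z) := fun hx hy hz =>
      hS_assoc x ⟨hx.le, le_top⟩ y ⟨hy.le, le_top⟩ z ⟨hz.le, le_top⟩
    rcases lt_or_eq_or_gt_or_par x e with hx | rfl | hx | hx
    rotate_left
    · simp only [unit_left]
    all_goals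
      rcases lt_or_eq_or_gt_or_par y e with hy | rfl | hy | hy
      rotate_left
      · simp only [unit_left, unit_right]
    all_goals
      rcases lt_or_eq_or_gt_or_par z e with hz | rfl | hz | hz
      rotate_left
      · simp only [unit_right]
    all_goals
      simp (disch := simp only [hx, hy, hz, S_gt, f_par, true_or, or_true, le_of_lt]) only
        [U_low, U_lt_ge, U_ge_lt, U_par_gt, U_gt_par, U_ge_ge, U_bot_left, U_bot_right, S_assoc,
          f_idem]
  have mono : ∀ x y z, x ≤ y → U x z ≤ U y z := by
    intro x y z hxy
    rcases lt_or_eq_or_gt_or_par z e with hz | rfl | hz | hz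
    · by_cases hx : e ≤ x
      · rw [U_ge_lt _ _ hx hz, U_ge_lt _ _ (hx.trans hxy) hz]
      · rw [U_low x z _ (.inl hz)]
        · exact bot_le
        · rcases lt_or_eq_or_gt_or_par x e with h | h | h | h
          exacts [.inl h, (hx h.ge).elim, (hx h.le).elim, .inr h]
    · rwa [unit_right, unit_right]
    · rcases lt_or_eq_or_gt_or_par x e with hx | rfl | hx | hx
      · rw [U_lt_ge _ _ hx hz.le]
        rcases lt_or_eq_or_gt_or_par y e with hy | rfl | hy | hy
        · rwa [U_lt_ge _ _ hy hz.le]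
        · rw [unit_left]; exact hx.le.trans hz.le
        · rw [U_ge_ge _ _ hy.le hz.le]; exact hxy.trans (le_S _ _ hy.le hz.le)
        · rw [U_par_gt _ _ hy hz]; exact hxy.trans (le_f y)
      · rw [U_ge_ge _ _ le_rfl hz.le, U_ge_ge _ _ hxy hz.le]
        exact hS_mono₁ _ ⟨le_rfl, le_top⟩ _ ⟨hxy, le_top⟩ _ ⟨hz.le, le_top⟩ hxy
      · have hy := hx.le.trans hxy
        rw [U_ge_ge _ _ hx.le hz.le, U_ge_ge _ _ hy hz.le]
        exact hS_mono₁ _ ⟨hx.le, le_top⟩ _ ⟨hy, le_top⟩ _ ⟨hz.le, le_top⟩ hxy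
      · rw [U_par_gt _ _ hx hz]
        by_cases hy : e ≤ y
        · rw [U_ge_ge _ _ hy hz.le]
          exact inf_le_right.trans ((sup_le hxy hy).trans (le_S _ _ hy hz.le))
        · have hy' : Par y e := ⟨fun h => hx.1 (hxy.trans h), hy⟩
          rw [U_par_gt _ _ hy' hz]
          exact inf_le_inf (cl_mono _ _ hxy) (sup_le_sup_right hxy e)
    · rcases lt_or_eq_or_gt_or_par x e with hx | rfl | hx | hx
      · rw [U_low _ _ (.inl hx) (.inr hz)]; exact bot_le
      · rw [unit_left]
        rcases hxy.eq_or_lt with rfl | hy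
        · rw [unit_left]
        · rw [U_gt_par _ _ hy hz]; exact le_f z
      · rw [U_gt_par _ _ hx hz, U_gt_par _ _ (hx.trans_le hxy) hz]
      · rw [U_low _ _ (.inr hx) (.inr hz)]; exact bot_le
  exact ⟨comm, assoc, mono, fun x y z h => by rw [comm z x, comm z y]; exact mono x y z h,
    unit_left⟩
end

section
/- Let e ∈ L \ {0,1}, T a t-norm on [0,e], and int₁, int₂ interior operators on L with int₂(x) ≤ int₁(x) for all x ∈ L \ [0,e]. Define U : L² → L by: U(x,y) = T(x,y) if (x,y) ∈ [0,e]²; U(x,y) = x if (x,y) ∈ (I_e ∪ ]e,1[) × {e}; U(x,y) = y if (x,y) ∈ {e} × (I_e ∪ ]e,1[); U(x,y) = int₂(x) ∨ (x ∧ e) if (x,y) ∈ I_e × [0,e[; U(x,y) = int₂(y) ∨ (y ∧ e) if (x,y) ∈ [0,e[ × I_e; U(x,y) = int₁(x) ∨ (x ∧ e) if (x,y) ∈ ]e,1[ × [0,e[; U(x,y) = int₁(y) ∨ (y ∧ e) if (x,y) ∈ [0,e[ × ]e,1[; and U(x,y) = 1 otherwise. Then U is a uninorm on L with neutral element e if and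 only if int₂(x) ∉ [0,e] for all x ∈ I_e and int₁(x) ∉ [0,e] for all x ∈ ]e,1[. -/
section

variable {L : Type*} [Lattice L] [BoundedOrder L] {e : L} {T U : L → L → L} {G : L → L}

/-- An operation built from a t-norm on `[⊥, e]`, the constant `⊤` outside `[⊥, e]`, and a map `G`
on the two mixed regions is commutative. -/
theorem comm_of_mixed
    (hT_comm : ∀ x ≤ e, ∀ y ≤ e, T x y = T y x)
    (hle : ∀ x y, x ≤ e → y ≤ e → U x y = T x y)
    (htop : ∀ x y, ¬x ≤ e → ¬y ≤ e → U x y = ⊤)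
    (hleft : ∀ x y, x < e → ¬y ≤ e → U x y = G y)
    (hright : ∀ x y, ¬x ≤ e → y < e → U x y = G x)
    (heleft : ∀ x, ¬x ≤ e → U e x = x) (heright : ∀ x, ¬x ≤ e → U x e = x) (x y : L) :
    U x y = U y x := by
  by_cases hx : x ≤ e <;> by_cases hy : y ≤ e
  · rw [hle x y hx hy, hle y x hy hx, hT_comm x hx y hy]
  · rcases hx.lt_or_eq with h | rfl
    · rw [hleft x y h hy, hright y x hy h]
    · rw [heleft y hy, heright y hy]
  · rcases hy.lt_or_eq with h | rfl
    · rw [hleft y x h hx, hright x y hx h]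
    · rw [heleft x hx, heright x hx]
  · rw [htop x y hx hy, htop y x hy hx]

/-- Monotonicity in the second variable, when `x ⊓ e ≤ G x ≤ x` and `G` is monotone off `[⊥, e]`. -/
theorem mono_right_of_mixed
    (hT_comm : ∀ x ≤ e, ∀ y ≤ e, T x y = T y x)
    (hT_mono : ∀ x ≤ e, ∀ y ≤ e, ∀ z ≤ e, x ≤ y → T z x ≤ T z y)
    (hT_unit : ∀ x ≤ e, T e x = x)
    (hle : ∀ x y, x ≤ e → y ≤ e → U x y = T x y)
    (htop : ∀ x y, ¬x ≤ e → ¬y ≤ e → U x y = ⊤)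
    (hleft : ∀ x y, x < e → ¬y ≤ e → U x y = G y)
    (hright : ∀ x y, ¬x ≤ e → y < e → U x y = G x)
    (heleft : ∀ x, ¬x ≤ e → U e x = x) (heright : ∀ x, ¬x ≤ e → U x e = x)
    (hG_le : ∀ x, ¬x ≤ e → G x ≤ x) (hG_inf : ∀ x, ¬x ≤ e → x ⊓ e ≤ G x)
    (hG_mono : ∀ x y, ¬x ≤ e → ¬y ≤ e → x ≤ y → G x ≤ G y) (x y z : L) (hxy : x ≤ y) :
    U z x ≤ U z y := by
  by_cases hz : z ≤ e
  · by_cases hy : y ≤ e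
    · have hx := hxy.trans hy
      rw [hle z x hz hx, hle z y hz hy]
      exact hT_mono x hx y hy z hz hxy
    by_cases hx : x ≤ e
    · have hTx : T z x ≤ x := by
        rw [hT_comm z hz x hx]
        refine (hT_mono z hz e le_rfl x hx hz).trans_eq ?_
        rw [hT_comm x hx e le_rfl, hT_unit x hx]
      rw [hle z x hz hx]
      refine hTx.trans ?_
      rcases hz.lt_or_eq with h | rfl
      · rw [hleft z y h hy]
        exact (le_inf hxy hx).trans (hG_inf y hy)
      · rwa [heleft y hy]
    · rcases hz.lt_or_eq with h | rfl
      · rw [hleft z x h hx, hleft z y h hy]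
        exact hG_mono x y hx hy hxy
      · rwa [heleft x hx, heleft y hy]
  · by_cases hy : y ≤ e
    · rcases hy.lt_or_eq with h | rfl
      · rw [hright z x hz (hxy.trans_lt h), hright z y hz h]
      · rcases hxy.lt_or_eq with h | rfl
        · rw [hright z x hz h, heright z hz]
          exact hG_le z hz
        · exact le_rfl
    · rw [htop z y hz hy]
      exact le_top

/-- Associativity, when `G` is an idempotent self-map of the complement of `[⊥, e]`. -/
theorem assoc_of_mixed
    (hT_mem : ∀ x ≤ e, ∀ y ≤ e, T x y ≤ e)
    (hT_comm : ∀ x ≤ e, ∀ y ≤ e, T x y = T y x)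
    (hT_assoc : ∀ x ≤ e, ∀ y ≤ e, ∀ z ≤ e, T (T x y) z = T x (T y z))
    (hT_mono : ∀ x ≤ e, ∀ y ≤ e, ∀ z ≤ e, x ≤ y → T z x ≤ T z y)
    (hT_unit : ∀ x ≤ e, T e x = x) (he1 : ¬⊤ ≤ e)
    (hle : ∀ x y, x ≤ e → y ≤ e → U x y = T x y)
    (htop : ∀ x y, ¬x ≤ e → ¬y ≤ e → U x y = ⊤)
    (hleft : ∀ x y, x < e → ¬y ≤ e → U x y = G y)
    (hright : ∀ x y, ¬x ≤ e → y < e → U x y = G x)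
    (heleft : ∀ x, ¬x ≤ e → U e x = x) (heright : ∀ x, ¬x ≤ e → U x e = x)
    (hG_top : G ⊤ = ⊤) (hG_mem : ∀ x, ¬x ≤ e → ¬G x ≤ e)
    (hG_idem : ∀ x, ¬x ≤ e → G (G x) = G x) (x y z : L) :
    U (U x y) z = U x (U y z) := by
  have comm := comm_of_mixed hT_comm hle htop hleft hright heleft heright
  have unit : ∀ x, U e x = x := fun x => by
    by_cases hx : x ≤ e
    · rw [hle e x le_rfl hx, hT_unit x hx]
    · exact heleft x hx
  rcases eq_or_ne x e with rfl | hxe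
  · rw [unit, unit]
  rcases eq_or_ne y e with rfl | hye
  · rw [comm x y, unit, unit]
  rcases eq_or_ne z e with rfl | hze
  · rw [comm _ z, unit, comm y z, unit]
  have hT_lt : ∀ x y, x < e → y < e → T x y < e := fun x y hx hy => by
    refine lt_of_le_of_lt (hT_mono y hy.le e le_rfl x hx.le hy.le) ?_
    rwa [hT_comm x hx.le e le_rfl, hT_unit x hx.le]
  by_cases hx : x ≤ e <;> by_cases hy : y ≤ e <;> by_cases hz : z ≤ e
  · rw [hle x y hx hy, hle y z hy hz, hle _ z (hT_mem x hx y hy) hz,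
      hle x _ hx (hT_mem y hy z hz), hT_assoc x hx y hy z hz]
  all_goals
    try have hx' := lt_of_le_of_ne hx hxe
    try have hy' := lt_of_le_of_ne hy hye
    try have hz' := lt_of_le_of_ne hz hze
    grind
end

theorem uninorm_two_interior_iff {L : Type*} [Lattice L] [BoundedOrder L]
    (e : L) (he0 : e ≠ ⊥) (he1 : e ≠ ⊤)
    (T : L → L → L)
    (hT_mem : ∀ x ∈ Set.Icc ⊥ e, ∀ y ∈ Set.Icc ⊥ e, T x y ∈ Set.Icc ⊥ e)
    (hT_comm : ∀ x ∈ Set.Icc ⊥ e, ∀ y ∈ Set.Icc ⊥ e, T x y = T y x)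
    (hT_assoc : ∀ x ∈ Set.Icc ⊥ e, ∀ y ∈ Set.Icc ⊥ e, ∀ z ∈ Set.Icc ⊥ e, T (T x y) z = T x (T y z))
    (hT_mono₁ : ∀ x ∈ Set.Icc ⊥ e, ∀ y ∈ Set.Icc ⊥ e, ∀ z ∈ Set.Icc ⊥ e, x ≤ y → T x z ≤ T y z)
    (hT_mono₂ : ∀ x ∈ Set.Icc ⊥ e, ∀ y ∈ Set.Icc ⊥ e, ∀ z ∈ Set.Icc ⊥ e, x ≤ y → T z x ≤ T z y)
    (hT_unit : ∀ x ∈ Set.Icc ⊥ e, T e x = x)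
    (int₁ int₂ : L → L)
    (hint₁_le : ∀ x, int₁ x ≤ x)
    (hint₁_inf : ∀ x y, int₁ (x ⊓ y) = int₁ x ⊓ int₁ y)
    (hint₁_idem : ∀ x, int₁ (int₁ x) = int₁ x)
    (hint₂_le : ∀ x, int₂ x ≤ x)
    (hint₂_inf : ∀ x y, int₂ (x ⊓ y) = int₂ x ⊓ int₂ y)
    (hint₂_idem : ∀ x, int₂ (int₂ x) = int₂ x)
    (hint₂₁ : ∀ x, x ∉ Set.Icc ⊥ e → int₂ x ≤ int₁ x)
    (U : L → L → L)
    (hU1 : ∀ x y, x ∈ Set.Icc ⊥ e ∧ y ∈ Set.Icc ⊥ e → U x y = T x y)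
    (hU2 : ∀ x y, (Par x e ∨ x ∈ Set.Ioo e ⊤) ∧ y = e → U x y = x)
    (hU3 : ∀ x y, x = e ∧ (Par y e ∨ y ∈ Set.Ioo e ⊤) → U x y = y)
    (hU4 : ∀ x y, Par x e ∧ y ∈ Set.Ico ⊥ e → U x y = int₂ x ⊔ (x ⊓ e))
    (hU5 : ∀ x y, x ∈ Set.Ico ⊥ e ∧ Par y e → U x y = int₂ y ⊔ (y ⊓ e))
    (hU6 : ∀ x y, x ∈ Set.Ioo e ⊤ ∧ y ∈ Set.Ico ⊥ e → U x y = int₁ x ⊔ (x ⊓ e))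
    (hU7 : ∀ x y, x ∈ Set.Ico ⊥ e ∧ y ∈ Set.Ioo e ⊤ → U x y = int₁ y ⊔ (y ⊓ e))
    (hU0 : ∀ x y, ¬(x ∈ Set.Icc ⊥ e ∧ y ∈ Set.Icc ⊥ e) → ¬((Par x e ∨ x ∈ Set.Ioo e ⊤) ∧ y = e) → ¬(x = e ∧ (Par y e ∨ y ∈ Set.Ioo e ⊤)) → ¬(Par x e ∧ y ∈ Set.Ico ⊥ e) → ¬(x ∈ Set.Ico ⊥ e ∧ Par y e) → ¬(x ∈ Set.Ioo e ⊤ ∧ y ∈ Set.Ico ⊥ e) → ¬(x ∈ Set.Ico ⊥ e ∧ y ∈ Set.Ioo e ⊤) → U x y = ⊤)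
    :
    ((∀ x y, U x y = U y x) ∧ (∀ x y z, U (U x y) z = U x (U y z)) ∧
      (∀ x y z, x ≤ y → U x z ≤ U y z) ∧ (∀ x y z, x ≤ y → U z x ≤ U z y) ∧
      (∀ x, U e x = x)) ↔
      ((∀ x, Par x e → int₂ x ∉ Set.Icc ⊥ e) ∧ (∀ x ∈ Set.Ioo e ⊤, int₁ x ∉ Set.Icc ⊥ e)) := by
  have he1' : ¬(⊤ : L) ≤ e := fun h => he1 (top_le_iff.1 h)
  have hbot : ⊥ < e := bot_lt_iff_ne_bot.2 he0
  have mem_Icc : ∀ x, x ∈ Set.Icc ⊥ e ↔ x ≤ e := fun x => by simp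
  have mem_Ico : ∀ x, x ∈ Set.Ico ⊥ e ↔ x < e := fun x => by simp
  have mem_Ioo : ∀ x, x ∈ Set.Ioo e ⊤ ↔ e < x ∧ x < ⊤ := fun x => Iff.rfl
  simp only [mem_Icc, mem_Ico, mem_Ioo] at *
  clear mem_Icc mem_Ico mem_Ioo
  have mono₁ : ∀ x y, x ≤ y → int₁ x ≤ int₁ y := fun x y h => by
    rw [← inf_eq_left, ← hint₁_inf, inf_eq_left.2 h]
  have mono₂ : ∀ x y, x ≤ y → int₂ x ≤ int₂ y := fun x y h => by
    rw [← inf_eq_left, ← hint₂_inf, inf_eq_left.2 h]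
  have cases_not_le : ∀ x, ¬x ≤ e → Par x e ∨ (e < x ∧ x < ⊤) ∨ x = ⊤ := fun x hx => by
    by_cases h : e ≤ x
    · rcases eq_or_ne x ⊤ with h' | h'
      · exact .inr (.inr h')
      · exact .inr (.inl ⟨lt_of_le_not_ge h hx, lt_top_iff_ne_top.2 h'⟩)
    · exact .inl ⟨hx, h⟩
  have not_le_of_par : ∀ x, Par x e → ¬x ≤ e := fun x h => h.1
  have htop : ∀ x y, ¬x ≤ e → ¬y ≤ e → U x y = ⊤ := fun x y hx hy => by
    apply hU0 <;> grind
  have not_par_top : ¬Par ⊤ e := fun h => h.2 le_top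
  have htop_left : ∀ y, U ⊤ y = ⊤ := fun y => by
    apply hU0 <;> simp [not_par_top, he1, he1.symm]
  have htop_right : ∀ x, U x ⊤ = ⊤ := fun x => by
    apply hU0 <;> simp [not_par_top, he1, he1.symm]
  have hleft : ∀ x y, x < e → ¬y ≤ e → U x y = U ⊥ y := fun x y hx hy => by
    rcases cases_not_le y hy with h | h | rfl
    · rw [hU5 x y ⟨hx, h⟩, hU5 ⊥ y ⟨hbot, h⟩]
    · rw [hU7 x y ⟨hx, h⟩, hU7 ⊥ y ⟨hbot, h⟩]
    · rw [htop_right, htop_right]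
  have hright : ∀ x y, ¬x ≤ e → y < e → U x y = U ⊥ x := fun x y hx hy => by
    rcases cases_not_le x hx with h | h | rfl
    · rw [hU4 x y ⟨h, hy⟩, hU5 ⊥ x ⟨hbot, h⟩]
    · rw [hU6 x y ⟨h, hy⟩, hU7 ⊥ x ⟨hbot, h⟩]
    · rw [htop_left, htop_right]
  have heleft : ∀ x, ¬x ≤ e → U e x = x := fun x hx => by
    rcases cases_not_le x hx with h | h | rfl
    · exact hU3 e x ⟨rfl, .inl h⟩
    · exact hU3 e x ⟨rfl, .inr h⟩
    · exact htop_right e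
  have heright : ∀ x, ¬x ≤ e → U x e = x := fun x hx => by
    rcases cases_not_le x hx with h | h | rfl
    · exact hU2 x e ⟨.inl h, rfl⟩
    · exact hU2 x e ⟨.inr h, rfl⟩
    · exact htop_left e
  have hG_par : ∀ x, Par x e → U ⊥ x = int₂ x ⊔ (x ⊓ e) := fun x h => hU5 ⊥ x ⟨hbot, h⟩
  have hG_Ioo : ∀ x, e < x → x < ⊤ → U ⊥ x = int₁ x ⊔ (x ⊓ e) :=
    fun x h h' => hU7 ⊥ x ⟨hbot, h, h'⟩
  have hG_le : ∀ x, ¬x ≤ e → U ⊥ x ≤ x := fun x hx => by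
    rcases cases_not_le x hx with h | h | rfl
    · rw [hG_par x h]
      exact sup_le (hint₂_le x) inf_le_left
    · rw [hG_Ioo x h.1 h.2]
      exact sup_le (hint₁_le x) inf_le_left
    · exact le_top
  have hG_inf : ∀ x, ¬x ≤ e → x ⊓ e ≤ U ⊥ x := fun x hx => by
    rcases cases_not_le x hx with h | h | rfl
    · rw [hG_par x h]
      exact le_sup_right
    · rw [hG_Ioo x h.1 h.2]
      exact le_sup_right
    · rw [htop_right]
      exact le_top
  have hU1' : ∀ x y, x ≤ e → y ≤ e → U x y = T x y := fun x y hx hy => hU1 x y ⟨hx, hy⟩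
  constructor
  · rintro ⟨-, assoc, -, -, -⟩
    have hG_mem : ∀ x, ¬x ≤ e → x ≠ ⊤ → ¬U ⊥ x ≤ e := fun x hx hx' hG => by
      have h := assoc ⊥ x x
      rw [htop x x hx hx, htop_right] at h
      rcases hG.lt_or_eq with h' | h'
      · rw [hleft _ x h' hx] at h
        exact he1' (h ▸ hG)
      · rw [h', heleft x hx] at h
        exact hx' h
    refine ⟨fun x hx hi => hG_mem x hx.1 ?_ ?_, fun x hx hi => hG_mem x hx.1.not_ge hx.2.ne ?_⟩
    · rintro rfl
      exact hx.2 le_top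
    · rw [hG_par x hx]
      exact sup_le hi inf_le_right
    · rw [hG_Ioo x hx.1 hx.2]
      exact sup_le hi inf_le_right
  · rintro ⟨h₂, h₁⟩
    have hG_mem : ∀ x, ¬x ≤ e → ¬U ⊥ x ≤ e := fun x hx hG => by
      rcases cases_not_le x hx with h | h | rfl
      · rw [hG_par x h] at hG
        exact h₂ x h (le_sup_left.trans hG)
      · rw [hG_Ioo x h.1 h.2] at hG
        exact h₁ x h (le_sup_left.trans hG)
      · exact he1' (htop_right ⊥ ▸ hG)
    have hG_mono : ∀ x y, ¬x ≤ e → ¬y ≤ e → x ≤ y → U ⊥ x ≤ U ⊥ y := fun x y hx hy hxy => by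
      have hinf : x ⊓ e ≤ y ⊓ e := inf_le_inf_right e hxy
      rcases cases_not_le y hy with h' | h' | rfl
      · have h : Par x e := ⟨hx, fun h => h'.2 (h.trans hxy)⟩
        rw [hG_par x h, hG_par y h']
        exact sup_le_sup (mono₂ x y hxy) hinf
      · rw [hG_Ioo y h'.1 h'.2]
        rcases cases_not_le x hx with h | h | rfl
        · rw [hG_par x h]
          exact sup_le_sup ((hint₂₁ x hx).trans (mono₁ x y hxy)) hinf
        · rw [hG_Ioo x h.1 h.2]
          exact sup_le_sup (mono₁ x y hxy) hinf
        · exact absurd (hxy.trans_lt h'.2) (lt_irrefl _)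
      · rw [htop_right ⊥]
        exact le_top
    have hG_idem : ∀ x, ¬x ≤ e → U ⊥ (U ⊥ x) = U ⊥ x := fun x hx => by
      refine le_antisymm (hG_le _ (hG_mem x hx)) ?_
      have hinf : x ⊓ e ≤ U ⊥ (U ⊥ x) :=
        (le_inf (hG_inf x hx) inf_le_right).trans (hG_inf _ (hG_mem x hx))
      have hGx := hG_le x hx
      rcases cases_not_le x hx with h | h | rfl
      · have h' : Par (U ⊥ x) e := ⟨hG_mem x hx, fun h' => h.2 (h'.trans hGx)⟩
        conv_lhs => rw [hG_par x h]
        refine sup_le ?_ hinf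
        have hi : int₂ x ≤ U ⊥ x := by
          rw [hG_par x h]
          exact le_sup_left
        rw [hG_par _ h', ← hint₂_idem x]
        exact (mono₂ _ _ hi).trans le_sup_left
      · have h' : e ≤ U ⊥ x := (le_inf h.1.le le_rfl).trans (hG_inf x hx)
        conv_lhs => rw [hG_Ioo x h.1 h.2]
        refine sup_le ?_ hinf
        have hi : int₁ x ≤ U ⊥ x := by
          rw [hG_Ioo x h.1 h.2]
          exact le_sup_left
        rw [hG_Ioo _ (lt_of_le_not_ge h' (hG_mem x hx)) (hGx.trans_lt h.2), ← hint₁_idem x]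
        exact (mono₁ _ _ hi).trans le_sup_left
      · rw [htop_right, htop_right]
    have comm := comm_of_mixed hT_comm hU1' htop hleft hright heleft heright
    have mono := mono_right_of_mixed hT_comm hT_mono₂ hT_unit hU1' htop hleft hright heleft
      heright hG_le hG_inf hG_mono
    refine ⟨comm, assoc_of_mixed hT_mem hT_comm hT_assoc hT_mono₂ hT_unit he1' hU1' htop hleft
      hright heleft heright (htop_right ⊥) hG_mem hG_idem, fun x y z h => ?_, mono, fun x => ?_⟩
    · rw [comm x z, comm y z]
      exact mono x y z h
    · by_cases hx : x ≤ e
      · rw [hU1' e x le_rfl hx, hT_unit x hx]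
      · exact heleft x hx
end

section
/- Let U be the uninorm constructed in Theorem 3.13 (i.e., the piecewise operation built from a t-norm T on [0,e] and interior operators int₂ ≤ int₁ on L \ [0,e] with int₂(x) ∉ [0,e] for all x ∈ I_e and int₁(x) ∉ [0,e] for all x ∈ ]e,1[). If ]e,1[ contains at most one element, or if any two distinct elements of ]e,1[ are incomparable, then U belongs to the class U_max^*, i.e., U(x,y) = y for all (x,y) ∈ [0,e[ × ]e,1]. -/
/-- In an interval `]e, ⊤[` without two distinct comparable elements, any `z ≤ y` not below `e`
joins with `e` to `y`. -/
theorem sup_eq_of_Ioo_par {L : Type*} [Lattice L] [BoundedOrder L] {e y z : L}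
    (hpar : ∀ a ∈ Set.Ioo e ⊤, ∀ b ∈ Set.Ioo e ⊤, a ≠ b → Par a b)
    (hy : y ∈ Set.Ioo e ⊤) (hzy : z ≤ y) (hze : ¬ z ≤ e) : z ⊔ e = y := by
  have hle : z ⊔ e ≤ y := sup_le hzy hy.1.le
  by_contra hne
  exact (hpar _ ⟨right_lt_sup.mpr hze, hle.trans_lt hy.2⟩ y hy hne).1 hle

theorem uninorm_two_interior_Umax_star {L : Type*} [Lattice L] [BoundedOrder L]
    (e : L) (he0 : e ≠ ⊥) (he1 : e ≠ ⊤)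
    (T : L → L → L)
    (hT_mem : ∀ x ∈ Set.Icc ⊥ e, ∀ y ∈ Set.Icc ⊥ e, T x y ∈ Set.Icc ⊥ e)
    (hT_comm : ∀ x ∈ Set.Icc ⊥ e, ∀ y ∈ Set.Icc ⊥ e, T x y = T y x)
    (hT_assoc : ∀ x ∈ Set.Icc ⊥ e, ∀ y ∈ Set.Icc ⊥ e, ∀ z ∈ Set.Icc ⊥ e, T (T x y) z = T x (T y z))
    (hT_mono₁ : ∀ x ∈ Set.Icc ⊥ e, ∀ y ∈ Set.Icc ⊥ e, ∀ z ∈ Set.Icc ⊥ e, x ≤ y → T x z ≤ T y z)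
    (hT_mono₂ : ∀ x ∈ Set.Icc ⊥ e, ∀ y ∈ Set.Icc ⊥ e, ∀ z ∈ Set.Icc ⊥ e, x ≤ y → T z x ≤ T z y)
    (hT_unit : ∀ x ∈ Set.Icc ⊥ e, T e x = x)
    (int₁ int₂ : L → L)
    (hint₁_le : ∀ x, int₁ x ≤ x)
    (hint₁_inf : ∀ x y, int₁ (x ⊓ y) = int₁ x ⊓ int₁ y)
    (hint₁_idem : ∀ x, int₁ (int₁ x) = int₁ x)
    (hint₂_le : ∀ x, int₂ x ≤ x)
    (hint₂_inf : ∀ x y, int₂ (x ⊓ y) = int₂ x ⊓ int₂ y)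
    (hint₂_idem : ∀ x, int₂ (int₂ x) = int₂ x)
    (hint₂₁ : ∀ x, x ∉ Set.Icc ⊥ e → int₂ x ≤ int₁ x)
    (U : L → L → L)
    (hU1 : ∀ x y, x ∈ Set.Icc ⊥ e ∧ y ∈ Set.Icc ⊥ e → U x y = T x y)
    (hU2 : ∀ x y, (Par x e ∨ x ∈ Set.Ioo e ⊤) ∧ y = e → U x y = x)
    (hU3 : ∀ x y, x = e ∧ (Par y e ∨ y ∈ Set.Ioo e ⊤) → U x y = y)
    (hU4 : ∀ x y, Par x e ∧ y ∈ Set.Ico ⊥ e → U x y = int₂ x ⊔ (x ⊓ e))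
    (hU5 : ∀ x y, x ∈ Set.Ico ⊥ e ∧ Par y e → U x y = int₂ y ⊔ (y ⊓ e))
    (hU6 : ∀ x y, x ∈ Set.Ioo e ⊤ ∧ y ∈ Set.Ico ⊥ e → U x y = int₁ x ⊔ (x ⊓ e))
    (hU7 : ∀ x y, x ∈ Set.Ico ⊥ e ∧ y ∈ Set.Ioo e ⊤ → U x y = int₁ y ⊔ (y ⊓ e))
    (hU0 : ∀ x y, ¬(x ∈ Set.Icc ⊥ e ∧ y ∈ Set.Icc ⊥ e) → ¬((Par x e ∨ x ∈ Set.Ioo e ⊤) ∧ y = e) → ¬(x = e ∧ (Par y e ∨ y ∈ Set.Ioo e ⊤)) → ¬(Par x e ∧ y ∈ Set.Ico ⊥ e) → ¬(x ∈ Set.Ico ⊥ e ∧ Par y e) → ¬(x ∈ Set.Ioo e ⊤ ∧ y ∈ Set.Ico ⊥ e) → ¬(x ∈ Set.Ico ⊥ e ∧ y ∈ Set.Ioo e ⊤) → U x y = ⊤)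
    (hint₂cond : ∀ x, Par x e → int₂ x ∉ Set.Icc ⊥ e)
    (hint₁cond : ∀ x ∈ Set.Ioo e ⊤, int₁ x ∉ Set.Icc ⊥ e)
    (hsmall : (Set.Ioo e ⊤).Subsingleton ∨
      (∀ x ∈ Set.Ioo e ⊤, ∀ y ∈ Set.Ioo e ⊤, x ≠ y → Par x y))
    :
    ∀ x ∈ Set.Ico ⊥ e, ∀ y ∈ Set.Ioc e ⊤, U x y = y := by
  intro x hx y hy
  have hpar : ∀ a ∈ Set.Ioo e ⊤, ∀ b ∈ Set.Ioo e ⊤, a ≠ b → Par a b :=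
    hsmall.elim (fun h a ha b hb hab => absurd (h ha hb) hab) id
  rcases hy.2.lt_or_eq with hlt | rfl
  · have hy' : y ∈ Set.Ioo e ⊤ := ⟨hy.1, hlt⟩
    rw [hU7 x y ⟨hx, hy'⟩, inf_eq_right.mpr hy.1.le]
    exact sup_eq_of_Ioo_par hpar hy' (hint₁_le y) fun h => hint₁cond y hy' ⟨bot_le, h⟩
  · exact hU0 x ⊤
      (fun h => hy.1.not_ge h.2.2)
      (fun h => he1 h.2.symm)
      (fun h => hx.2.ne h.1)
      (fun h => h.1.1 hx.2.le)
      (fun h => h.2.2 le_top)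
      (fun h => lt_asymm h.1.1 hx.2)
      (fun h => lt_irrefl _ h.2.2)
end

section
/- Let e ∈ L \ {0,1}, T a t-norm on [0,e], and int an interior operator on L. Define U : L² → L by: U(x,y) = T(x,y) if (x,y) ∈ [0,e]²; U(x,y) = x if (x,y) ∈ (I_e ∪ ]e,1[) × {e}; U(x,y) = y if (x,y) ∈ {e} × (I_e ∪ ]e,1[); U(x,y) = int(x) ∨ (x ∧ e) if (x,y) ∈ (I_e ∪ ]e,1[) × [0,e[; U(x,y) = int(y) ∨ (y ∧ e) if (x,y) ∈ [0,e[ × (I_e ∪ ]e,1[); and U(x,y) = 1 otherwise. Then U is a uninorm on L with neutral element e if and only if int(x) ∉ [0,e] for all x ∈ I_e ∪ ]e,1[. -/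
theorem uninorm_one_interior_iff {L : Type*} [Lattice L] [BoundedOrder L]
    (e : L) (he0 : e ≠ ⊥) (he1 : e ≠ ⊤)
    (T : L → L → L)
    (hT_mem : ∀ x ∈ Set.Icc ⊥ e, ∀ y ∈ Set.Icc ⊥ e, T x y ∈ Set.Icc ⊥ e)
    (hT_comm : ∀ x ∈ Set.Icc ⊥ e, ∀ y ∈ Set.Icc ⊥ e, T x y = T y x)
    (hT_assoc : ∀ x ∈ Set.Icc ⊥ e, ∀ y ∈ Set.Icc ⊥ e, ∀ z ∈ Set.Icc ⊥ e, T (T x y) z = T x (T y z))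
    (hT_mono₁ : ∀ x ∈ Set.Icc ⊥ e, ∀ y ∈ Set.Icc ⊥ e, ∀ z ∈ Set.Icc ⊥ e, x ≤ y → T x z ≤ T y z)
    (hT_mono₂ : ∀ x ∈ Set.Icc ⊥ e, ∀ y ∈ Set.Icc ⊥ e, ∀ z ∈ Set.Icc ⊥ e, x ≤ y → T z x ≤ T z y)
    (hT_unit : ∀ x ∈ Set.Icc ⊥ e, T e x = x)
    (int : L → L)
    (hint_le : ∀ x, int x ≤ x)
    (hint_inf : ∀ x y, int (x ⊓ y) = int x ⊓ int y)
    (hint_idem : ∀ x, int (int x) = int x)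
    (U : L → L → L)
    (hU1 : ∀ x y, x ∈ Set.Icc ⊥ e ∧ y ∈ Set.Icc ⊥ e → U x y = T x y)
    (hU2 : ∀ x y, (Par x e ∨ x ∈ Set.Ioo e ⊤) ∧ y = e → U x y = x)
    (hU3 : ∀ x y, x = e ∧ (Par y e ∨ y ∈ Set.Ioo e ⊤) → U x y = y)
    (hU4 : ∀ x y, (Par x e ∨ x ∈ Set.Ioo e ⊤) ∧ y ∈ Set.Ico ⊥ e → U x y = int x ⊔ (x ⊓ e))
    (hU5 : ∀ x y, x ∈ Set.Ico ⊥ e ∧ (Par y e ∨ y ∈ Set.Ioo e ⊤) → U x y = int y ⊔ (y ⊓ e))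
    (hU0 : ∀ x y, ¬(x ∈ Set.Icc ⊥ e ∧ y ∈ Set.Icc ⊥ e) → ¬((Par x e ∨ x ∈ Set.Ioo e ⊤) ∧ y = e) → ¬(x = e ∧ (Par y e ∨ y ∈ Set.Ioo e ⊤)) → ¬((Par x e ∨ x ∈ Set.Ioo e ⊤) ∧ y ∈ Set.Ico ⊥ e) → ¬(x ∈ Set.Ico ⊥ e ∧ (Par y e ∨ y ∈ Set.Ioo e ⊤)) → U x y = ⊤)
    :
    ((∀ x y, U x y = U y x) ∧ (∀ x y z, U (U x y) z = U x (U y z)) ∧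
      (∀ x y z, x ≤ y → U x z ≤ U y z) ∧ (∀ x y z, x ≤ y → U z x ≤ U z y) ∧
      (∀ x, U e x = x)) ↔
      (∀ x, (Par x e ∨ x ∈ Set.Ioo e ⊤) → int x ∉ Set.Icc ⊥ e) := by
  have hM : ∀ x, (Par x e ∨ x ∈ Set.Ioo e ⊤) ↔ (¬ x ≤ e ∧ x ≠ ⊤) := by
    intro x
    constructor
    · rintro (⟨h1, h2⟩ | ⟨h1, h2⟩)
      · exact ⟨h1, fun h => h2 (h ▸ le_top)⟩
      · exact ⟨not_le_of_gt h1, h2.ne⟩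
    · rintro ⟨h1, h2⟩
      by_cases h : e ≤ x
      · exact Or.inr ⟨lt_of_le_not_ge h h1, lt_top_iff_ne_top.2 h2⟩
      · exact Or.inl ⟨h1, h⟩
  simp only [hM, Set.mem_Icc, Set.mem_Ico, bot_le, true_and] at *
  have htop : ¬ (⊤ : L) ≤ e := fun h => he1 (top_le_iff.1 h)
  have top_left : ∀ y, U ⊤ y = ⊤ := fun y => by
    apply hU0 <;> grind
  have top_right : ∀ y, U y ⊤ = ⊤ := fun y => by
    apply hU0 <;> grind
  have mid_mid : ∀ x y, ¬ x ≤ e → ¬ y ≤ e → U x y = ⊤ := fun x y hx hy => by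
    apply hU0 <;> grind
  have unit_left : ∀ x, U e x = x := fun x => by
    by_cases hx : x ≤ e
    · rw [hU1 _ _ ⟨le_rfl, hx⟩, hT_unit x hx]
    · by_cases h : x = ⊤
      · rw [h, top_right]
      · exact hU3 _ _ ⟨rfl, hx, h⟩
  have unit_right : ∀ x, U x e = x := fun x => by
    by_cases hx : x ≤ e
    · rw [hU1 _ _ ⟨hx, le_rfl⟩, hT_comm x hx e le_rfl, hT_unit x hx]
    · by_cases h : x = ⊤
      · rw [h, top_left]
      · exact hU2 _ _ ⟨⟨hx, h⟩, rfl⟩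
  have core_le : ∀ x, int x ⊔ (x ⊓ e) ≤ x := fun x => sup_le (hint_le x) inf_le_left
  constructor
  · rintro ⟨-, hassoc, -⟩ x hx hint
    have hbot : (⊥ : L) < e := bot_lt_iff_ne_bot.2 he0
    have h := hassoc x x ⊥
    rw [mid_mid x x hx.1 hx.1, top_left, hU4 x ⊥ ⟨hx, hbot⟩] at h
    have hle : int x ⊔ (x ⊓ e) ≤ e := sup_le hint inf_le_right
    rcases hle.eq_or_lt with heq | hlt
    · rw [heq, unit_right] at h
      exact hx.2 h.symm
    · rw [hU4 x _ ⟨hx, hlt⟩] at h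
      exact htop (h ▸ hle)
  · intro hint
    have int_mono : ∀ x y, x ≤ y → int x ≤ int y := fun x y h => by
      have := hint_inf x y
      rw [inf_eq_left.2 h] at this
      exact this ▸ inf_le_right
    have core_mono : ∀ x y, x ≤ y → int x ⊔ (x ⊓ e) ≤ int y ⊔ (y ⊓ e) := fun x y h =>
      sup_le_sup (int_mono x y h) (inf_le_inf_right e h)
    have core_mid : ∀ x, ¬ x ≤ e ∧ x ≠ ⊤ →
        ¬ int x ⊔ (x ⊓ e) ≤ e ∧ int x ⊔ (x ⊓ e) ≠ ⊤ := fun x hx =>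
      ⟨fun h => hint x hx (le_sup_left.trans h),
        fun h => hx.2 (top_le_iff.1 (h ▸ core_le x))⟩
    obtain ⟨f, hf⟩ : ∃ f : L → L, ∀ x, f x = int x ⊔ (x ⊓ e) := ⟨_, fun _ => rfl⟩
    have core_idem : ∀ x, f (f x) = f x := fun x => by
      apply le_antisymm
      · rw [hf (f x)]
        exact core_le _
      · rw [hf (f x)]
        conv_lhs => rw [hf x]
        refine sup_le_sup ?_ (le_inf ?_ inf_le_right)
        · conv_lhs => rw [← hint_idem x]
          exact int_mono _ _ (hf x ▸ le_sup_left)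
        · exact hf x ▸ le_sup_right
    simp only [← hf] at hU4 hU5 core_le core_mono core_mid
    have T_le_left : ∀ x y, x ≤ e → y ≤ e → T x y ≤ x := fun x y hx hy => by
      have h := hT_mono₂ y hy e le_rfl x hx hy
      rwa [hT_comm x hx e le_rfl, hT_unit x hx] at h
    have cases4 : ∀ x, x < e ∨ x = e ∨ (¬ x ≤ e ∧ x ≠ ⊤) ∨ x = ⊤ := fun x => by
      have := @lt_or_eq_of_le _ _ x e
      tauto
    have comm : ∀ x y, U x y = U y x := fun x y => by
      rcases cases4 x with hx | rfl | hx | rfl <;> rcases cases4 y with hy | rfl | hy | rfl <;>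
        try simp only [unit_left, unit_right, top_left, top_right]
      · rw [hU1 _ _ ⟨hx.le, hy.le⟩, hU1 _ _ ⟨hy.le, hx.le⟩, hT_comm x hx.le y hy.le]
      · rw [hU5 _ _ ⟨hx, hy⟩, hU4 _ _ ⟨hy, hx⟩]
      · rw [hU5 _ _ ⟨hy, hx⟩, hU4 _ _ ⟨hx, hy⟩]
      · rw [mid_mid _ _ hx.1 hy.1, mid_mid _ _ hy.1 hx.1]
    have low_low : ∀ x y, x < e → y < e → U x y < e := fun x y hx hy => by
      rw [hU1 _ _ ⟨hx.le, hy.le⟩]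
      exact (T_le_left x y hx.le hy.le).trans_lt hx
    have mono : ∀ x y z, x ≤ y → U x z ≤ U y z := fun x y z hxy => by
      rcases cases4 z with hz | rfl | hz | rfl
      · by_cases hy : y ≤ e
        · rw [hU1 _ _ ⟨hxy.trans hy, hz.le⟩, hU1 _ _ ⟨hy, hz.le⟩]
          exact hT_mono₁ x (hxy.trans hy) y hy z hz.le hxy
        · by_cases hy' : y = ⊤
          · rw [hy', top_left]
            exact le_top
          · rw [hU4 y z ⟨⟨hy, hy'⟩, hz⟩]
            by_cases hx : x ≤ e
            · rw [hU1 _ _ ⟨hx, hz.le⟩]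
              have h := T_le_left x z hx hz.le
              exact (le_inf (h.trans hxy) (h.trans hx)).trans (hf y ▸ le_sup_right)
            · rw [hU4 x z ⟨⟨hx, fun h => hy' (top_le_iff.1 (h ▸ hxy))⟩, hz⟩]
              exact core_mono x y hxy
      · simpa only [unit_right] using hxy
      · by_cases hy : y ≤ e
        · rcases hy.eq_or_lt with rfl | hy
          · rcases hxy.eq_or_lt with rfl | hx
            · exact le_rfl
            · rw [hU5 _ _ ⟨hx, hz⟩, unit_left]
              exact core_le z
          · rw [hU5 _ _ ⟨hxy.trans_lt hy, hz⟩, hU5 _ _ ⟨hy, hz⟩]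
        · rw [mid_mid _ _ hy hz.1]
          exact le_top
      · simp only [top_right, le_refl]
    refine ⟨comm, fun x y z => ?_, mono, fun x y z h => ?_, unit_left⟩
    · rcases cases4 x with hx | rfl | hx | rfl <;> rcases cases4 y with hy | rfl | hy | rfl <;>
        rcases cases4 z with hz | rfl | hz | rfl <;>
        try simp only [unit_left, unit_right, top_left, top_right]
      · have hxy := low_low x y hx hy
        have hyz := low_low y z hy hz
        rw [hU1 _ _ ⟨hxy.le, hz.le⟩, hU1 _ _ ⟨hx.le, hyz.le⟩, hU1 _ _ ⟨hx.le, hy.le⟩,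
          hU1 _ _ ⟨hy.le, hz.le⟩, hT_assoc x hx.le y hy.le z hz.le]
      · rw [hU5 _ _ ⟨low_low x y hx hy, hz⟩, hU5 _ _ ⟨hy, hz⟩, hU5 _ _ ⟨hx, core_mid z hz⟩,
          core_idem]
      · rw [hU5 _ _ ⟨hx, hy⟩, hU4 _ _ ⟨hy, hz⟩, hU4 _ _ ⟨core_mid y hy, hz⟩,
          hU5 _ _ ⟨hx, core_mid y hy⟩]
      · rw [hU5 _ _ ⟨hx, hy⟩, mid_mid _ _ hy.1 hz.1, mid_mid _ _ (core_mid y hy).1 hz.1,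
          top_right]
      · rw [hU4 _ _ ⟨hx, hy⟩, hU4 _ _ ⟨core_mid x hx, hz⟩, hU4 _ _ ⟨hx, low_low y z hy hz⟩,
          core_idem]
      · rw [hU4 _ _ ⟨hx, hy⟩, hU5 _ _ ⟨hy, hz⟩, mid_mid _ _ (core_mid x hx).1 hz.1,
          mid_mid _ _ hx.1 (core_mid z hz).1]
      · rw [mid_mid _ _ hx.1 hy.1, hU4 _ _ ⟨hy, hz⟩, mid_mid _ _ hx.1 (core_mid y hy).1,
          top_left]
      · rw [mid_mid _ _ hx.1 hy.1, mid_mid _ _ hy.1 hz.1, top_left, top_right]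
    · rw [comm z x, comm z y]
      exact mono x y z h
end

section
/- Let e ∈ L \ {0,1}, T a t-norm on [0,e], and int an interior operator on L. Define U : L² → L by: U(x,y) = T(x,y) if (x,y) ∈ [0,e]²; U(x,y) = x if (x,y) ∈ ]e,1] × [0,e] ∪ I_e × {e}; U(x,y) = y if (x,y) ∈ [0,e] × ]e,1] ∪ {e} × I_e; U(x,y) = int(x) ∨ (x ∧ e) if (x,y) ∈ I_e × [0,e[; U(x,y) = int(y) ∨ (y ∧ e) if (x,y) ∈ [0,e[ × I_e; and U(x,y) = 1 otherwise. Then U is a uninorm on L with neutral element e if and only if int(x) ∉ [0,e] for all x ∈ I_e. -/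
section Lattice

variable {L : Type*} [Lattice L]

theorem lt_or_eq_or_par_or_gt (x e : L) : x < e ∨ x = e ∨ Par x e ∨ e < x := by
  by_cases h : x ≤ e
  · exact h.lt_or_eq.imp_right Or.inl
  · by_cases h' : e ≤ x
    · exact .inr (.inr (.inr (lt_of_le_not_ge h' h)))
    · exact .inr (.inr (.inl ⟨h, h'⟩))

theorem Par.inf_lt {x e : L} (h : Par x e) : x ⊓ e < e :=
  inf_le_right.lt_of_ne fun h' => h.2 (inf_eq_right.mp h')

/-- The value `int x ⊔ (x ⊓ e)` of the interior construction below the neutral element. -/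
def interiorJoin (int : L → L) (e x : L) : L := int x ⊔ (x ⊓ e)

variable {int : L → L} {e : L}

theorem monotone_of_map_inf (hint_inf : ∀ x y, int (x ⊓ y) = int x ⊓ int y) : Monotone int :=
  fun x y h => by
    rw [← inf_eq_left.mpr h, hint_inf]
    exact inf_le_right

theorem interiorJoin_le (hle : ∀ x, int x ≤ x) (x : L) : interiorJoin int e x ≤ x :=
  sup_le (hle x) inf_le_left

theorem interiorJoin_mono (hmono : Monotone int) : Monotone (interiorJoin int e) :=
  fun _ _ h => sup_le_sup (hmono h) (inf_le_inf_right e h)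

theorem interiorJoin_idem (hle : ∀ x, int x ≤ x) (hmono : Monotone int)
    (hidem : ∀ x, int (int x) = int x) (x : L) :
    interiorJoin int e (interiorJoin int e x) = interiorJoin int e x := by
  refine le_antisymm (interiorJoin_le hle _) (sup_le_sup ?_ ?_)
  · exact (hidem x).ge.trans (hmono le_sup_left)
  · exact le_inf le_sup_right inf_le_right

theorem Par.interiorJoin (hle : ∀ x, int x ≤ x) {x : L} (hx : Par x e) (h : ¬ int x ≤ e) :
    Par (interiorJoin int e x) e :=
  ⟨fun h' => h (le_sup_left.trans h'), fun h' => hx.2 (h'.trans (interiorJoin_le hle x))⟩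

end Lattice

theorem uninorm_one_interior_iff' {L : Type*} [Lattice L] [BoundedOrder L]
    (e : L) (he0 : e ≠ ⊥) (he1 : e ≠ ⊤)
    (T : L → L → L)
    (hT_mem : ∀ x ∈ Set.Icc ⊥ e, ∀ y ∈ Set.Icc ⊥ e, T x y ∈ Set.Icc ⊥ e)
    (hT_comm : ∀ x ∈ Set.Icc ⊥ e, ∀ y ∈ Set.Icc ⊥ e, T x y = T y x)
    (hT_assoc : ∀ x ∈ Set.Icc ⊥ e, ∀ y ∈ Set.Icc ⊥ e, ∀ z ∈ Set.Icc ⊥ e, T (T x y) z = T x (T y z))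
    (hT_mono₁ : ∀ x ∈ Set.Icc ⊥ e, ∀ y ∈ Set.Icc ⊥ e, ∀ z ∈ Set.Icc ⊥ e, x ≤ y → T x z ≤ T y z)
    (hT_mono₂ : ∀ x ∈ Set.Icc ⊥ e, ∀ y ∈ Set.Icc ⊥ e, ∀ z ∈ Set.Icc ⊥ e, x ≤ y → T z x ≤ T z y)
    (hT_unit : ∀ x ∈ Set.Icc ⊥ e, T e x = x)
    (int : L → L)
    (hint_le : ∀ x, int x ≤ x)
    (hint_inf : ∀ x y, int (x ⊓ y) = int x ⊓ int y)
    (hint_idem : ∀ x, int (int x) = int x)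
    (U : L → L → L)
    (hU1 : ∀ x y, x ∈ Set.Icc ⊥ e ∧ y ∈ Set.Icc ⊥ e → U x y = T x y)
    (hU2 : ∀ x y, (x ∈ Set.Ioc e ⊤ ∧ y ∈ Set.Icc ⊥ e) ∨ (Par x e ∧ y = e) → U x y = x)
    (hU3 : ∀ x y, (x ∈ Set.Icc ⊥ e ∧ y ∈ Set.Ioc e ⊤) ∨ (x = e ∧ Par y e) → U x y = y)
    (hU4 : ∀ x y, Par x e ∧ y ∈ Set.Ico ⊥ e → U x y = int x ⊔ (x ⊓ e))
    (hU5 : ∀ x y, x ∈ Set.Ico ⊥ e ∧ Par y e → U x y = int y ⊔ (y ⊓ e))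
    (hU0 : ∀ x y, ¬(x ∈ Set.Icc ⊥ e ∧ y ∈ Set.Icc ⊥ e) → ¬((x ∈ Set.Ioc e ⊤ ∧ y ∈ Set.Icc ⊥ e) ∨ (Par x e ∧ y = e)) → ¬((x ∈ Set.Icc ⊥ e ∧ y ∈ Set.Ioc e ⊤) ∨ (x = e ∧ Par y e)) → ¬(Par x e ∧ y ∈ Set.Ico ⊥ e) → ¬(x ∈ Set.Ico ⊥ e ∧ Par y e) → U x y = ⊤)
    :
    ((∀ x y, U x y = U y x) ∧ (∀ x y z, U (U x y) z = U x (U y z)) ∧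
      (∀ x y z, x ≤ y → U x z ≤ U y z) ∧ (∀ x y z, x ≤ y → U z x ≤ U z y) ∧
      (∀ x, U e x = x)) ↔
      (∀ x, Par x e → int x ∉ Set.Icc ⊥ e) := by
  have hpos : ⊥ < e := bot_lt_iff_ne_bot.mpr he0
  have htop : e < ⊤ := lt_top_iff_ne_top.mpr he1
  have hmono := monotone_of_map_inf hint_inf
  have hTe : ∀ x ≤ e, T x e = x := fun x hx => by
    rw [hT_comm x ⟨bot_le, hx⟩ e ⟨bot_le, le_rfl⟩, hT_unit x ⟨bot_le, hx⟩]
  have hT_left : ∀ x ≤ e, ∀ y ≤ e, T x y ≤ x := fun x hx y hy =>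
    (hT_mono₂ y ⟨bot_le, hy⟩ e ⟨bot_le, le_rfl⟩ x ⟨bot_le, hx⟩ hy).trans_eq (hTe x hx)
  have hT_right : ∀ x ≤ e, ∀ y ≤ e, T x y ≤ y := fun x hx y hy => by
    rw [hT_comm x ⟨bot_le, hx⟩ y ⟨bot_le, hy⟩]
    exact hT_left y hy x hx
  have U_low : ∀ x y, x ≤ e → y ≤ e → U x y = T x y := fun x y hx hy =>
    hU1 x y ⟨⟨bot_le, hx⟩, bot_le, hy⟩
  have U_gt_low : ∀ x y, e < x → y ≤ e → U x y = x := fun x y hx hy =>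
    hU2 x y (.inl ⟨⟨hx, le_top⟩, bot_le, hy⟩)
  have U_low_gt : ∀ x y, x ≤ e → e < y → U x y = y := fun x y hx hy =>
    hU3 x y (.inl ⟨⟨bot_le, hx⟩, hy, le_top⟩)
  have U_par_lt : ∀ x y, Par x e → y < e → U x y = interiorJoin int e x := fun x y hx hy =>
    hU4 x y ⟨hx, bot_le, hy⟩
  have U_lt_par : ∀ x y, x < e → Par y e → U x y = interiorJoin int e y := fun x y hx hy =>
    hU5 x y ⟨⟨bot_le, hx⟩, hy⟩
  have U_top : ∀ x y, ¬ x ≤ e → ¬ y ≤ e → U x y = ⊤ := fun x y hx hy => by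
    refine hU0 x y ?_ ?_ ?_ ?_ ?_
    · exact fun h => hx h.1.2
    · rintro (h | h)
      exacts [hy h.2.2, hy h.2.le]
    · rintro (h | h)
      exacts [hx h.1.2, hx h.1.le]
    · exact fun h => hy h.2.2.le
    · exact fun h => hx h.1.2.le
  have U_left : ∀ x, U e x = x := fun x => by
    rcases lt_or_eq_or_par_or_gt x e with h | h | h | h
    · rw [U_low e x le_rfl h.le, hT_unit x ⟨bot_le, h.le⟩]
    · rw [U_low e x le_rfl h.le, hT_unit x ⟨bot_le, h.le⟩]
    · exact hU3 e x (.inr ⟨rfl, h⟩)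
    · exact U_low_gt e x le_rfl h
  have U_right : ∀ x, U x e = x := fun x => by
    rcases lt_or_eq_or_par_or_gt x e with h | h | h | h
    · rw [U_low x e h.le le_rfl, hTe x h.le]
    · rw [U_low x e h.le le_rfl, hTe x h.le]
    · exact hU2 x e (.inr ⟨h, rfl⟩)
    · exact U_gt_low x e h le_rfl
  constructor
  · rintro ⟨-, hassoc, -⟩ x hx ⟨-, hi⟩
    have hg : interiorJoin int e x = x ⊓ e := sup_eq_right.mpr (le_inf (hint_le x) hi)
    have h := hassoc ⊥ x x
    rw [U_top x x hx.1 hx.1, U_low_gt ⊥ ⊤ bot_le htop, U_lt_par ⊥ x hpos hx, hg,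
      U_lt_par _ x hx.inf_lt hx, hg] at h
    exact (hx.inf_lt.trans htop).ne h
  · intro hint
    have hpar : ∀ x, Par x e → Par (interiorJoin int e x) e := fun x hx =>
      hx.interiorJoin hint_le fun h => hint x hx ⟨bot_le, h⟩
    have hidem : ∀ x, interiorJoin int e (interiorJoin int e x) = interiorJoin int e x :=
      interiorJoin_idem hint_le hmono hint_idem
    have hT_lt : ∀ x y, x < e → y < e → T x y < e := fun x y hx hy =>
      (hT_left x hx.le y hy.le).trans_lt hx
    have U_comm : ∀ x y, U x y = U y x := fun x y => by
      rcases lt_or_eq_or_par_or_gt x e with hx | rfl | hx | hx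
      · rcases lt_or_eq_or_par_or_gt y e with hy | rfl | hy | hy
        · rw [U_low x y hx.le hy.le, U_low y x hy.le hx.le,
            hT_comm x ⟨bot_le, hx.le⟩ y ⟨bot_le, hy.le⟩]
        · rw [U_left, U_right]
        · rw [U_lt_par x y hx hy, U_par_lt y x hy hx]
        · rw [U_low_gt x y hx.le hy, U_gt_low y x hy hx.le]
      · rw [U_left, U_right]
      · rcases lt_or_eq_or_par_or_gt y e with hy | rfl | hy | hy
        · rw [U_par_lt x y hx hy, U_lt_par y x hy hx]
        · rw [U_left, U_right]
        · rw [U_top x y hx.1 hy.1, U_top y x hy.1 hx.1]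
        · rw [U_top x y hx.1 hy.not_ge, U_top y x hy.not_ge hx.1]
      · by_cases hy : y ≤ e
        · rw [U_gt_low x y hx hy, U_low_gt y x hy hx]
        · rw [U_top x y hx.not_ge hy, U_top y x hy hx.not_ge]
    have U_mono : ∀ x y z, x ≤ y → U x z ≤ U y z := fun x y z hxy => by
      rcases lt_or_eq_or_par_or_gt z e with hz | rfl | hz | hz
      · rcases lt_or_eq_or_par_or_gt y e with hy | rfl | hy | hy
        · rw [U_low x z (hxy.trans hy.le) hz.le, U_low y z hy.le hz.le]
          exact hT_mono₁ x ⟨bot_le, hxy.trans hy.le⟩ y ⟨bot_le, hy.le⟩ z ⟨bot_le, hz.le⟩ hxy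
        · rw [U_left, U_low x z hxy hz.le]
          exact hT_right x hxy z hz.le
        · rw [U_par_lt y z hy hz]
          by_cases hx : x ≤ e
          · rw [U_low x z hx hz.le]
            exact (hT_left x hx z hz.le).trans ((le_inf hxy hx).trans le_sup_right)
          · rw [U_par_lt x z ⟨hx, fun h => hy.2 (h.trans hxy)⟩ hz]
            exact interiorJoin_mono hmono hxy
        · rw [U_gt_low y z hy hz.le]
          refine le_trans ?_ hxy
          rcases lt_or_eq_or_par_or_gt x e with hx | hx | hx | hx
          · rw [U_low x z hx.le hz.le]
            exact hT_left x hx.le z hz.le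
          · rw [U_low x z hx.le hz.le]
            exact hT_left x hx.le z hz.le
          · rw [U_par_lt x z hx hz]
            exact interiorJoin_le hint_le x
          · exact (U_gt_low x z hx hz.le).le
      · rwa [U_right, U_right]
      · by_cases hy : y ≤ e
        · rcases hy.lt_or_eq with hy | rfl
          · rw [U_lt_par x z (hxy.trans_lt hy) hz, U_lt_par y z hy hz]
          · rw [U_left]
            rcases hxy.lt_or_eq with hx | rfl
            · rw [U_lt_par x z hx hz]
              exact interiorJoin_le hint_le z
            · rw [U_left]
        · rw [U_top y z hy hz.1]
          exact le_top
      · by_cases hy : y ≤ e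
        · rw [U_low_gt x z (hxy.trans hy) hz, U_low_gt y z hy hz]
        · rw [U_top y z hy hz.not_ge]
          exact le_top
    have U_not_le : ∀ x y, ¬ x ≤ e → ¬ U x y ≤ e := fun x y hx => by
      rcases lt_or_eq_or_par_or_gt y e with hy | rfl | hy | hy
      · rcases lt_or_eq_or_par_or_gt x e with h | h | h | h
        · exact absurd h.le hx
        · exact absurd h.le hx
        · rw [U_par_lt x y h hy]
          exact (hpar x h).1
        · rwa [U_gt_low x y h hy.le]
      · rwa [U_right]
      · rw [U_top x y hx hy.1]
        exact htop.not_ge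
      · rw [U_top x y hx hy.not_ge]
        exact htop.not_ge
    have U_top_right : ∀ x, U x ⊤ = ⊤ := fun x => by
      by_cases hx : x ≤ e
      · exact U_low_gt x ⊤ hx htop
      · exact U_top x ⊤ hx htop.not_ge
    -- Two factors outside `[⊥, e]` force the value `⊤`, so one may assume that the outer
    -- factor `x` lies below `e`.
    have assoc_of_le : ∀ x y z, x ≤ e → U (U x y) z = U x (U y z) := fun x y z hx => by
      rcases hx.lt_or_eq with hx | rfl
      · by_cases hy : y ≤ e
        · rcases hy.lt_or_eq with hy | rfl
          · have hxy := hT_lt x y hx hy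
            rw [U_low x y hx.le hy.le]
            rcases lt_or_eq_or_par_or_gt z e with hz | rfl | hz | hz
            · rw [U_low _ z hxy.le hz.le, U_low y z hy.le hz.le,
                U_low x _ hx.le (hT_lt y z hy hz).le,
                hT_assoc x ⟨bot_le, hx.le⟩ y ⟨bot_le, hy.le⟩ z ⟨bot_le, hz.le⟩]
            · rw [U_right, U_right, U_low x y hx.le hy.le]
            · rw [U_lt_par _ z hxy hz, U_lt_par y z hy hz, U_lt_par x _ hx (hpar z hz), hidem]
            · rw [U_low_gt _ z hxy.le hz, U_low_gt y z hy.le hz, U_low_gt x z hx.le hz]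
          · rw [U_left, U_right]
        · by_cases hz : z ≤ e
          · rcases hz.lt_or_eq with hz | rfl
            · rcases lt_or_eq_or_par_or_gt y e with h | h | h | h
              · exact absurd h.le hy
              · exact absurd h.le hy
              · rw [U_lt_par x y hx h, U_par_lt _ z (hpar y h) hz, U_par_lt y z h hz,
                  U_lt_par x _ hx (hpar y h)]
              · rw [U_low_gt x y hx.le h, U_gt_low y z h hz.le, U_low_gt x y hx.le h]
            · rw [U_right, U_right]
          · rw [U_top y z hy hz, U_top_right, U_comm x y, U_top _ z (U_not_le y x hy) hz]
      · rw [U_left, U_left]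
    have U_assoc : ∀ x y z, U (U x y) z = U x (U y z) := fun x y z => by
      by_cases hx : x ≤ e
      · exact assoc_of_le x y z hx
      by_cases hz : z ≤ e
      · rw [U_comm _ z, U_comm x y, U_comm x, U_comm y z, assoc_of_le z y x hz]
      · rw [U_top _ z (U_not_le x y hx) hz, U_comm y z, U_top x _ hx (U_not_le z y hz)]
    refine ⟨U_comm, U_assoc, U_mono, fun x y z h => ?_, U_left⟩
    rw [U_comm z x, U_comm z y]
    exact U_mono x y z h
end

section
/- Let e ∈ L \ {0,1}, S a t-conorm on [e,1], and cl₁, cl₂ closure operators on L with cl₁(x) ≤ cl₂(x) for all x ∈ L \ [e,1]. Define U : L² → L by: U(x,y) = S(x,y) if (x,y) ∈ [e,1[²; U(x,y) = x if (x,y) ∈ ([0,e[ ∪ I_e) × {e}; U(x,y) = y if (x,y) ∈ {e} × ([0,e[ ∪ I_e); U(x,y) = cl₁(x) ∧ (x ∨ e) if (x,y) ∈ ]0,e[ × ]e,1[; U(x,y) = cl₁(y) ∧ (y ∨ e) if (x,y) ∈ ]e,1[ × ]0,e[; U(x,y) = cl₂(x) ∧ (x ∨ e) if (x,y) ∈ I_e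 × ]e,1[; U(x,y) = cl₂(y) ∧ (y ∨ e) if (x,y) ∈ ]e,1[ × I_e; U(x,y) = 1 if (x,y) ∈ L × {1} ∪ {1} × L; and U(x,y) = 0 otherwise. Suppose that cl₁(x) ∉ [e,1] for all x ∈ ]0,e[ and cl₂(x) ∉ [e,1] for all x ∈ I_e. Then U is a uninorm on L with neutral element e if and only if S(x,y) < 1 for all x, y ∈ ]e,1[. -/
section LowAction

variable {L : Type*} [Lattice L] [BoundedOrder L] {e : L} {U : L → L → L} {g : L → L}

/-- The position of an element relative to `e`: the last three cases form `[e, ⊤]`. -/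
theorem low_or_eq_or_mem_or_eq_top (e x : L) :
    ¬ e ≤ x ∨ x = e ∨ x ∈ Set.Ioo e ⊤ ∨ x = ⊤ := by
  by_cases h : e ≤ x
  · rcases h.eq_or_lt with h | h
    · exact .inr (.inl h.symm)
    · rcases eq_or_ne x ⊤ with ht | ht
      · exact .inr (.inr (.inr ht))
      · exact .inr (.inr (.inl ⟨h, ht.lt_top⟩))
  · exact .inl h

theorem uninorm_comm_of_low_action
    (hel : ∀ x, U e x = x) (hle : ∀ x, U x e = x)
    (htl : ∀ x, U ⊤ x = ⊤) (hlt : ∀ x, U x ⊤ = ⊤)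
    (hll : ∀ x y, ¬ e ≤ x → ¬ e ≤ y → U x y = ⊥)
    (hlb : ∀ x, ¬ e ≤ x → ∀ y ∈ Set.Ioo e ⊤, U x y = g x)
    (hbl : ∀ x, ¬ e ≤ x → ∀ y ∈ Set.Ioo e ⊤, U y x = g x)
    (hbb : ∀ x ∈ Set.Ioo e ⊤, ∀ y ∈ Set.Ioo e ⊤, U x y = U y x) (x y : L) :
    U x y = U y x := by
  rcases low_or_eq_or_mem_or_eq_top e x with hx | rfl | hx | rfl
  · rcases low_or_eq_or_mem_or_eq_top e y with hy | rfl | hy | rfl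
    · rw [hll x y hx hy, hll y x hy hx]
    · rw [hel, hle]
    · rw [hlb x hx y hy, hbl x hx y hy]
    · rw [htl, hlt]
  · rw [hel, hle]
  · rcases low_or_eq_or_mem_or_eq_top e y with hy | rfl | hy | rfl
    · rw [hlb y hy x hx, hbl y hy x hx]
    · rw [hel, hle]
    · exact hbb x hx y hy
    · rw [htl, hlt]
  · rw [htl, hlt]

theorem uninorm_assoc_of_low_action (he0 : e ≠ ⊥)
    (hel : ∀ x, U e x = x) (hle : ∀ x, U x e = x)
    (htl : ∀ x, U ⊤ x = ⊤) (hlt : ∀ x, U x ⊤ = ⊤)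
    (hll : ∀ x y, ¬ e ≤ x → ¬ e ≤ y → U x y = ⊥)
    (hlb : ∀ x, ¬ e ≤ x → ∀ y ∈ Set.Ioo e ⊤, U x y = g x)
    (hbl : ∀ x, ¬ e ≤ x → ∀ y ∈ Set.Ioo e ⊤, U y x = g x)
    (hgbot : g ⊥ = ⊥) (hglow : ∀ x, ¬ e ≤ x → ¬ e ≤ g x)
    (hgidem : ∀ x, ¬ e ≤ x → g (g x) = g x)
    (hbb : ∀ x ∈ Set.Ioo e ⊤, ∀ y ∈ Set.Ioo e ⊤, U x y ∈ Set.Ioo e ⊤)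
    (hassoc : ∀ x ∈ Set.Ioo e ⊤, ∀ y ∈ Set.Ioo e ⊤, ∀ z ∈ Set.Ioo e ⊤,
      U (U x y) z = U x (U y z)) (x y z : L) :
    U (U x y) z = U x (U y z) := by
  have hbot : ¬ e ≤ (⊥ : L) := fun h => he0 (le_bot_iff.mp h)
  rcases low_or_eq_or_mem_or_eq_top e x with hx | rfl | hx | rfl
  on_goal 2 => rw [hel, hel]
  on_goal 3 => rw [htl, htl, htl]
  all_goals rcases low_or_eq_or_mem_or_eq_top e y with hy | rfl | hy | rfl
  any_goals rw [hel, hle]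
  any_goals rw [htl, hlt, htl]
  all_goals rcases low_or_eq_or_mem_or_eq_top e z with hz | rfl | hz | rfl
  any_goals rw [hle, hle]
  any_goals rw [hlt, hlt, hlt]
  · rw [hll x y hx hy, hll y z hy hz, hll _ _ hbot hz, hll _ _ hx hbot]
  · rw [hll x y hx hy, hlb y hy z hz, hlb _ hbot z hz, hgbot, hll _ _ hx (hglow y hy)]
  · rw [hlb x hx y hy, hbl z hz y hy, hll _ _ (hglow x hx) hz, hll _ _ hx (hglow z hz)]
  · rw [hlb x hx y hy, hlb _ (hglow x hx) z hz, hgidem x hx, hlb x hx _ (hbb y hy z hz)]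
  · rw [hbl y hy x hx, hll y z hy hz, hll _ _ (hglow y hy) hz, hbl _ hbot x hx, hgbot]
  · rw [hbl y hy x hx, hlb y hy z hz, hlb _ (hglow y hy) z hz, hbl _ (hglow y hy) x hx]
  · rw [hbl z hz y hy, hbl z hz _ (hbb x hx y hy), hbl _ (hglow z hz) x hx, hgidem z hz]
  · exact hassoc x hx y hy z hz

theorem uninorm_mono_of_low_action
    (hel : ∀ x, U e x = x) (hle : ∀ x, U x e = x)
    (htl : ∀ x, U ⊤ x = ⊤) (hlt : ∀ x, U x ⊤ = ⊤)
    (hll : ∀ x y, ¬ e ≤ x → ¬ e ≤ y → U x y = ⊥)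
    (hlb : ∀ x, ¬ e ≤ x → ∀ y ∈ Set.Ioo e ⊤, U x y = g x)
    (hbl : ∀ x, ¬ e ≤ x → ∀ y ∈ Set.Ioo e ⊤, U y x = g x)
    (hgle : ∀ x, ¬ e ≤ x → x ≤ g x) (hgsup : ∀ x, ¬ e ≤ x → g x ≤ x ⊔ e)
    (hgmono : ∀ x y, ¬ e ≤ y → x ≤ y → g x ≤ g y)
    (hbb : ∀ x ∈ Set.Ico e ⊤, ∀ z ∈ Set.Ioo e ⊤, x ≤ U x z)
    (hmono : ∀ x ∈ Set.Ico e ⊤, ∀ y ∈ Set.Ico e ⊤, ∀ z ∈ Set.Ioo e ⊤,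
      x ≤ y → U x z ≤ U y z) (x y z : L) (hxy : x ≤ y) :
    U x z ≤ U y z := by
  rcases low_or_eq_or_mem_or_eq_top e z with hz | rfl | hz | rfl
  · by_cases hx : e ≤ x
    · rcases low_or_eq_or_mem_or_eq_top e y with hy | hy | hy | rfl
      · exact absurd (hx.trans hxy) hy
      · rw [hy] at hxy ⊢
        rw [le_antisymm hxy hx]
      · rw [hbl z hz y hy]
        rcases low_or_eq_or_mem_or_eq_top e x with hx' | rfl | hx' | rfl
        · exact absurd hx hx'
        · rw [hel]
          exact hgle z hz
        · rw [hbl z hz x hx']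
        · exact absurd hy.2 (not_lt_of_ge hxy)
      · rw [htl]
        exact le_top
    · rw [hll x z hx hz]
      exact bot_le
  · rwa [hle, hle]
  · by_cases hyt : y = ⊤
    · rw [hyt, htl]
      exact le_top
    by_cases hy : e ≤ y
    · have hy' : y ∈ Set.Ico e ⊤ := ⟨hy, Ne.lt_top hyt⟩
      by_cases hx : e ≤ x
      · exact hmono x ⟨hx, hxy.trans_lt hy'.2⟩ y hy' z hz hxy
      · rw [hlb x hx z hz]
        exact (hgsup x hx).trans ((sup_le hxy hy).trans (hbb y hy' z hz))
    · have hx : ¬ e ≤ x := fun h => hy (h.trans hxy)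
      rw [hlb x hx z hz, hlb y hy z hz]
      exact hgmono x y hy hxy
  · rw [hlt, hlt]

end LowAction

section TruncatedClosure

variable {L : Type*} [Lattice L]

theorem monotone_of_map_sup {c : L → L} (h : ∀ x y, c (x ⊔ y) = c x ⊔ c y) : Monotone c := by
  intro x y hxy
  have := h x y
  rw [sup_eq_right.mpr hxy] at this
  exact le_sup_left.trans this.ge

theorem le_truncated {c : L → L} (hle : ∀ x, x ≤ c x) (e x : L) : x ≤ c x ⊓ (x ⊔ e) :=
  le_inf (hle x) le_sup_left

theorem truncated_idem {c : L → L} (hle : ∀ x, x ≤ c x) (hmono : Monotone c)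
    (hidem : ∀ x, c (c x) = c x) (e x : L) :
    c (c x ⊓ (x ⊔ e)) ⊓ (c x ⊓ (x ⊔ e) ⊔ e) = c x ⊓ (x ⊔ e) := by
  apply le_antisymm
  · refine inf_le_inf ?_ (sup_le inf_le_right le_sup_right)
    rw [← hidem x]
    exact hmono (inf_le_left.trans (hidem x).le)
  · exact le_inf (hle _) le_sup_left

end TruncatedClosure

theorem uninorm_two_closure_top_iff {L : Type*} [Lattice L] [BoundedOrder L]
    (e : L) (he0 : e ≠ ⊥) (he1 : e ≠ ⊤)
    (S : L → L → L)
    (hS_mem : ∀ x ∈ Set.Icc e ⊤, ∀ y ∈ Set.Icc e ⊤, S x y ∈ Set.Icc e ⊤)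
    (hS_comm : ∀ x ∈ Set.Icc e ⊤, ∀ y ∈ Set.Icc e ⊤, S x y = S y x)
    (hS_assoc : ∀ x ∈ Set.Icc e ⊤, ∀ y ∈ Set.Icc e ⊤, ∀ z ∈ Set.Icc e ⊤, S (S x y) z = S x (S y z))
    (hS_mono₁ : ∀ x ∈ Set.Icc e ⊤, ∀ y ∈ Set.Icc e ⊤, ∀ z ∈ Set.Icc e ⊤, x ≤ y → S x z ≤ S y z)
    (hS_mono₂ : ∀ x ∈ Set.Icc e ⊤, ∀ y ∈ Set.Icc e ⊤, ∀ z ∈ Set.Icc e ⊤, x ≤ y → S z x ≤ S z y)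
    (hS_unit : ∀ x ∈ Set.Icc e ⊤, S e x = x)
    (cl₁ cl₂ : L → L)
    (hcl₁_le : ∀ x, x ≤ cl₁ x)
    (hcl₁_sup : ∀ x y, cl₁ (x ⊔ y) = cl₁ x ⊔ cl₁ y)
    (hcl₁_idem : ∀ x, cl₁ (cl₁ x) = cl₁ x)
    (hcl₂_le : ∀ x, x ≤ cl₂ x)
    (hcl₂_sup : ∀ x y, cl₂ (x ⊔ y) = cl₂ x ⊔ cl₂ y)
    (hcl₂_idem : ∀ x, cl₂ (cl₂ x) = cl₂ x)
    (hcl₁₂ : ∀ x, x ∉ Set.Icc e ⊤ → cl₁ x ≤ cl₂ x)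
    (U : L → L → L)
    (hU1 : ∀ x y, x ∈ Set.Ico e ⊤ ∧ y ∈ Set.Ico e ⊤ → U x y = S x y)
    (hU2 : ∀ x y, (x ∈ Set.Ico ⊥ e ∨ Par x e) ∧ y = e → U x y = x)
    (hU3 : ∀ x y, x = e ∧ (y ∈ Set.Ico ⊥ e ∨ Par y e) → U x y = y)
    (hU4 : ∀ x y, x ∈ Set.Ioo ⊥ e ∧ y ∈ Set.Ioo e ⊤ → U x y = cl₁ x ⊓ (x ⊔ e))
    (hU5 : ∀ x y, x ∈ Set.Ioo e ⊤ ∧ y ∈ Set.Ioo ⊥ e → U x y = cl₁ y ⊓ (y ⊔ e))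
    (hU6 : ∀ x y, Par x e ∧ y ∈ Set.Ioo e ⊤ → U x y = cl₂ x ⊓ (x ⊔ e))
    (hU7 : ∀ x y, x ∈ Set.Ioo e ⊤ ∧ Par y e → U x y = cl₂ y ⊓ (y ⊔ e))
    (hU8 : ∀ x y, x = ⊤ ∨ y = ⊤ → U x y = ⊤)
    (hU0 : ∀ x y, ¬(x ∈ Set.Ico e ⊤ ∧ y ∈ Set.Ico e ⊤) → ¬((x ∈ Set.Ico ⊥ e ∨ Par x e) ∧ y = e) → ¬(x = e ∧ (y ∈ Set.Ico ⊥ e ∨ Par y e)) → ¬(x ∈ Set.Ioo ⊥ e ∧ y ∈ Set.Ioo e ⊤) → ¬(x ∈ Set.Ioo e ⊤ ∧ y ∈ Set.Ioo ⊥ e) → ¬(Par x e ∧ y ∈ Set.Ioo e ⊤) → ¬(x ∈ Set.Ioo e ⊤ ∧ Par y e) → ¬(x = ⊤ ∨ y = ⊤) → U x y = ⊥)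
    (hcl₁cond : ∀ x ∈ Set.Ioo ⊥ e, cl₁ x ∉ Set.Icc e ⊤)
    (hcl₂cond : ∀ x, Par x e → cl₂ x ∉ Set.Icc e ⊤)
    :
    ((∀ x y, U x y = U y x) ∧ (∀ x y z, U (U x y) z = U x (U y z)) ∧
      (∀ x y z, x ≤ y → U x z ≤ U y z) ∧ (∀ x y z, x ≤ y → U z x ≤ U z y) ∧
      (∀ x, U e x = x)) ↔ (∀ x ∈ Set.Ioo e ⊤, ∀ y ∈ Set.Ioo e ⊤, S x y < ⊤) := by
  have hebot : ⊥ < e := bot_lt_iff_ne_bot.mpr he0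
  have hetop : e < ⊤ := lt_top_iff_ne_top.mpr he1
  have hlow : ∀ x, ¬ e ≤ x → x ∈ Set.Ico ⊥ e ∨ Par x e := fun x hx => by
    by_cases h : x ≤ e
    · exact .inl ⟨bot_le, lt_of_le_not_ge h hx⟩
    · exact .inr ⟨h, hx⟩
  have hS_unit' : ∀ x ∈ Set.Icc e ⊤, S x e = x := fun x hx => by
    rw [hS_comm x hx e ⟨le_rfl, le_top⟩, hS_unit x hx]
  have hel : ∀ x, U e x = x := fun x => by
    rcases low_or_eq_or_mem_or_eq_top e x with hx | rfl | hx | rfl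
    · exact hU3 e x ⟨rfl, hlow x hx⟩
    · rw [hU1 x x ⟨⟨le_rfl, hetop⟩, ⟨le_rfl, hetop⟩⟩, hS_unit x ⟨le_rfl, le_top⟩]
    · rw [hU1 e x ⟨⟨le_rfl, hetop⟩, ⟨hx.1.le, hx.2⟩⟩, hS_unit x ⟨hx.1.le, le_top⟩]
    · exact hU8 _ _ (.inr rfl)
  have hle : ∀ x, U x e = x := fun x => by
    rcases low_or_eq_or_mem_or_eq_top e x with hx | rfl | hx | rfl
    · exact hU2 x e ⟨hlow x hx, rfl⟩
    · exact hel x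
    · rw [hU1 x e ⟨⟨hx.1.le, hx.2⟩, ⟨le_rfl, hetop⟩⟩, hS_unit' x ⟨hx.1.le, le_top⟩]
    · exact hU8 _ _ (.inl rfl)
  have htl : ∀ x, U ⊤ x = ⊤ := fun x => hU8 _ _ (.inl rfl)
  have hlt : ∀ x, U x ⊤ = ⊤ := fun x => hU8 _ _ (.inr rfl)
  have hll : ∀ x y, ¬ e ≤ x → ¬ e ≤ y → U x y = ⊥ := fun x y hx hy => by
    apply hU0 x y
    · exact fun h => hx h.1.1
    · exact fun h => hy h.2.ge
    · exact fun h => hx h.1.ge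
    · exact fun h => hy h.2.1.le
    · exact fun h => hx h.1.1.le
    · exact fun h => hy h.2.1.le
    · exact fun h => hx h.1.1.le
    · rintro (rfl | rfl)
      · exact hx le_top
      · exact hy le_top
  have hbot_right : ∀ y ∈ Set.Ioo e ⊤, U ⊥ y = ⊥ := fun y hy => by
    apply hU0 ⊥ y
    · exact fun h => he0 (le_bot_iff.mp h.1.1)
    · exact fun h => hy.1.ne' h.2
    · exact fun h => he0 h.1.symm
    · exact fun h => h.1.1.ne rfl
    · exact fun h => not_lt_bot h.1.1
    · exact fun h => h.1.1 bot_le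
    · exact fun h => not_lt_bot h.1.1
    · rintro (h | h)
      · exact (hebot.trans hetop).ne h
      · exact hy.2.ne h
  have hbot_left : ∀ y ∈ Set.Ioo e ⊤, U y ⊥ = ⊥ := fun y hy => by
    apply hU0 y ⊥
    · exact fun h => he0 (le_bot_iff.mp h.2.1)
    · exact fun h => he0 h.2.symm
    · exact fun h => hy.1.ne' h.1
    · exact fun h => not_lt_bot h.2.1
    · exact fun h => h.2.1.ne rfl
    · exact fun h => not_lt_bot h.2.1
    · exact fun h => h.2.1 bot_le
    · rintro (h | h)
      · exact hy.2.ne h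
      · exact (hebot.trans hetop).ne h
  constructor
  · rintro ⟨-, hassoc, -⟩ x hx y hy
    refine lt_top_iff_ne_top.mpr fun h => (hebot.trans hetop).ne ?_
    have := hassoc x y ⊥
    rwa [hU1 x y ⟨⟨hx.1.le, hx.2⟩, ⟨hy.1.le, hy.2⟩⟩, h, htl, hbot_left y hy, hbot_left x hx,
      eq_comm] at this
  intro hSlt
  have hIcc : ∀ {x}, x ∈ Set.Ico e ⊤ → x ∈ Set.Icc e ⊤ := fun h => ⟨h.1, le_top⟩
  have hIco : ∀ {x}, x ∈ Set.Ioo e ⊤ → x ∈ Set.Ico e ⊤ := fun h => ⟨h.1.le, h.2⟩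
  have he : e ∈ Set.Icc e (⊤ : L) := ⟨le_rfl, le_top⟩
  have hSle : ∀ x ∈ Set.Icc e ⊤, ∀ y ∈ Set.Icc e ⊤, x ≤ S x y := fun x hx y hy => by
    simpa only [hS_unit' x hx] using hS_mono₂ e he y hy x hx hy.1
  have hUS : ∀ x ∈ Set.Ico e ⊤, ∀ y ∈ Set.Ico e ⊤, U x y = S x y :=
    fun x hx y hy => hU1 x y ⟨hx, hy⟩
  have hbb : ∀ x ∈ Set.Ioo e ⊤, ∀ y ∈ Set.Ioo e ⊤, U x y ∈ Set.Ioo e ⊤ := fun x hx y hy => by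
    rw [hUS x (hIco hx) y (hIco hy)]
    exact ⟨hx.1.trans_le (hSle x (hIcc (hIco hx)) y (hIcc (hIco hy))), hSlt x hx y hy⟩
  have hm₁ : Monotone cl₁ := monotone_of_map_sup hcl₁_sup
  have hm₂ : Monotone cl₂ := monotone_of_map_sup hcl₂_sup
  classical
  obtain ⟨g, hgbot, hg₁, hg₂⟩ : ∃ g : L → L, g ⊥ = ⊥ ∧
      (∀ x ∈ Set.Ioo ⊥ e, g x = cl₁ x ⊓ (x ⊔ e)) ∧ (∀ x, Par x e → g x = cl₂ x ⊓ (x ⊔ e)) := by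
    refine ⟨fun x => if x = ⊥ then ⊥ else if x < e then cl₁ x ⊓ (x ⊔ e) else cl₂ x ⊓ (x ⊔ e),
      if_pos rfl, fun x hx => ?_, fun x hx => ?_⟩
    · simp only [if_neg hx.1.ne', if_pos hx.2]
    · have hx0 : x ≠ ⊥ := fun h => hx.1 (h ▸ bot_le)
      simp only [if_neg hx0, if_neg fun h : x < e => hx.1 h.le]
  have hlow' : ∀ x, ¬ e ≤ x → x = ⊥ ∨ x ∈ Set.Ioo ⊥ e ∨ Par x e := fun x hx => by
    rcases eq_or_ne x ⊥ with h | h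
    · exact .inl h
    · exact .inr ((hlow x hx).imp_left fun h' => ⟨bot_lt_iff_ne_bot.mpr h, h'.2⟩)
  have hlb : ∀ x, ¬ e ≤ x → ∀ y ∈ Set.Ioo e ⊤, U x y = g x := fun x hx y hy => by
    rcases hlow' x hx with rfl | h | h
    · rw [hgbot, hbot_right y hy]
    · rw [hg₁ x h, hU4 x y ⟨h, hy⟩]
    · rw [hg₂ x h, hU6 x y ⟨h, hy⟩]
  have hbl : ∀ x, ¬ e ≤ x → ∀ y ∈ Set.Ioo e ⊤, U y x = g x := fun x hx y hy => by
    rcases hlow' x hx with rfl | h | h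
    · rw [hgbot, hbot_left y hy]
    · rw [hg₁ x h, hU5 y x ⟨hy, h⟩]
    · rw [hg₂ x h, hU7 y x ⟨hy, h⟩]
  have hgle : ∀ x, ¬ e ≤ x → x ≤ g x := fun x hx => by
    rcases hlow' x hx with rfl | h | h
    · exact bot_le
    · exact (hg₁ x h).symm ▸ le_truncated hcl₁_le e x
    · exact (hg₂ x h).symm ▸ le_truncated hcl₂_le e x
  have hgsup : ∀ x, ¬ e ≤ x → g x ≤ x ⊔ e := fun x hx => by
    rcases hlow' x hx with rfl | h | h
    · exact hgbot.trans_le bot_le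
    · exact (hg₁ x h).trans_le inf_le_right
    · exact (hg₂ x h).trans_le inf_le_right
  have hglow : ∀ x, ¬ e ≤ x → ¬ e ≤ g x := fun x hx hge => by
    rcases hlow' x hx with rfl | h | h
    · exact hx (hge.trans hgbot.le)
    · exact hcl₁cond x h ⟨hge.trans ((hg₁ x h).trans_le inf_le_left), le_top⟩
    · exact hcl₂cond x h ⟨hge.trans ((hg₂ x h).trans_le inf_le_left), le_top⟩
  have hgidem : ∀ x, ¬ e ≤ x → g (g x) = g x := fun x hx => by
    rcases hlow' x hx with rfl | h | h
    · rw [hgbot, hgbot]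
    · have hgx : g x ∈ Set.Ioo ⊥ e := ⟨h.1.trans_le (hgle x hx),
        lt_of_le_not_ge ((hgsup x hx).trans (sup_le h.2.le le_rfl)) (hglow x hx)⟩
      rw [hg₁ _ hgx, hg₁ x h]
      exact truncated_idem hcl₁_le hm₁ hcl₁_idem e x
    · have hgx : Par (g x) e := ⟨fun h' => h.1 ((hgle x hx).trans h'), hglow x hx⟩
      rw [hg₂ _ hgx, hg₂ x h]
      exact truncated_idem hcl₂_le hm₂ hcl₂_idem e x
  have hgmono : ∀ x y, ¬ e ≤ y → x ≤ y → g x ≤ g y := fun x y hy hxy => by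
    have hx : ¬ e ≤ x := fun h => hy (h.trans hxy)
    rcases hlow' x hx with rfl | h | h
    · exact hgbot.trans_le bot_le
    · rcases hlow' y hy with rfl | h' | h'
      · exact absurd (h.1.trans_le hxy) not_lt_bot
      · rw [hg₁ x h, hg₁ y h']
        exact inf_le_inf (hm₁ hxy) (sup_le_sup_right hxy e)
      · rw [hg₁ x h, hg₂ y h']
        exact inf_le_inf ((hm₁ hxy).trans (hcl₁₂ y fun hm => hy hm.1)) (sup_le_sup_right hxy e)
    · rcases hlow' y hy with rfl | h' | h'
      · exact absurd (hxy.trans bot_le) h.1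
      · exact absurd (hxy.trans h'.2.le) h.1
      · rw [hg₂ x h, hg₂ y h']
        exact inf_le_inf (hm₂ hxy) (sup_le_sup_right hxy e)
  have hcomm : ∀ x y, U x y = U y x :=
    uninorm_comm_of_low_action hel hle htl hlt hll hlb hbl fun x hx y hy => by
      rw [hUS x (hIco hx) y (hIco hy), hUS y (hIco hy) x (hIco hx),
        hS_comm x (hIcc (hIco hx)) y (hIcc (hIco hy))]
  have hmono : ∀ x y z, x ≤ y → U x z ≤ U y z := by
    refine uninorm_mono_of_low_action hel hle htl hlt hll hlb hbl hgle hgsup hgmono ?_ ?_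
    · intro x hx z hz
      rw [hUS x hx z (hIco hz)]
      exact hSle x (hIcc hx) z (hIcc (hIco hz))
    · intro x hx y hy z hz hxy
      rw [hUS x hx z (hIco hz), hUS y hy z (hIco hz)]
      exact hS_mono₁ x (hIcc hx) y (hIcc hy) z (hIcc (hIco hz)) hxy
  refine ⟨hcomm, ?_, hmono, fun x y z hxy => ?_, hel⟩
  · refine uninorm_assoc_of_low_action he0 hel hle htl hlt hll hlb hbl hgbot hglow hgidem hbb ?_
    intro x hx y hy z hz
    rw [hUS _ (hIco (hbb x hx y hy)) z (hIco hz), hUS x (hIco hx) _ (hIco (hbb y hy z hz)),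
      hUS x (hIco hx) y (hIco hy), hUS y (hIco hy) z (hIco hz)]
    exact hS_assoc x (hIcc (hIco hx)) y (hIcc (hIco hy)) z (hIcc (hIco hz))
  · rw [hcomm z x, hcomm z y]
    exact hmono x y z hxy
end

section
/- Let e ∈ L \ {0,1}, S a t-conorm on [e,1], and cl₁, cl₂ closure operators on L with cl₁(x) ≤ cl₂(x) for all x ∈ L \ [e,1]. Define U : L² → L by: U(x,y) = S(x,y) if (x,y) ∈ [e,1[²; U(x,y) = x if (x,y) ∈ ([0,e[ ∪ I_e) × {e}; U(x,y) = y if (x,y) ∈ {e} × ([0,e[ ∪ I_e); U(x,y) = cl₁(x) ∧ (x ∨ e) if (x,y) ∈ ]0,e[ × ]e,1[; U(x,y) = cl₁(y) ∧ (y ∨ e) if (x,y) ∈ ]e,1[ × ]0,e[; U(x,y) = cl₂(x) ∧ (x ∨ e) if (x,y) ∈ I_e × ]e,1[; U(x,y) = cl₂(y) ∧ (y ∨ e) if (x,y) ∈ ]e,1[ × I_e; U(x,y) = 1 if (x,y) ∈ L × {1} ∪ {1} × L; and U(x,y) = 0 otherwise. Suppose that ]e,1[ ≠ ∅. Then U is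 a uninorm on L with neutral element e if and only if S(x,y) < 1 for all x, y ∈ ]e,1[, cl₁(x) ∉ [e,1] for all x ∈ ]0,e[, and cl₂(x) ∉ [e,1] for all x ∈ I_e. -/
/-- Elements of a bounded lattice, sorted by their position relative to `e`. -/
theorem eq_top_or_eq_or_mem_Ioo_or_not_le {L : Type*} [Lattice L] [BoundedOrder L] (e x : L) :
    x = ⊤ ∨ x = e ∨ x ∈ Set.Ioo e ⊤ ∨ ¬ e ≤ x := by
  by_cases h : e ≤ x
  · rcases h.eq_or_lt with h | h
    · exact .inr (.inl h.symm)
    · rcases (le_top : x ≤ ⊤).eq_or_lt with h' | h'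
      · exact .inl h'
      · exact .inr (.inr (.inl ⟨h, h'⟩))
  · exact .inr (.inr (.inr h))

/-- An operation with annihilator `⊤` and neutral element `e` which vanishes on pairs of elements
not above `e`, and which maps a pair of an element `x` not above `e` and an element of `]e, ⊤[`
to `f x`, is a uninorm as soon as `f` is a closure-like map and `]e, ⊤[` is closed under a
monotone, associative and commutative operation. -/
theorem uninorm_of_table {L : Type*} [Lattice L] [BoundedOrder L] {e : L}
    {U : L → L → L} {f : L → L}
    (hTop : ∀ x, U x ⊤ = ⊤) (hTop' : ∀ x, U ⊤ x = ⊤)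
    (hE : ∀ x, U x e = x) (hE' : ∀ x, U e x = x)
    (hLL : ∀ x y, ¬ e ≤ x → ¬ e ≤ y → U x y = ⊥)
    (hLA : ∀ x, ¬ e ≤ x → ∀ y ∈ Set.Ioo e ⊤, U x y = f x)
    (hAL : ∀ x, ¬ e ≤ x → ∀ y ∈ Set.Ioo e ⊤, U y x = f x)
    (hA_mem : ∀ x ∈ Set.Ioo e ⊤, ∀ y ∈ Set.Ioo e ⊤, U x y ∈ Set.Ioo e ⊤)
    (hA_comm : ∀ x ∈ Set.Ioo e ⊤, ∀ y ∈ Set.Ioo e ⊤, U x y = U y x)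
    (hA_assoc : ∀ x ∈ Set.Ioo e ⊤, ∀ y ∈ Set.Ioo e ⊤, ∀ z ∈ Set.Ioo e ⊤,
      U (U x y) z = U x (U y z))
    (hA_mono : ∀ x ∈ Set.Ioo e ⊤, ∀ y ∈ Set.Ioo e ⊤, ∀ z ∈ Set.Ioo e ⊤, x ≤ y → U x z ≤ U y z)
    (hA_le : ∀ x ∈ Set.Ioo e ⊤, ∀ y ∈ Set.Ioo e ⊤, x ≤ U x y)
    (hf_bot : f ⊥ = ⊥)
    (hf_not_le : ∀ x, ¬ e ≤ x → ¬ e ≤ f x)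
    (hf_le : ∀ x, ¬ e ≤ x → x ≤ f x)
    (hf_le_sup : ∀ x, ¬ e ≤ x → f x ≤ x ⊔ e)
    (hf_idem : ∀ x, ¬ e ≤ x → f (f x) = f x)
    (hf_mono : ∀ x y, ¬ e ≤ x → ¬ e ≤ y → x ≤ y → f x ≤ f y) (he : ¬ e ≤ ⊥) :
    (∀ x y, U x y = U y x) ∧ (∀ x y z, U (U x y) z = U x (U y z)) ∧
      (∀ x y z, x ≤ y → U x z ≤ U y z) ∧ (∀ x y z, x ≤ y → U z x ≤ U z y) ∧
      (∀ x, U e x = x) := by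
  have comm : ∀ x y, U x y = U y x := by
    intro x y
    rcases eq_top_or_eq_or_mem_Ioo_or_not_le e x with rfl | rfl | hx | hx
    · rw [hTop, hTop']
    · rw [hE, hE']
    all_goals
      rcases eq_top_or_eq_or_mem_Ioo_or_not_le e y with rfl | rfl | hy | hy
      · rw [hTop, hTop']
      · rw [hE, hE']
    · exact hA_comm x hx y hy
    · rw [hLA y hy x hx, hAL y hy x hx]
    · rw [hLA x hx y hy, hAL x hx y hy]
    · rw [hLL x y hx hy, hLL y x hy hx]
  have mono : ∀ x y z, x ≤ y → U x z ≤ U y z := by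
    intro x y z hxy
    rcases eq_top_or_eq_or_mem_Ioo_or_not_le e z with rfl | rfl | hz | hz
    · rw [hTop, hTop]
    · rwa [hE, hE]
    · rcases eq_top_or_eq_or_mem_Ioo_or_not_le e y with rfl | rfl | hy | hy
      · rw [hTop']; exact le_top
      · rw [hE']
        rcases eq_top_or_eq_or_mem_Ioo_or_not_le y x with rfl | rfl | hx | hx
        · exact absurd (hz.1.trans_le le_top) (not_lt_of_ge hxy)
        · rw [hE']
        · exact absurd hxy (not_le_of_gt hx.1)
        · rw [hLA x hx z hz]
          exact (hf_le_sup x hx).trans (sup_le (hxy.trans hz.1.le) hz.1.le)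
      · rcases eq_top_or_eq_or_mem_Ioo_or_not_le e x with rfl | rfl | hx | hx
        · exact absurd hy.2 (not_lt_of_ge hxy)
        · rw [hE', hA_comm y hy z hz]; exact hA_le z hz y hy
        · exact hA_mono x hx y hy z hz hxy
        · rw [hLA x hx z hz]
          exact ((hf_le_sup x hx).trans (sup_le hxy hy.1.le)).trans (hA_le y hy z hz)
      · have hx : ¬ e ≤ x := fun h => hy (h.trans hxy)
        rw [hLA x hx z hz, hLA y hy z hz]
        exact hf_mono x y hx hy hxy
    · rcases eq_top_or_eq_or_mem_Ioo_or_not_le e x with rfl | rfl | hx | hx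
      · rw [top_le_iff.1 hxy]
      · rw [hE']
        rcases eq_top_or_eq_or_mem_Ioo_or_not_le x y with rfl | rfl | hy | hy
        · rw [hTop']; exact le_top
        · rw [hE']
        · rw [hAL z hz y hy]; exact hf_le z hz
        · exact absurd hxy hy
      · rw [hAL z hz x hx]
        rcases eq_top_or_eq_or_mem_Ioo_or_not_le e y with rfl | rfl | hy | hy
        · rw [hTop']; exact le_top
        · exact absurd hxy (not_le_of_gt hx.1)
        · rw [hAL z hz y hy]
        · exact absurd (hx.1.le.trans hxy) hy
      · rw [hLL x z hx hz]; exact bot_le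
  refine ⟨comm, ?_, mono, fun x y z h => ?_, hE'⟩
  · intro x y z
    rcases eq_top_or_eq_or_mem_Ioo_or_not_le e x with rfl | rfl | hx | hx
    · simp only [hTop']
    · simp only [hE']
    all_goals
      rcases eq_top_or_eq_or_mem_Ioo_or_not_le e y with rfl | rfl | hy | hy
      · simp only [hTop, hTop']
      · simp only [hE, hE']
    all_goals
      rcases eq_top_or_eq_or_mem_Ioo_or_not_le e z with rfl | rfl | hz | hz
      · simp only [hTop]
      · simp only [hE]
    · exact hA_assoc x hx y hy z hz
    · rw [hAL z hz _ (hA_mem x hx y hy), hAL z hz y hy, hAL _ (hf_not_le z hz) x hx, hf_idem z hz]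
    · rw [hAL y hy x hx, hLA _ (hf_not_le y hy) z hz, hLA y hy z hz,
        hAL _ (hf_not_le y hy) x hx]
    · rw [hAL y hy x hx, hLL _ _ (hf_not_le y hy) hz, hLL y z hy hz, hAL ⊥ he x hx, hf_bot]
    · rw [hLA x hx y hy, hLA _ (hf_not_le x hx) z hz, hLA x hx _ (hA_mem y hy z hz), hf_idem x hx]
    · rw [hLA x hx y hy, hLL _ _ (hf_not_le x hx) hz, hAL z hz y hy,
        hLL _ _ hx (hf_not_le z hz)]
    · rw [hLL x y hx hy, hLA ⊥ he z hz, hf_bot, hLA y hy z hz, hLL _ _ hx (hf_not_le y hy)]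
    · rw [hLL x y hx hy, hLL y z hy hz, hLL _ _ he hz, hLL _ _ hx he]
  · rw [comm z x, comm z y]; exact mono x y z h

/-- A map on a lattice that preserves binary suprema is monotone. -/
theorem monotone_of_map_sup_s13 {L : Type*} [Lattice L] {g : L → L}
    (hg : ∀ x y, g (x ⊔ y) = g x ⊔ g y) : Monotone g := fun x y h => by
  rw [← sup_eq_right.2 h, hg]; exact le_sup_left

/-- The map `x ↦ g x ⊓ (x ⊔ e)` inherits idempotence from a closure operator `g`. -/
theorem inf_sup_idem_of_closure {L : Type*} [Lattice L] {g : L → L} {e : L}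
    (hle : ∀ x, x ≤ g x) (hmono : Monotone g) (hidem : ∀ x, g (g x) = g x) (x : L) :
    g (g x ⊓ (x ⊔ e)) ⊓ (g x ⊓ (x ⊔ e) ⊔ e) = g x ⊓ (x ⊔ e) := by
  apply le_antisymm
  · refine inf_le_inf ?_ (sup_le inf_le_right le_sup_right)
    exact (hmono inf_le_left).trans (hidem x).le
  · exact le_inf (hle _) le_sup_left

theorem uninorm_two_closure_top_iff' {L : Type*} [Lattice L] [BoundedOrder L]
    (e : L) (he0 : e ≠ ⊥) (he1 : e ≠ ⊤)
    (S : L → L → L)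
    (hS_mem : ∀ x ∈ Set.Icc e ⊤, ∀ y ∈ Set.Icc e ⊤, S x y ∈ Set.Icc e ⊤)
    (hS_comm : ∀ x ∈ Set.Icc e ⊤, ∀ y ∈ Set.Icc e ⊤, S x y = S y x)
    (hS_assoc : ∀ x ∈ Set.Icc e ⊤, ∀ y ∈ Set.Icc e ⊤, ∀ z ∈ Set.Icc e ⊤, S (S x y) z = S x (S y z))
    (hS_mono₁ : ∀ x ∈ Set.Icc e ⊤, ∀ y ∈ Set.Icc e ⊤, ∀ z ∈ Set.Icc e ⊤, x ≤ y → S x z ≤ S y z)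
    (hS_mono₂ : ∀ x ∈ Set.Icc e ⊤, ∀ y ∈ Set.Icc e ⊤, ∀ z ∈ Set.Icc e ⊤, x ≤ y → S z x ≤ S z y)
    (hS_unit : ∀ x ∈ Set.Icc e ⊤, S e x = x)
    (cl₁ cl₂ : L → L)
    (hcl₁_le : ∀ x, x ≤ cl₁ x)
    (hcl₁_sup : ∀ x y, cl₁ (x ⊔ y) = cl₁ x ⊔ cl₁ y)
    (hcl₁_idem : ∀ x, cl₁ (cl₁ x) = cl₁ x)
    (hcl₂_le : ∀ x, x ≤ cl₂ x)
    (hcl₂_sup : ∀ x y, cl₂ (x ⊔ y) = cl₂ x ⊔ cl₂ y)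
    (hcl₂_idem : ∀ x, cl₂ (cl₂ x) = cl₂ x)
    (hcl₁₂ : ∀ x, x ∉ Set.Icc e ⊤ → cl₁ x ≤ cl₂ x)
    (U : L → L → L)
    (hU1 : ∀ x y, x ∈ Set.Ico e ⊤ ∧ y ∈ Set.Ico e ⊤ → U x y = S x y)
    (hU2 : ∀ x y, (x ∈ Set.Ico ⊥ e ∨ Par x e) ∧ y = e → U x y = x)
    (hU3 : ∀ x y, x = e ∧ (y ∈ Set.Ico ⊥ e ∨ Par y e) → U x y = y)
    (hU4 : ∀ x y, x ∈ Set.Ioo ⊥ e ∧ y ∈ Set.Ioo e ⊤ → U x y = cl₁ x ⊓ (x ⊔ e))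
    (hU5 : ∀ x y, x ∈ Set.Ioo e ⊤ ∧ y ∈ Set.Ioo ⊥ e → U x y = cl₁ y ⊓ (y ⊔ e))
    (hU6 : ∀ x y, Par x e ∧ y ∈ Set.Ioo e ⊤ → U x y = cl₂ x ⊓ (x ⊔ e))
    (hU7 : ∀ x y, x ∈ Set.Ioo e ⊤ ∧ Par y e → U x y = cl₂ y ⊓ (y ⊔ e))
    (hU8 : ∀ x y, x = ⊤ ∨ y = ⊤ → U x y = ⊤)
    (hU0 : ∀ x y, ¬(x ∈ Set.Ico e ⊤ ∧ y ∈ Set.Ico e ⊤) → ¬((x ∈ Set.Ico ⊥ e ∨ Par x e) ∧ y = e) → ¬(x = e ∧ (y ∈ Set.Ico ⊥ e ∨ Par y e)) → ¬(x ∈ Set.Ioo ⊥ e ∧ y ∈ Set.Ioo e ⊤) → ¬(x ∈ Set.Ioo e ⊤ ∧ y ∈ Set.Ioo ⊥ e) → ¬(Par x e ∧ y ∈ Set.Ioo e ⊤) → ¬(x ∈ Set.Ioo e ⊤ ∧ Par y e) → ¬(x = ⊤ ∨ y = ⊤) → U x y = ⊥)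
    (hne : (Set.Ioo e ⊤).Nonempty)
    :
    ((∀ x y, U x y = U y x) ∧ (∀ x y z, U (U x y) z = U x (U y z)) ∧
      (∀ x y z, x ≤ y → U x z ≤ U y z) ∧ (∀ x y z, x ≤ y → U z x ≤ U z y) ∧
      (∀ x, U e x = x)) ↔
      ((∀ x ∈ Set.Ioo e ⊤, ∀ y ∈ Set.Ioo e ⊤, S x y < ⊤) ∧
        (∀ x ∈ Set.Ioo ⊥ e, cl₁ x ∉ Set.Icc e ⊤) ∧ (∀ x, Par x e → cl₂ x ∉ Set.Icc e ⊤)) := by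
  obtain ⟨a, ha⟩ := hne
  have he : ¬ e ≤ ⊥ := fun h => he0 (le_bot_iff.1 h)
  have hA : ∀ x ∈ Set.Ioo e ⊤, x ∈ Set.Icc e ⊤ := fun x hx => ⟨hx.1.le, le_top⟩
  have hA' : ∀ x ∈ Set.Ioo e ⊤, x ∈ Set.Ico e ⊤ := fun x hx => ⟨hx.1.le, hx.2⟩
  have heI : e ∈ Set.Icc e ⊤ := ⟨le_rfl, le_top⟩
  have heo : e ∈ Set.Ico e ⊤ := ⟨le_rfl, lt_top_iff_ne_top.2 he1⟩
  have low : ∀ x, ¬ e ≤ x → x = ⊥ ∨ x ∈ Set.Ioo ⊥ e ∨ Par x e := by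
    intro x hx
    by_cases hxe : x ≤ e
    · rcases (bot_le : ⊥ ≤ x).eq_or_lt with h | h
      · exact .inl h.symm
      · exact .inr (.inl ⟨h, lt_of_le_not_ge hxe hx⟩)
    · exact .inr (.inr ⟨hxe, hx⟩)
  have low' : ∀ x, ¬ e ≤ x → x ∈ Set.Ico ⊥ e ∨ Par x e := by
    intro x hx
    by_cases hxe : x ≤ e
    · exact .inl ⟨bot_le, lt_of_le_not_ge hxe hx⟩
    · exact .inr ⟨hxe, hx⟩
  have hSA : ∀ x ∈ Set.Ioo e ⊤, ∀ y ∈ Set.Ioo e ⊤, U x y = S x y :=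
    fun x hx y hy => hU1 x y ⟨hA' x hx, hA' y hy⟩
  have hTop : ∀ x, U x ⊤ = ⊤ := fun x => hU8 x ⊤ (.inr rfl)
  have hTop' : ∀ x, U ⊤ x = ⊤ := fun x => hU8 ⊤ x (.inl rfl)
  have hE' : ∀ x, U e x = x := by
    intro x
    rcases eq_top_or_eq_or_mem_Ioo_or_not_le e x with rfl | rfl | hx | hx
    · exact hTop e
    · rw [hU1 _ _ ⟨heo, heo⟩, hS_unit _ heI]
    · rw [hU1 _ _ ⟨heo, hA' x hx⟩, hS_unit x (hA x hx)]
    · exact hU3 e x ⟨rfl, low' x hx⟩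
  have hE : ∀ x, U x e = x := by
    intro x
    rcases eq_top_or_eq_or_mem_Ioo_or_not_le e x with rfl | rfl | hx | hx
    · exact hTop' e
    · exact hE' _
    · rw [hU1 _ _ ⟨hA' x hx, heo⟩, hS_comm x (hA x hx) e heI, hS_unit x (hA x hx)]
    · exact hU2 x e ⟨low' x hx, rfl⟩
  have hLL : ∀ x y, ¬ e ≤ x → ¬ e ≤ y → U x y = ⊥ := by
    intro x y hx hy
    apply hU0
    · exact fun h => hx h.1.1
    · exact fun h => hy h.2.ge
    · exact fun h => hx h.1.ge
    · exact fun h => hy h.2.1.le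
    · exact fun h => hx h.1.1.le
    · exact fun h => hy h.2.1.le
    · exact fun h => hx h.1.1.le
    · rintro (rfl | rfl)
      · exact hx le_top
      · exact hy le_top
  have hbotA : ∀ y ∈ Set.Ioo e ⊤, U ⊥ y = ⊥ := by
    intro y hy
    apply hU0
    · exact fun h => he h.1.1
    · exact fun h => hy.1.ne' h.2
    · exact fun h => he0 h.1.symm
    · exact fun h => h.1.1.ne rfl
    · exact fun h => he h.1.1.le
    · exact fun h => h.1.1 bot_le
    · exact fun h => he h.1.1.le
    · rintro (h | h)
      · exact he (h ▸ le_top)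
      · exact hy.2.ne h
  have hAbot : ∀ y ∈ Set.Ioo e ⊤, U y ⊥ = ⊥ := by
    intro y hy
    apply hU0
    · exact fun h => he h.2.1
    · exact fun h => he0 h.2.symm
    · exact fun h => hy.1.ne' h.1
    · exact fun h => he h.2.1.le
    · exact fun h => h.2.1.ne rfl
    · exact fun h => he h.2.1.le
    · exact fun h => h.2.1 bot_le
    · rintro (h | h)
      · exact hy.2.ne h
      · exact he (h ▸ le_top)
  have hLA : ∀ x, ¬ e ≤ x → ∀ y ∈ Set.Ioo e ⊤, U x y = U x a := by
    intro x hx y hy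
    rcases low x hx with rfl | h | h
    · rw [hbotA y hy, hbotA a ha]
    · rw [hU4 x y ⟨h, hy⟩, hU4 x a ⟨h, ha⟩]
    · rw [hU6 x y ⟨h, hy⟩, hU6 x a ⟨h, ha⟩]
  have hAL : ∀ x, ¬ e ≤ x → ∀ y ∈ Set.Ioo e ⊤, U y x = U x a := by
    intro x hx y hy
    rcases low x hx with rfl | h | h
    · rw [hAbot y hy, hbotA a ha]
    · rw [hU5 y x ⟨hy, h⟩, hU4 x a ⟨h, ha⟩]
    · rw [hU7 y x ⟨hy, h⟩, hU6 x a ⟨h, ha⟩]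
  have hA_le : ∀ x ∈ Set.Ioo e ⊤, ∀ y ∈ Set.Ioo e ⊤, x ≤ S x y := by
    intro x hx y hy
    calc x = S x e := by rw [hS_comm x (hA x hx) e heI, hS_unit x (hA x hx)]
      _ ≤ S x y := hS_mono₂ e heI y (hA y hy) x (hA x hx) hy.1.le
  have mono₁ := monotone_of_map_sup_s13 hcl₁_sup
  have mono₂ := monotone_of_map_sup_s13 hcl₂_sup
  constructor
  · rintro ⟨-, assoc, -, -, -⟩
    have hS_lt : ∀ x ∈ Set.Ioo e ⊤, ∀ y ∈ Set.Ioo e ⊤, S x y < ⊤ := by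
      intro x hx y hy
      refine lt_top_iff_ne_top.2 fun h => he ?_
      have := assoc ⊥ x y
      rw [hbotA x hx, hbotA y hy, hSA x hx y hy, h, hTop] at this
      exact this ▸ le_top
    refine ⟨hS_lt, fun x hx h => ?_, fun x hx h => ?_⟩
    · have hfx : U x a = e := by
        rw [hU4 x a ⟨hx, ha⟩, sup_eq_right.2 hx.2.le]
        exact inf_eq_right.2 h.1
      have := assoc x a a
      rw [hSA a ha a ha, hLA x (not_le_of_gt hx.2) (S a a)
        ⟨ha.1.trans_le (hA_le a ha a ha), hS_lt a ha a ha⟩, hfx, hE'] at this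
      exact ha.1.ne' this
    · have hfx : U x a = x ⊔ e := by
        rw [hU6 x a ⟨hx, ha⟩]
        exact inf_eq_right.2 (sup_le (hcl₂_le x) h.1)
      have := assoc x x a
      rw [hLL x x hx.2 hx.2, hbotA a ha, hfx] at this
      by_cases ht : x ⊔ e = ⊤
      · rw [ht, hTop] at this
        exact he (this ▸ le_top)
      · have hxe : x ⊔ e ∈ Set.Ioo e ⊤ :=
          ⟨lt_of_le_of_ne le_sup_right fun h' => hx.1 (h' ▸ le_sup_left), lt_top_iff_ne_top.2 ht⟩
        rw [hLA x hx.2 _ hxe, hfx] at this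
        exact he (this ▸ le_sup_right)
  · rintro ⟨hS_lt, h₁, h₂⟩
    have hf₁ : ∀ x ∈ Set.Ioo ⊥ e, U x a = cl₁ x ⊓ (x ⊔ e) := fun x hx => hU4 x a ⟨hx, ha⟩
    have hf₂ : ∀ x, Par x e → U x a = cl₂ x ⊓ (x ⊔ e) := fun x hx => hU6 x a ⟨hx, ha⟩
    have hf_not_le : ∀ x, ¬ e ≤ x → ¬ e ≤ U x a := by
      intro x hx h
      rcases low x hx with rfl | hx | hx
      · exact he (hbotA a ha ▸ h)
      · exact h₁ x hx ⟨(hf₁ x hx ▸ h).trans inf_le_left, le_top⟩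
      · exact h₂ x hx ⟨(hf₂ x hx ▸ h).trans inf_le_left, le_top⟩
    have hf_le : ∀ x, ¬ e ≤ x → x ≤ U x a := by
      intro x hx
      rcases low x hx with rfl | hx | hx
      · exact bot_le
      · rw [hf₁ x hx]; exact le_inf (hcl₁_le x) le_sup_left
      · rw [hf₂ x hx]; exact le_inf (hcl₂_le x) le_sup_left
    have hf_le_sup : ∀ x, ¬ e ≤ x → U x a ≤ x ⊔ e := by
      intro x hx
      rcases low x hx with rfl | hx | hx
      · rw [hbotA a ha]; exact bot_le
      · rw [hf₁ x hx]; exact inf_le_right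
      · rw [hf₂ x hx]; exact inf_le_right
    have hf_idem : ∀ x, ¬ e ≤ x → U (U x a) a = U x a := by
      intro x hx
      rcases low x hx with rfl | hx' | hx'
      · rw [hbotA a ha, hbotA a ha]
      · have hm : U x a ∈ Set.Ioo ⊥ e :=
          ⟨hx'.1.trans_le (hf_le x hx), lt_of_le_not_ge
            ((hf_le_sup x hx).trans (sup_le hx'.2.le le_rfl)) (hf_not_le x hx)⟩
        rw [hf₁ _ hm, hf₁ x hx']
        exact inf_sup_idem_of_closure hcl₁_le mono₁ hcl₁_idem x
      · have hm : Par (U x a) e := ⟨fun h => hx'.1 ((hf_le x hx).trans h), hf_not_le x hx⟩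
        rw [hf₂ _ hm, hf₂ x hx']
        exact inf_sup_idem_of_closure hcl₂_le mono₂ hcl₂_idem x
    have hf_mono : ∀ x y, ¬ e ≤ x → ¬ e ≤ y → x ≤ y → U x a ≤ U y a := by
      intro x y hx hy hxy
      rcases low x hx with rfl | hx' | hx'
      · rw [hbotA a ha]; exact bot_le
      · rcases low y hy with rfl | hy' | hy'
        · exact absurd hxy (not_le_of_gt hx'.1)
        · rw [hf₁ x hx', hf₁ y hy']
          exact inf_le_inf (mono₁ hxy) (sup_le_sup_right hxy e)
        · rw [hf₁ x hx', hf₂ y hy']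
          exact inf_le_inf ((hcl₁₂ x fun h => hx h.1).trans (mono₂ hxy)) (sup_le_sup_right hxy e)
      · have hy' : Par y e := ⟨fun h => hx'.1 (hxy.trans h), hy⟩
        rw [hf₂ x hx', hf₂ y hy']
        exact inf_le_inf (mono₂ hxy) (sup_le_sup_right hxy e)
    have hS_mem' : ∀ x ∈ Set.Ioo e ⊤, ∀ y ∈ Set.Ioo e ⊤, S x y ∈ Set.Ioo e ⊤ :=
      fun x hx y hy => ⟨hx.1.trans_le (hA_le x hx y hy), hS_lt x hx y hy⟩
    refine uninorm_of_table (f := fun x => U x a) hTop hTop' hE hE' hLL hLA hAL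
      (fun x hx y hy => ?_) (fun x hx y hy => ?_) (fun x hx y hy z hz => ?_)
      (fun x hx y hy z hz hxy => ?_) (fun x hx y hy => ?_) (hbotA a ha)
      hf_not_le hf_le hf_le_sup hf_idem hf_mono he
    · rw [hSA x hx y hy]; exact hS_mem' x hx y hy
    · rw [hSA x hx y hy, hSA y hy x hx]; exact hS_comm x (hA x hx) y (hA y hy)
    · rw [hSA x hx y hy, hSA y hy z hz, hSA _ (hS_mem' x hx y hy) z hz,
        hSA x hx _ (hS_mem' y hy z hz)]
      exact hS_assoc x (hA x hx) y (hA y hy) z (hA z hz)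
    · rw [hSA x hx z hz, hSA y hy z hz]
      exact hS_mono₁ x (hA x hx) y (hA y hy) z (hA z hz) hxy
    · rw [hSA x hx y hy]; exact hA_le x hx y hy
end

section
/- Let U be the uninorm constructed in Theorem 3.19 (the piecewise operation built from a t-conorm S on [e,1] with S(x,y) < 1 for all x,y ∈ ]e,1[ and closure operators cl₁ ≤ cl₂ on L \ [e,1] with cl₁(x) ∉ [e,1] for all x ∈ ]0,e[ and cl₂(x) ∉ [e,1] for all x ∈ I_e, taking value 1 on L × {1} ∪ {1} × L). If ]0,e[ contains at most one element and I_e contains at most one element, or if any two distinct elements of ]0,e[ are incomparable and any two distinct elements of I_e are incomparable, then U belongs to the class U_min^1, i.e., U(x,y) = y for all (x,y) ∈ ]e,1[ × (L \ [e,1]) and U(1,y) = 1 for all y ∈ L \ [e,1]. -/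
theorem uninorm_two_closure_top_Umin_one {L : Type*} [Lattice L] [BoundedOrder L]
    (e : L) (he0 : e ≠ ⊥) (he1 : e ≠ ⊤)
    (S : L → L → L)
    (hS_mem : ∀ x ∈ Set.Icc e ⊤, ∀ y ∈ Set.Icc e ⊤, S x y ∈ Set.Icc e ⊤)
    (hS_comm : ∀ x ∈ Set.Icc e ⊤, ∀ y ∈ Set.Icc e ⊤, S x y = S y x)
    (hS_assoc : ∀ x ∈ Set.Icc e ⊤, ∀ y ∈ Set.Icc e ⊤, ∀ z ∈ Set.Icc e ⊤, S (S x y) z = S x (S y z))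
    (hS_mono₁ : ∀ x ∈ Set.Icc e ⊤, ∀ y ∈ Set.Icc e ⊤, ∀ z ∈ Set.Icc e ⊤, x ≤ y → S x z ≤ S y z)
    (hS_mono₂ : ∀ x ∈ Set.Icc e ⊤, ∀ y ∈ Set.Icc e ⊤, ∀ z ∈ Set.Icc e ⊤, x ≤ y → S z x ≤ S z y)
    (hS_unit : ∀ x ∈ Set.Icc e ⊤, S e x = x)
    (cl₁ cl₂ : L → L)
    (hcl₁_le : ∀ x, x ≤ cl₁ x)
    (hcl₁_sup : ∀ x y, cl₁ (x ⊔ y) = cl₁ x ⊔ cl₁ y)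
    (hcl₁_idem : ∀ x, cl₁ (cl₁ x) = cl₁ x)
    (hcl₂_le : ∀ x, x ≤ cl₂ x)
    (hcl₂_sup : ∀ x y, cl₂ (x ⊔ y) = cl₂ x ⊔ cl₂ y)
    (hcl₂_idem : ∀ x, cl₂ (cl₂ x) = cl₂ x)
    (hcl₁₂ : ∀ x, x ∉ Set.Icc e ⊤ → cl₁ x ≤ cl₂ x)
    (U : L → L → L)
    (hU1 : ∀ x y, x ∈ Set.Ico e ⊤ ∧ y ∈ Set.Ico e ⊤ → U x y = S x y)
    (hU2 : ∀ x y, (x ∈ Set.Ico ⊥ e ∨ Par x e) ∧ y = e → U x y = x)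
    (hU3 : ∀ x y, x = e ∧ (y ∈ Set.Ico ⊥ e ∨ Par y e) → U x y = y)
    (hU4 : ∀ x y, x ∈ Set.Ioo ⊥ e ∧ y ∈ Set.Ioo e ⊤ → U x y = cl₁ x ⊓ (x ⊔ e))
    (hU5 : ∀ x y, x ∈ Set.Ioo e ⊤ ∧ y ∈ Set.Ioo ⊥ e → U x y = cl₁ y ⊓ (y ⊔ e))
    (hU6 : ∀ x y, Par x e ∧ y ∈ Set.Ioo e ⊤ → U x y = cl₂ x ⊓ (x ⊔ e))
    (hU7 : ∀ x y, x ∈ Set.Ioo e ⊤ ∧ Par y e → U x y = cl₂ y ⊓ (y ⊔ e))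
    (hU8 : ∀ x y, x = ⊤ ∨ y = ⊤ → U x y = ⊤)
    (hU0 : ∀ x y, ¬(x ∈ Set.Ico e ⊤ ∧ y ∈ Set.Ico e ⊤) → ¬((x ∈ Set.Ico ⊥ e ∨ Par x e) ∧ y = e) → ¬(x = e ∧ (y ∈ Set.Ico ⊥ e ∨ Par y e)) → ¬(x ∈ Set.Ioo ⊥ e ∧ y ∈ Set.Ioo e ⊤) → ¬(x ∈ Set.Ioo e ⊤ ∧ y ∈ Set.Ioo ⊥ e) → ¬(Par x e ∧ y ∈ Set.Ioo e ⊤) → ¬(x ∈ Set.Ioo e ⊤ ∧ Par y e) → ¬(x = ⊤ ∨ y = ⊤) → U x y = ⊥)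
    (hSlt : ∀ x ∈ Set.Ioo e ⊤, ∀ y ∈ Set.Ioo e ⊤, S x y < ⊤)
    (hcl₁cond : ∀ x ∈ Set.Ioo ⊥ e, cl₁ x ∉ Set.Icc e ⊤)
    (hcl₂cond : ∀ x, Par x e → cl₂ x ∉ Set.Icc e ⊤)
    (hsmall : ((Set.Ioo ⊥ e).Subsingleton ∧ {x : L | Par x e}.Subsingleton) ∨
      ((∀ x ∈ Set.Ioo ⊥ e, ∀ y ∈ Set.Ioo ⊥ e, x ≠ y → Par x y) ∧
        (∀ x y, Par x e → Par y e → x ≠ y → Par x y)))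
    :
    (∀ x ∈ Set.Ioo e ⊤, ∀ y, y ∉ Set.Icc e ⊤ → U x y = y) ∧
      (∀ y, y ∉ Set.Icc e ⊤ → U ⊤ y = ⊤) := by
  have hanti₁ : ∀ x ∈ Set.Ioo ⊥ e, ∀ y ∈ Set.Ioo ⊥ e, x ≤ y → x = y := by
    intro x hx y hy hxy
    by_contra hne
    rcases hsmall with h | h
    · exact hne (h.1 hx hy)
    · exact (h.1 x hx y hy hne).1 hxy
  have hanti₂ : ∀ x y, Par x e → Par y e → x ≤ y → x = y := by
    intro x y hx hy hxy
    by_contra hne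
    rcases hsmall with h | h
    · exact hne (h.2 hx hy)
    · exact (h.2 x y hx hy hne).1 hxy
  refine ⟨fun x hx y hy => ?_, fun y _ => hU8 ⊤ y (Or.inl rfl)⟩
  have hey : ¬ e ≤ y := fun h => hy ⟨h, le_top⟩
  by_cases hye : y ≤ e
  · have hlt : y < e := lt_of_le_not_ge hye hey
    by_cases hbot : y = ⊥
    · subst hbot
      refine hU0 x ⊥ ?_ ?_ ?_ ?_ ?_ ?_ ?_ ?_
      · exact fun h => hey h.2.1
      · exact fun h => he0 h.2.symm
      · exact fun h => hx.1.ne' h.1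
      · exact fun h => hey h.2.1.le
      · exact fun h => lt_irrefl _ h.2.1
      · exact fun h => hey h.2.1.le
      · exact fun h => h.2.1 bot_le
      · rintro (h | h)
        · exact hx.2.ne h
        · exact hey (h ▸ le_top)
    · have hy' : y ∈ Set.Ioo ⊥ e := ⟨bot_lt_iff_ne_bot.2 hbot, hlt⟩
      rw [hU5 x y ⟨hx, hy'⟩, sup_eq_right.2 hye]
      have hle : y ≤ cl₁ y ⊓ e := le_inf (hcl₁_le y) hye
      refine (hanti₁ y hy' _ ⟨hy'.1.trans_le hle, lt_of_le_not_ge inf_le_right fun h => ?_⟩ hle).symm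
      exact hcl₁cond y hy' ⟨h.trans inf_le_left, le_top⟩
  · have hy' : Par y e := ⟨hye, hey⟩
    rw [hU7 x y ⟨hx, hy'⟩]
    have hle : y ≤ cl₂ y ⊓ (y ⊔ e) := le_inf (hcl₂_le y) le_sup_left
    refine (hanti₂ y _ hy' ⟨fun h => hye (hle.trans h), fun h => ?_⟩ hle).symm
    exact hcl₂cond y hy' ⟨h.trans inf_le_left, le_top⟩
end

section
/- Let e ∈ L \ {0,1}, S a t-conorm on [e,1], and cl a closure operator on L. Define U : L² → L by: U(x,y) = S(x,y) if (x,y) ∈ [e,1[²; U(x,y) = x if (x,y) ∈ ([0,e[ ∪ I_e) × {e}; U(x,y) = y if (x,y) ∈ {e} × ([0,e[ ∪ I_e); U(x,y) = cl(x) ∧ (x ∨ e) if (x,y) ∈ (]0,e[ ∪ I_e) × ]e,1[; U(x,y) = cl(y) ∧ (y ∨ e) if (x,y) ∈ ]e,1[ × (]0,e[ ∪ I_e); U(x,y) = 1 if (x,y) ∈ L × {1} ∪ {1} × L; and U(x,y) = 0 otherwise. Then: (1) if cl(x) ∉ [e,1] for all x ∈ ]0,e[ ∪ I_e, then U is a uninorm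 on L with neutral element e if and only if S(x,y) < 1 for all x, y ∈ ]e,1[; (2) if ]e,1[ ≠ ∅, then U is a uninorm on L with neutral element e if and only if S(x,y) < 1 for all x, y ∈ ]e,1[ and cl(x) ∉ [e,1] for all x ∈ ]0,e[ ∪ I_e. -/
/-- The Cayley table of the operation `U` with neutral element `e`, where `S` acts on `]e, ⊤[`,
and `f` gives the product of an element not above `e` with an element of `]e, ⊤[`. -/
structure UninormTable {L : Type*} [Lattice L] [BoundedOrder L] (e : L) (S : L → L → L)
    (f : L → L) (U : L → L → L) : Prop where
  unit_left : ∀ x, U e x = x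
  unit_right : ∀ x, U x e = x
  top_left : ∀ x, U ⊤ x = ⊤
  top_right : ∀ x, U x ⊤ = ⊤
  bot_left : ∀ x, x ≠ ⊤ → U ⊥ x = ⊥
  bot_right : ∀ x, x ≠ ⊤ → U x ⊥ = ⊥
  low_low : ∀ x y, ¬ e ≤ x → ¬ e ≤ y → U x y = ⊥
  low_high : ∀ x y, x ≠ ⊥ → ¬ e ≤ x → e < y → y ≠ ⊤ → U x y = f x
  high_low : ∀ x y, e < x → x ≠ ⊤ → y ≠ ⊥ → ¬ e ≤ y → U x y = f y
  high_high : ∀ x y, e < x → x ≠ ⊤ → e < y → y ≠ ⊤ → U x y = S x y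

theorem eq_bot_or_low_or_unit_or_high_or_eq_top {L : Type*} [Lattice L] [BoundedOrder L]
    (e x : L) :
    x = ⊥ ∨ (x ≠ ⊥ ∧ ¬ e ≤ x) ∨ e = x ∨ (e < x ∧ x ≠ ⊤) ∨ x = ⊤ := by
  by_cases hx : e ≤ x
  · rcases hx.eq_or_lt with h | h <;> tauto
  · tauto

theorem mem_Ioo_bot_or_par_iff {L : Type*} [Lattice L] [BoundedOrder L] {e x : L} (he : e ≠ ⊥) :
    (x ∈ Set.Ioo ⊥ e ∨ Par x e) ↔ x ≠ ⊥ ∧ ¬ e ≤ x := by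
  simp only [Set.mem_Ioo, Par, bot_lt_iff_ne_bot]
  rw [lt_iff_le_not_ge]
  by_cases hx : x = ⊥
  · simp [hx, he]
  · tauto

theorem mem_Ico_bot_or_par_iff {L : Type*} [Lattice L] [BoundedOrder L] {e x : L} :
    (x ∈ Set.Ico ⊥ e ∨ Par x e) ↔ ¬ e ≤ x := by
  simp only [Set.mem_Ico, Par, bot_le, true_and, lt_iff_le_not_ge]
  tauto

namespace UninormTable

variable {L : Type*} [Lattice L] [BoundedOrder L] {e : L} {S : L → L → L} {f : L → L}
  {U : L → L → L}

theorem comm (h : UninormTable e S f U) (he0 : e ≠ ⊥)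
    (hS : ∀ x y, e < x → e < y → S x y = S y x) (x y : L) : U x y = U y x := by
  obtain ⟨_, _, _, _, _, _, _, _, _, _⟩ := h
  have hbot : ¬ e ≤ ⊥ := by simpa using he0
  rcases eq_bot_or_low_or_unit_or_high_or_eq_top e x with rfl | hx | rfl | hx | rfl <;>
  rcases eq_bot_or_low_or_unit_or_high_or_eq_top e y with rfl | hy | rfl | hy | rfl <;>
  grind

theorem mono_left (h : UninormTable e S f U)
    (hS : ∀ x y z, e < x → e < y → e < z → x ≤ y → S x z ≤ S y z)
    (hS_left : ∀ x y, e < x → e < y → x ≤ S x y) (hS_right : ∀ x y, e < x → e < y → y ≤ S x y)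
    (hf : Monotone f) (hf_le : ∀ x, x ≤ f x) (hf_sup : ∀ x, f x ≤ x ⊔ e)
    (x y z : L) (hxy : x ≤ y) : U x z ≤ U y z := by
  obtain ⟨_, _, _, _, _, _, _, _, _, _⟩ := h
  have htop : e ≤ ⊤ := le_top
  have hbot : ∀ a : L, ⊥ ≤ a := fun _ => bot_le
  have hle_top : ∀ a : L, a ≤ ⊤ := fun _ => le_top
  have hf_high : ∀ x y, x ≤ y → e ≤ y → f x ≤ y := fun x y hxy hy =>
    (hf_sup x).trans (sup_le hxy hy)
  rcases eq_bot_or_low_or_unit_or_high_or_eq_top e x with rfl | hx | rfl | hx | rfl <;>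
  rcases eq_bot_or_low_or_unit_or_high_or_eq_top e y with rfl | hy | rfl | hy | rfl <;>
  rcases eq_bot_or_low_or_unit_or_high_or_eq_top e z with rfl | hz | rfl | hz | rfl <;>
  grind [Monotone]

theorem assoc (h : UninormTable e S f U) (he0 : e ≠ ⊥)
    (hS : ∀ x y z, e < x → e < y → e < z → S (S x y) z = S x (S y z))
    (hS_lt : ∀ x y, e < x → e < y → e < S x y)
    (hS_top : ∀ x y, e < x → x ≠ ⊤ → e < y → y ≠ ⊤ → S x y ≠ ⊤)
    (hf_idem : ∀ x, f (f x) = f x) (hf_bot : ∀ x, x ≠ ⊥ → f x ≠ ⊥)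
    (hf_low : ∀ x, x ≠ ⊥ → ¬ e ≤ x → ¬ e ≤ f x)
    (x y z : L) : U (U x y) z = U x (U y z) := by
  obtain ⟨_, _, _, _, _, _, _, _, _, _⟩ := h
  have hbot : ¬ e ≤ ⊥ := by simpa using he0
  have htop : e ≤ ⊤ := le_top
  rcases eq_bot_or_low_or_unit_or_high_or_eq_top e x with rfl | hx | rfl | hx | rfl <;>
  rcases eq_bot_or_low_or_unit_or_high_or_eq_top e y with rfl | hy | rfl | hy | rfl <;>
  rcases eq_bot_or_low_or_unit_or_high_or_eq_top e z with rfl | hz | rfl | hz | rfl <;>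
  grind

theorem lt_top_of_assoc (h : UninormTable e S f U) (he0 : e ≠ ⊥)
    (hU : ∀ x y z, U (U x y) z = U x (U y z)) {x y : L} (hx : x ∈ Set.Ioo e ⊤)
    (hy : y ∈ Set.Ioo e ⊤) : S x y < ⊤ := by
  refine lt_top_iff_ne_top.2 fun hxy => ?_
  have key := hU x y ⊥
  rw [h.high_high x y hx.1 hx.2.ne hy.1 hy.2.ne, hxy, h.top_left, h.bot_right y hy.2.ne,
    h.bot_right x hx.2.ne] at key
  exact he0 (le_bot_iff.1 (key ▸ le_top))

theorem not_le_of_assoc (h : UninormTable e S f U) (hU : ∀ x y z, U (U x y) z = U x (U y z))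
    (hf_le : ∀ x, x ≤ f x) {x y : L} (hx : x ≠ ⊥) (hex : ¬ e ≤ x) (hy : y ∈ Set.Ioo e ⊤) :
    ¬ e ≤ f x := by
  intro hle
  have key := hU x x y
  rw [h.low_low x x hex hex, h.bot_left y hy.2.ne, h.low_high x y hx hex hy.1 hy.2.ne] at key
  rcases hle.eq_or_lt with heq | hlt
  · exact hx (by rw [← heq, h.unit_right] at key; exact key.symm)
  by_cases htop : f x = ⊤
  · rw [htop, h.top_right] at key
    exact hx (le_bot_iff.1 (key ▸ le_top))
  · rw [h.low_high x (f x) hx hex hlt htop] at key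
    exact hx (le_bot_iff.1 (key ▸ hf_le x))

end UninormTable

theorem uninorm_one_closure_top_iff {L : Type*} [Lattice L] [BoundedOrder L]
    (e : L) (he0 : e ≠ ⊥) (he1 : e ≠ ⊤)
    (S : L → L → L)
    (hS_mem : ∀ x ∈ Set.Icc e ⊤, ∀ y ∈ Set.Icc e ⊤, S x y ∈ Set.Icc e ⊤)
    (hS_comm : ∀ x ∈ Set.Icc e ⊤, ∀ y ∈ Set.Icc e ⊤, S x y = S y x)
    (hS_assoc : ∀ x ∈ Set.Icc e ⊤, ∀ y ∈ Set.Icc e ⊤, ∀ z ∈ Set.Icc e ⊤, S (S x y) z = S x (S y z))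
    (hS_mono₁ : ∀ x ∈ Set.Icc e ⊤, ∀ y ∈ Set.Icc e ⊤, ∀ z ∈ Set.Icc e ⊤, x ≤ y → S x z ≤ S y z)
    (hS_mono₂ : ∀ x ∈ Set.Icc e ⊤, ∀ y ∈ Set.Icc e ⊤, ∀ z ∈ Set.Icc e ⊤, x ≤ y → S z x ≤ S z y)
    (hS_unit : ∀ x ∈ Set.Icc e ⊤, S e x = x)
    (cl : L → L)
    (hcl_le : ∀ x, x ≤ cl x)
    (hcl_sup : ∀ x y, cl (x ⊔ y) = cl x ⊔ cl y)
    (hcl_idem : ∀ x, cl (cl x) = cl x)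
    (U : L → L → L)
    (hU1 : ∀ x y, x ∈ Set.Ico e ⊤ ∧ y ∈ Set.Ico e ⊤ → U x y = S x y)
    (hU2 : ∀ x y, (x ∈ Set.Ico ⊥ e ∨ Par x e) ∧ y = e → U x y = x)
    (hU3 : ∀ x y, x = e ∧ (y ∈ Set.Ico ⊥ e ∨ Par y e) → U x y = y)
    (hU4 : ∀ x y, (x ∈ Set.Ioo ⊥ e ∨ Par x e) ∧ y ∈ Set.Ioo e ⊤ → U x y = cl x ⊓ (x ⊔ e))
    (hU5 : ∀ x y, x ∈ Set.Ioo e ⊤ ∧ (y ∈ Set.Ioo ⊥ e ∨ Par y e) → U x y = cl y ⊓ (y ⊔ e))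
    (hU6 : ∀ x y, x = ⊤ ∨ y = ⊤ → U x y = ⊤)
    (hU0 : ∀ x y, ¬(x ∈ Set.Ico e ⊤ ∧ y ∈ Set.Ico e ⊤) → ¬((x ∈ Set.Ico ⊥ e ∨ Par x e) ∧ y = e) → ¬(x = e ∧ (y ∈ Set.Ico ⊥ e ∨ Par y e)) → ¬((x ∈ Set.Ioo ⊥ e ∨ Par x e) ∧ y ∈ Set.Ioo e ⊤) → ¬(x ∈ Set.Ioo e ⊤ ∧ (y ∈ Set.Ioo ⊥ e ∨ Par y e)) → ¬(x = ⊤ ∨ y = ⊤) → U x y = ⊥)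
    :
    ((∀ x, (x ∈ Set.Ioo ⊥ e ∨ Par x e) → cl x ∉ Set.Icc e ⊤) →
        (((∀ x y, U x y = U y x) ∧ (∀ x y z, U (U x y) z = U x (U y z)) ∧
      (∀ x y z, x ≤ y → U x z ≤ U y z) ∧ (∀ x y z, x ≤ y → U z x ≤ U z y) ∧
      (∀ x, U e x = x)) ↔ (∀ x ∈ Set.Ioo e ⊤, ∀ y ∈ Set.Ioo e ⊤, S x y < ⊤))) ∧
    ((Set.Ioo e ⊤).Nonempty →
        (((∀ x y, U x y = U y x) ∧ (∀ x y z, U (U x y) z = U x (U y z)) ∧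
      (∀ x y z, x ≤ y → U x z ≤ U y z) ∧ (∀ x y z, x ≤ y → U z x ≤ U z y) ∧
      (∀ x, U e x = x)) ↔ ((∀ x ∈ Set.Ioo e ⊤, ∀ y ∈ Set.Ioo e ⊤, S x y < ⊤) ∧ (∀ x, (x ∈ Set.Ioo ⊥ e ∨ Par x e) → cl x ∉ Set.Icc e ⊤)))) := by
  have hcl_mono : Monotone cl := fun x y hxy => by
    rw [← sup_eq_right.2 hxy, hcl_sup]; exact le_sup_left
  set f : L → L := fun x => cl x ⊓ (x ⊔ e) with hf_def
  have hf : Monotone f := fun x y hxy => inf_le_inf (hcl_mono hxy) (sup_le_sup_right hxy e)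
  have hf_le : ∀ x, x ≤ f x := fun x => le_inf (hcl_le x) le_sup_left
  have hf_sup : ∀ x, f x ≤ x ⊔ e := fun x => inf_le_right
  have hf_idem : ∀ x, f (f x) = f x := fun x =>
    le_antisymm (le_inf (inf_le_left.trans ((hcl_mono inf_le_left).trans (hcl_idem x).le))
      (inf_le_right.trans (sup_le (hf_sup x) le_sup_right))) (hf_le _)
  have hf_ge : ∀ x, e ≤ f x ↔ cl x ∈ Set.Icc e ⊤ := fun x => by simp [hf_def]
  have mem : ∀ {x}, e ≤ x → x ∈ Set.Icc e ⊤ := fun h => ⟨h, le_top⟩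
  simp only [mem_Ioo_bot_or_par_iff he0, mem_Ico_bot_or_par_iff] at hU2 hU3 hU4 hU5 hU0
  simp only [Set.mem_Ico, Set.mem_Ioo, lt_top_iff_ne_top] at hU1 hU4 hU5 hU0
  have hbot : ¬ e ≤ ⊥ := by simpa using he0
  have hbt : (⊥ : L) ≠ ⊤ := fun h => he0 (le_bot_iff.1 (h ▸ le_top))
  have table : UninormTable e S f U := by
    have hS_unit' : ∀ x, e ≤ x → S x e = x := fun x hx => by
      rw [hS_comm x (mem hx) e (mem le_rfl), hS_unit x (mem hx)]
    refine ⟨fun x => ?_, fun x => ?_, fun x => hU6 _ _ (.inl rfl), fun x => hU6 _ _ (.inr rfl),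
      fun x hx => ?_, fun x hx => ?_, fun x y hx hy => ?_,
      fun x y hx hex hy hyt => hU4 x y ⟨⟨hx, hex⟩, hy, hyt⟩,
      fun x y hx hxt hy hey => hU5 x y ⟨⟨hx, hxt⟩, hy, hey⟩,
      fun x y hx hxt hy hyt => hU1 x y ⟨⟨hx.le, hxt⟩, hy.le, hyt⟩⟩
    · by_cases hx : e ≤ x
      · by_cases hxt : x = ⊤
        · rw [hxt, hU6 _ _ (.inr rfl)]
        · rw [hU1 e x ⟨⟨le_rfl, he1⟩, hx, hxt⟩, hS_unit x (mem hx)]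
      · exact hU3 e x ⟨rfl, hx⟩
    · by_cases hx : e ≤ x
      · by_cases hxt : x = ⊤
        · rw [hxt, hU6 _ _ (.inl rfl)]
        · rw [hU1 x e ⟨⟨hx, hxt⟩, le_rfl, he1⟩, hS_unit' x hx]
      · exact hU2 x e ⟨hx, rfl⟩
    · by_cases hxe : x = e
      · exact hU2 ⊥ x ⟨hbot, hxe⟩
      · apply hU0 <;> simp [hbot, hx, hxe, he0.symm, hbt]
    · by_cases hxe : x = e
      · exact hU3 x ⊥ ⟨hxe, hbot⟩
      · apply hU0 <;> simp [hbot, hx, hxe, he0.symm, hbt]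
    · have htop : ∀ {z}, ¬ e ≤ z → z ≠ ⊤ := fun hz h => hz (h ▸ le_top)
      apply hU0 <;> simp [hx, hy, mt le_of_lt hx, mt le_of_lt hy, mt Eq.ge hx, mt Eq.ge hy,
        htop hx, htop hy]
  have hS_left : ∀ x y, e < x → e < y → x ≤ S x y := fun x y hx hy => by
    have := hS_mono₂ e (mem le_rfl) y (mem hy.le) x (mem hx.le) hy.le
    rwa [hS_comm x (mem hx.le) e (mem le_rfl), hS_unit x (mem hx.le)] at this
  have hS_right : ∀ x y, e < x → e < y → y ≤ S x y := fun x y hx hy => by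
    rw [hS_comm x (mem hx.le) y (mem hy.le)]
    exact hS_left y x hy hx
  have comm := table.comm he0 fun x y hx hy => hS_comm x (mem hx.le) y (mem hy.le)
  have mono := table.mono_left
    (fun x y z hx hy hz => hS_mono₁ x (mem hx.le) y (mem hy.le) z (mem hz.le))
    hS_left hS_right hf hf_le hf_sup
  simp only [mem_Ioo_bot_or_par_iff he0, ← hf_ge]
  have sufficient (hcl : ∀ x, x ≠ ⊥ ∧ ¬ e ≤ x → ¬ e ≤ f x)
      (hS : ∀ x ∈ Set.Ioo e ⊤, ∀ y ∈ Set.Ioo e ⊤, S x y < ⊤) :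
      (∀ x y, U x y = U y x) ∧ (∀ x y z, U (U x y) z = U x (U y z)) ∧
      (∀ x y z, x ≤ y → U x z ≤ U y z) ∧ (∀ x y z, x ≤ y → U z x ≤ U z y) ∧
      (∀ x, U e x = x) := by
    refine ⟨comm, table.assoc he0
      (fun x y z hx hy hz => hS_assoc x (mem hx.le) y (mem hy.le) z (mem hz.le))
      (fun x y hx hy => hx.trans_le (hS_left x y hx hy))
      (fun x y hx hxt hy hyt => (hS x ⟨hx, hxt.lt_top⟩ y ⟨hy, hyt.lt_top⟩).ne)
      hf_idem (fun x hx h => hx (le_bot_iff.1 (h ▸ hf_le x)))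
      (fun x hx hex => hcl x ⟨hx, hex⟩), mono, fun x y z hxy => ?_, table.unit_left⟩
    rw [comm z x, comm z y]
    exact mono x y z hxy
  refine ⟨fun hcl => ⟨fun h x hx y hy => table.lt_top_of_assoc he0 h.2.1 hx hy, sufficient hcl⟩,
    fun ⟨b, hb⟩ => ⟨fun h => ⟨fun x hx y hy => table.lt_top_of_assoc he0 h.2.1 hx hy,
      fun x hx => table.not_le_of_assoc h.2.1 hf_le hx.1 hx.2 hb⟩, fun h => sufficient h.2 h.1⟩⟩
end
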